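/- arXiv:2511.22604 — 5 statements merged into one kernel-verified Lean document; each statement's English description precedes it below -/
import Mathlib

section
/- There exists an absolute constant C > 0 such that the following holds. Let G = (G_t)_{t ∈ ℕ, t ≥ 1} be an always-connected temporal graph on a vertex set of size n ≥ 2, and let D ≥ 1 be a real number such that the average temporal maximum degree of G is at most D. Then for every start vertex s, there exists a temporal exploration of G starting at s that spans at most C · n^{3/2} · sqrt(D · log₂ n) time steps. -/
/-- `w` is a temporal walk of `G` occupying vertex `w t` at each time `t ∈ [a, b]`. -/
def IsTemporalWalk {V : Type*} (G : ℕ → SimpleGraph V) (a b : ℕ) (w : ℕ → V) : Prop :=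
  ∀ t, a ≤ t → t < b → w t = w (t + 1) ∨ (G t).Adj (w t) (w (t + 1))

/-- There is a temporal walk from `x` at time `a` to `y` at time `b`. -/
def TemporalReach {V : Type*} (G : ℕ → SimpleGraph V) (a b : ℕ) (x y : V) : Prop :=
  ∃ w, IsTemporalWalk G a b w ∧ w a = x ∧ w b = y

/-- The vertices visited by `w` during `[a, b]`. -/
def visited {V : Type*} [DecidableEq V] (w : ℕ → V) (a b : ℕ) : Finset V :=
  (Finset.Icc a b).image w

section Walks

variable {V : Type*} {G : ℕ → SimpleGraph V}

theorem mem_visited [DecidableEq V] {w : ℕ → V} {a b : ℕ} {v : V} :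
    v ∈ visited w a b ↔ ∃ t, (a ≤ t ∧ t ≤ b) ∧ w t = v := by
  simp [visited]

theorem IsTemporalWalk.concat {a b c : ℕ} {w₁ w₂ : ℕ → V} (h₁ : IsTemporalWalk G a b w₁)
    (h₂ : IsTemporalWalk G b c w₂) (h : w₁ b = w₂ b) :
    IsTemporalWalk G a c (fun t => if t ≤ b then w₁ t else w₂ t) := by
  intro t hat htc
  rcases lt_trichotomy t b with htb | rfl | htb
  · have h' : t + 1 ≤ b := htb
    simpa only [htb.le, h', if_true] using h₁ t hat htb
  · have h' : ¬ t + 1 ≤ t := by omega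
    simpa only [le_refl, h', if_true, if_false, h] using h₂ t le_rfl htc
  · have h₁' : ¬ t ≤ b := by omega
    have h₂' : ¬ t + 1 ≤ b := by omega
    simpa only [h₁', h₂', if_false] using h₂ t htb.le htc

theorem visited_concat [DecidableEq V] {a b c : ℕ} {w₁ w₂ : ℕ → V} (hab : a ≤ b) (hbc : b ≤ c)
    (h : w₁ b = w₂ b) :
    visited w₁ a b ∪ visited w₂ b c ⊆ visited (fun t => if t ≤ b then w₁ t else w₂ t) a c := by
  intro v hv
  rw [Finset.mem_union, mem_visited, mem_visited] at hv
  rw [mem_visited]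
  rcases hv with ⟨t, ht, rfl⟩ | ⟨t, ht, rfl⟩
  · exact ⟨t, ⟨ht.1, ht.2.trans hbc⟩, by simp [ht.2]⟩
  · refine ⟨t, ⟨hab.trans ht.1, ht.2⟩, ?_⟩
    rcases ht.1.eq_or_lt with rfl | hlt
    · simpa using h
    · simp [not_le.mpr hlt]

theorem IsTemporalWalk.comp_min {a b : ℕ} {w : ℕ → V} (h : IsTemporalWalk G a b w) (c : ℕ) :
    IsTemporalWalk G a b (fun t => w (min t c)) := by
  intro t hat htb
  rcases lt_or_ge t c with htc | htc
  · simpa [min_eq_left htc.le, min_eq_left (Nat.succ_le_of_lt htc)] using h t hat htb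
  · left
    simp [min_eq_right htc, min_eq_right (htc.trans t.le_succ)]

theorem IsTemporalWalk.comp_max {a b : ℕ} {w : ℕ → V} (h : IsTemporalWalk G a b w) (c : ℕ) :
    IsTemporalWalk G a b (fun t => w (max t c)) := by
  intro t hat htb
  rcases lt_or_ge t c with htc | htc
  · left
    simp [max_eq_right htc.le, max_eq_right (Nat.succ_le_of_lt htc)]
  · simpa [max_eq_left htc, max_eq_left (htc.trans t.le_succ)] using h t hat htb

theorem TemporalReach.refl (a b : ℕ) (x : V) : TemporalReach G a b x x :=
  ⟨fun _ => x, fun _ _ _ => Or.inl rfl, rfl, rfl⟩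

theorem TemporalReach.trans {a b c : ℕ} {x y z : V} (hab : a ≤ b) (hbc : b ≤ c)
    (h₁ : TemporalReach G a b x y) (h₂ : TemporalReach G b c y z) : TemporalReach G a c x z := by
  obtain ⟨w₁, hw₁, rfl, rfl⟩ := h₁
  obtain ⟨w₂, hw₂, h, rfl⟩ := h₂
  refine ⟨_, hw₁.concat hw₂ h.symm, by simp [hab], ?_⟩
  rcases hbc.eq_or_lt with rfl | hlt
  · simpa using h.symm
  · simp [not_le.mpr hlt]

theorem TemporalReach.mono_right {a b c : ℕ} {x y : V} (hab : a ≤ b) (hbc : b ≤ c)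
    (h : TemporalReach G a b x y) : TemporalReach G a c x y :=
  h.trans hab hbc (.refl _ _ _)

theorem TemporalReach.mono_left {a b c : ℕ} {x y : V} (hab : a ≤ b) (hbc : b ≤ c)
    (h : TemporalReach G b c x y) : TemporalReach G a c x y :=
  (TemporalReach.refl _ _ _).trans hab hbc h

theorem TemporalReach.of_adj {t : ℕ} {x y : V} (h : (G t).Adj x y) :
    TemporalReach G t (t + 1) x y := by
  refine ⟨fun i => if i ≤ t then x else y, fun i hi hi' => ?_, by simp, by simp⟩
  obtain rfl : i = t := by omega
  right
  simpa using h

end Walks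

theorem SimpleGraph.Connected.exists_adj_mem_notMem {V : Type*} {H : SimpleGraph V}
    (hH : H.Connected) {K : Set V} {x y : V} (hx : x ∈ K) (hy : y ∉ K) :
    ∃ v z, v ∈ K ∧ z ∉ K ∧ H.Adj v z := by
  obtain ⟨p⟩ := hH.preconnected x y
  obtain ⟨d, -, h₁, h₂⟩ := p.exists_boundary_dart K hx hy
  exact ⟨d.fst, d.snd, h₁, h₂, d.adj⟩

/-- In an always-connected temporal graph every vertex can be reached in `n` time steps. -/
theorem temporalReach_of_connected {V : Type*} [Fintype V] {G : ℕ → SimpleGraph V}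
    (hG : ∀ t, (G t).Connected) (a : ℕ) (x y : V) :
    TemporalReach G a (a + Fintype.card V) x y := by
  classical
  have key : ∀ k, (∀ z, TemporalReach G a (a + k) x z) ∨
      k + 1 ≤ (Finset.univ.filter (TemporalReach G a (a + k) x)).card := by
    intro k
    induction k with
    | zero =>
      right
      exact Finset.card_pos.mpr ⟨x, by simpa using .refl _ _ _⟩
    | succ k ih =>
      rcases ih with ih | ih
      · exact .inl fun z => (ih z).mono_right (by omega) (by omega)
      · by_cases hall : ∀ z, TemporalReach G a (a + k) x z
        · exact .inl fun z => (hall z).mono_right (by omega) (by omega)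
        · right
          push Not at hall
          obtain ⟨z₀, hz₀⟩ := hall
          obtain ⟨v, z, hv, hz, hadj⟩ := (hG (a + k)).exists_adj_mem_notMem
            (K := {z | TemporalReach G a (a + k) x z}) (.refl _ _ _) hz₀
          refine Nat.succ_le_of_lt (lt_of_le_of_lt ih (Finset.card_lt_card ?_))
          refine (Finset.ssubset_iff_of_subset fun i hi => ?_).mpr ⟨z, ?_, ?_⟩
          · simp only [Finset.mem_filter_univ] at hi ⊢
            exact hi.mono_right (by omega) (by omega)
          · simp only [Finset.mem_filter_univ]
            exact TemporalReach.trans (by omega) (by omega) hv (.of_adj hadj)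
          · simpa using hz
  rcases key (Fintype.card V) with h | h
  · exact h y
  · have := Finset.card_le_univ (Finset.univ.filter
      (TemporalReach G a (a + Fintype.card V) x))
    omega

/-- Any sufficiently large set of vertices contains two distinct vertices the first of which
reaches the second within `T` time steps. -/
theorem exists_temporalReach_of_card_mul_gt {V : Type*} [Fintype V] {G : ℕ → SimpleGraph V}
    (hG : ∀ t, (G t).Connected) {d : V → ℕ} (hd : ∀ t v, ((G t).neighborSet v).ncard ≤ d v)
    (a T : ℕ) (S : Finset V) (hS : 2 ≤ S.card) (hST : ∑ v, (d v + 2) < S.card * T) :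
    ∃ x ∈ S, ∃ y ∈ S, x ≠ y ∧ TemporalReach G a (a + T) x y := by
  classical
  by_contra! hno
  have sep : ∀ x ∈ S, ∀ y ∈ S, ∀ t z, a ≤ t → t ≤ a + T → TemporalReach G a t x z →
      TemporalReach G t (a + T) z y → x = y := by
    intro x hx y hy t z h₁ h₂ h₃ h₄
    by_contra hxy
    exact hno x hx y hy hxy (h₃.trans h₁ h₂ h₄)
  have hex : ∀ p : V × ℕ, ∃ v z, p ∈ S ×ˢ Finset.Ico a (a + T) →
      TemporalReach G a p.2 p.1 v ∧ TemporalReach G (p.2 + 1) (a + T) v p.1 ∧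
      ¬ (TemporalReach G a p.2 p.1 z ∧ TemporalReach G (p.2 + 1) (a + T) z p.1) ∧
      (G p.2).Adj v z := by
    rintro ⟨x, t⟩
    by_cases hp : (x, t) ∈ S ×ˢ Finset.Ico a (a + T)
    · have hp' := hp
      rw [Finset.mem_product, Finset.mem_Ico] at hp'
      obtain ⟨hx, hat, htb⟩ := hp'
      dsimp only at hx hat htb
      obtain ⟨y, hy, hyx⟩ := Finset.exists_mem_ne (by omega : 1 < S.card) x
      obtain ⟨v, z, hv, hz, hadj⟩ := (hG t).exists_adj_mem_notMem
        (K := {z | TemporalReach G a t x z ∧ TemporalReach G (t + 1) (a + T) z x})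
        (x := x) (y := y) ⟨.refl _ _ _, .refl _ _ _⟩
        (fun h => hyx (sep x hx y hy t y hat htb.le h.1 (.refl _ _ _)).symm)
      exact ⟨v, z, fun _ => ⟨hv.1, hv.2, hz, hadj⟩⟩
    · exact ⟨x, x, fun h => absurd h hp⟩
  choose v z hvz using hex
  have hfib : ∀ u : V, ((S ×ˢ Finset.Ico a (a + T)).filter (fun p => z p = u)).card ≤ d u + 2 := by
    intro u
    set F := (S ×ˢ Finset.Ico a (a + T)).filter (fun p => z p = u) with hF
    have hmem : ∀ p ∈ F, p.1 ∈ S ∧ a ≤ p.2 ∧ p.2 < a + T ∧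
        TemporalReach G a p.2 p.1 (v p) ∧ TemporalReach G p.2 (a + T) (v p) p.1 ∧
        TemporalReach G a (p.2 + 1) p.1 u ∧ TemporalReach G p.2 (a + T) u p.1 ∧
        ¬ (TemporalReach G a p.2 p.1 u ∧ TemporalReach G (p.2 + 1) (a + T) u p.1) ∧
        (G p.2).Adj u (v p) := by
      intro p hp
      rw [hF, Finset.mem_filter] at hp
      obtain ⟨hp, rfl⟩ := hp
      obtain ⟨h₁, h₂, h₃, h₄⟩ := hvz p hp
      rw [Finset.mem_product, Finset.mem_Ico] at hp
      obtain ⟨hx, hat, htb⟩ := hp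
      exact ⟨hx, hat, htb, h₁, h₂.mono_left (by omega) (by omega),
        h₁.trans hat (by omega) (.of_adj h₄),
        TemporalReach.trans (by omega) (by omega) (.of_adj h₄.symm) h₂, h₃, h₄.symm⟩
    have h₁ : (F.filter fun p => TemporalReach G (p.2 + 1) (a + T) u p.1).card ≤ 1 := by
      have key : ∀ p ∈ F, ∀ q ∈ F, TemporalReach G (p.2 + 1) (a + T) u p.1 →
          TemporalReach G (q.2 + 1) (a + T) u q.1 → p.2 ≤ q.2 → p = q := by
        intro p hp q hq hp' hq' hpq
        obtain ⟨a1, a2, a3, a4, a5, a6, a7, a8, a9⟩ := hmem p hp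
        obtain ⟨b1, b2, b3, b4, b5, b6, b7, b8, b9⟩ := hmem q hq
        have hx : p.1 = q.1 := sep _ a1 _ b1 (q.2 + 1) u (by omega) (by omega)
          (a6.mono_right (by omega) (by omega)) hq'
        rcases hpq.eq_or_lt with h | h
        · exact Prod.ext hx h
        · exact absurd ⟨hx ▸ a6.mono_right (by omega) (by omega), hq'⟩ b8
      rw [Finset.card_le_one]
      intro p hp q hq
      rw [Finset.mem_filter] at hp hq
      rcases le_total p.2 q.2 with h | h
      · exact key p hp.1 q hq.1 hp.2 hq.2 h
      · exact (key q hq.1 p hp.1 hq.2 hp.2 h).symm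
    have h₂ : (F.filter fun p => TemporalReach G a p.2 p.1 u).card ≤ 1 := by
      have key : ∀ p ∈ F, ∀ q ∈ F, TemporalReach G a p.2 p.1 u →
          TemporalReach G a q.2 q.1 u → p.2 ≤ q.2 → p = q := by
        intro p hp q hq hp' hq' hpq
        obtain ⟨a1, a2, a3, a4, a5, a6, a7, a8, a9⟩ := hmem p hp
        obtain ⟨b1, b2, b3, b4, b5, b6, b7, b8, b9⟩ := hmem q hq
        have hx : p.1 = q.1 := sep _ a1 _ b1 p.2 u (by omega) (by omega) hp'
          (b7.mono_left (by omega) (by omega))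
        rcases hpq.eq_or_lt with h | h
        · exact Prod.ext hx h
        · exact absurd ⟨hp', hx ▸ b7.mono_left (by omega) (by omega)⟩ a8
      rw [Finset.card_le_one]
      intro p hp q hq
      rw [Finset.mem_filter] at hp hq
      rcases le_total p.2 q.2 with h | h
      · exact key p hp.1 q hq.1 hp.2 hq.2 h
      · exact (key q hq.1 p hp.1 hq.2 hp.2 h).symm
    have h₃ : (F.filter fun p => ¬ TemporalReach G (p.2 + 1) (a + T) u p.1 ∧
        ¬ TemporalReach G a p.2 p.1 u).card ≤ d u := by
      have key : ∀ p ∈ F, ∀ q ∈ F, ¬ TemporalReach G a q.2 q.1 u → q.2 ≤ p.2 := by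
        intro p hp q hq hq'
        obtain ⟨a1, a2, a3, a4, a5, a6, a7, a8, a9⟩ := hmem p hp
        obtain ⟨b1, b2, b3, b4, b5, b6, b7, b8, b9⟩ := hmem q hq
        by_contra! h
        have hx : p.1 = q.1 := sep _ a1 _ b1 q.2 u (by omega) (by omega)
          (a6.mono_right (by omega) (by omega)) b7
        exact hq' (hx ▸ a6.mono_right (by omega) (by omega))
      rcases Finset.eq_empty_or_nonempty (F.filter fun p =>
        ¬ TemporalReach G (p.2 + 1) (a + T) u p.1 ∧ ¬ TemporalReach G a p.2 p.1 u) with h | ⟨p₀, h₀⟩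
      · simp [h]
      · rw [Finset.mem_filter] at h₀
        have ht : ∀ p ∈ F, ¬ TemporalReach G a p.2 p.1 u → p.2 = p₀.2 := fun p hp hp' =>
          le_antisymm (key p₀ h₀.1 p hp hp') (key p hp p₀ h₀.1 h₀.2.2)
        refine le_trans ?_ (hd p₀.2 u)
        rw [← Set.ncard_coe_finset]
        refine Set.ncard_le_ncard_of_injOn v ?_ ?_ (Set.toFinite _)
        · intro p hp
          rw [Finset.mem_coe, Finset.mem_filter] at hp
          rw [SimpleGraph.mem_neighborSet, ← ht p hp.1 hp.2.2]
          exact (hmem p hp.1).2.2.2.2.2.2.2.2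
        · intro p hp q hq hpq
          rw [Finset.mem_coe, Finset.mem_filter] at hp hq
          obtain ⟨a1, a2, a3, a4, a5, -⟩ := hmem p hp.1
          obtain ⟨b1, b2, b3, b4, b5, -⟩ := hmem q hq.1
          have htt : p.2 = q.2 := (ht p hp.1 hp.2.2).trans (ht q hq.1 hq.2.2).symm
          refine Prod.ext (sep _ a1 _ b1 p.2 (v p) a2 a3.le a4 ?_) htt
          rw [hpq, htt]
          exact b5
    have hsub : F ⊆ (F.filter fun p => TemporalReach G (p.2 + 1) (a + T) u p.1) ∪
        (F.filter fun p => TemporalReach G a p.2 p.1 u) ∪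
        (F.filter fun p => ¬ TemporalReach G (p.2 + 1) (a + T) u p.1 ∧
          ¬ TemporalReach G a p.2 p.1 u) := by
      intro p hp
      simp only [Finset.mem_union, Finset.mem_filter]
      tauto
    have := Finset.card_le_card hsub
    have := Finset.card_union_le ((F.filter fun p => TemporalReach G (p.2 + 1) (a + T) u p.1) ∪
        (F.filter fun p => TemporalReach G a p.2 p.1 u))
        (F.filter fun p => ¬ TemporalReach G (p.2 + 1) (a + T) u p.1 ∧
          ¬ TemporalReach G a p.2 p.1 u)
    have := Finset.card_union_le (F.filter fun p => TemporalReach G (p.2 + 1) (a + T) u p.1)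
        (F.filter fun p => TemporalReach G a p.2 p.1 u)
    omega
  have hcard := Finset.card_eq_sum_card_fiberwise (f := z) (s := S ×ˢ Finset.Ico a (a + T))
    (t := Finset.univ) (fun _ _ => by simp)
  rw [Finset.card_product, Nat.card_Ico, Nat.add_sub_cancel_left] at hcard
  have := Finset.sum_le_sum fun u (_ : u ∈ Finset.univ) => hfib u
  omega

section Cover

variable {V : Type*} [DecidableEq V] {G : ℕ → SimpleGraph V}

/-- A walk visiting part of `X` can be trimmed so as to end in `X`. -/
theorem IsTemporalWalk.exists_ending_in {a b : ℕ} {w : ℕ → V} (hw : IsTemporalWalk G a b w)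
    {X : Finset V} (hX : (X ∩ visited w a b).Nonempty) :
    ∃ x ∈ X, ∃ w', IsTemporalWalk G a b w' ∧ w' b = x ∧
      X ∩ visited w a b ⊆ visited w' a b := by
  have hne : ((Finset.Icc a b).filter fun t => w t ∈ X).Nonempty := by
    obtain ⟨v, hv⟩ := hX
    rw [Finset.mem_inter, mem_visited] at hv
    obtain ⟨hvX, t, ht, rfl⟩ := hv
    exact ⟨t, by simp [ht, hvX]⟩
  set c := Finset.max' _ hne with hc
  have hcm := Finset.max'_mem _ hne
  rw [← hc, Finset.mem_filter, Finset.mem_Icc] at hcm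
  refine ⟨w c, hcm.2, _, hw.comp_min c, by simp [min_eq_right hcm.1.2], fun v hv => ?_⟩
  rw [Finset.mem_inter, mem_visited] at hv
  obtain ⟨hvX, t, ht, rfl⟩ := hv
  rw [mem_visited]
  have htc : t ≤ c := Finset.le_max' _ _ (by simp [ht, hvX])
  exact ⟨t, ht, by simp [min_eq_left htc]⟩

/-- A walk visiting part of `X` can be trimmed so as to start in `X`. -/
theorem IsTemporalWalk.exists_starting_in {a b : ℕ} {w : ℕ → V} (hw : IsTemporalWalk G a b w)
    {X : Finset V} (hX : (X ∩ visited w a b).Nonempty) :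
    ∃ x ∈ X, ∃ w', IsTemporalWalk G a b w' ∧ w' a = x ∧
      X ∩ visited w a b ⊆ visited w' a b := by
  have hne : ((Finset.Icc a b).filter fun t => w t ∈ X).Nonempty := by
    obtain ⟨v, hv⟩ := hX
    rw [Finset.mem_inter, mem_visited] at hv
    obtain ⟨hvX, t, ht, rfl⟩ := hv
    exact ⟨t, by simp [ht, hvX]⟩
  set c := Finset.min' _ hne with hc
  have hcm := Finset.min'_mem _ hne
  rw [← hc, Finset.mem_filter, Finset.mem_Icc] at hcm
  refine ⟨w c, hcm.2, _, hw.comp_max c, by simp [max_eq_right hcm.1.1], fun v hv => ?_⟩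
  rw [Finset.mem_inter, mem_visited] at hv
  obtain ⟨hvX, t, ht, rfl⟩ := hv
  rw [mem_visited]
  have htc : c ≤ t := Finset.min'_le _ _ (by simp [ht, hvX])
  exact ⟨t, ht, by simp [max_eq_left htc]⟩

/-- Greedy selection of `m` elements of `X`, each with two attached `s`-subsets of `X`, such that
sets attached to distinct elements are disjoint. -/
theorem exists_greedy_disjoint {P Q : V → Finset V → Prop} {N s : ℕ}
    (h : ∀ X : Finset V, N ≤ X.card → ∃ x ∈ X, ∃ A B, A ⊆ X ∧ B ⊆ X ∧ A.card = s ∧ B.card = s ∧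
      x ∈ A ∧ P x A ∧ Q x B) (m : ℕ) :
    ∀ X : Finset V, N + 2 * s * m ≤ X.card → ∃ S ⊆ X, S.card = m ∧ ∃ A B : V → Finset V,
      (∀ x ∈ S, A x ⊆ X ∧ B x ⊆ X ∧ (A x).card = s ∧ (B x).card = s ∧ P x (A x) ∧ Q x (B x)) ∧
      ∀ x ∈ S, ∀ y ∈ S, x ≠ y → Disjoint (A x) (B y) := by
  induction m with
  | zero => exact fun X _ => ⟨∅, by simp, rfl, fun _ => ∅, fun _ => ∅, by simp, by simp⟩
  | succ m ih =>
    intro X hX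
    have hm : 2 * s * (m + 1) = 2 * s * m + 2 * s := by ring
    obtain ⟨x, hxX, A₀, B₀, hA₀, hB₀, hAc, hBc, hxA, hP, hQ⟩ := h X (by omega)
    have hcard : N + 2 * s * m ≤ (X \ (A₀ ∪ B₀)).card := by
      have h₁ := Finset.le_card_sdiff (A₀ ∪ B₀) X
      have h₂ := Finset.card_union_le A₀ B₀
      omega
    obtain ⟨S, hSX, hSc, A, B, hS, hdisj⟩ := ih _ hcard
    have hne : ∀ y ∈ S, y ≠ x := by
      rintro y hy rfl
      have := hSX hy
      simp [hxA] at this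
    have hxS : x ∉ S := fun hx => hne x hx rfl
    refine ⟨insert x S, ?_, by simp [hxS, hSc], Function.update A x A₀, Function.update B x B₀,
      ?_, ?_⟩
    · exact Finset.insert_subset hxX (hSX.trans Finset.sdiff_subset)
    · intro y hy
      rw [Finset.mem_insert] at hy
      rcases hy with rfl | hy
      · simp only [Function.update_self]
        exact ⟨hA₀, hB₀, hAc, hBc, hP, hQ⟩
      · simp only [Function.update_of_ne (hne y hy)]
        obtain ⟨h₁, h₂, h₃⟩ := hS y hy
        exact ⟨h₁.trans Finset.sdiff_subset, h₂.trans Finset.sdiff_subset, h₃⟩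
    · intro y hy z hz hyz
      rw [Finset.mem_insert] at hy hz
      rcases hy with rfl | hy <;> rcases hz with rfl | hz
      · exact absurd rfl hyz
      · rw [Function.update_self, Function.update_of_ne (hne z hz)]
        exact (Finset.disjoint_sdiff.mono_left Finset.subset_union_left).mono_right (hS z hz).2.1
      · rw [Function.update_self, Function.update_of_ne (hne y hy)]
        exact (Finset.sdiff_disjoint.mono_right Finset.subset_union_right).mono_left (hS y hy).1
      · rw [Function.update_of_ne (hne y hy), Function.update_of_ne (hne z hz)]
        exact hdisj y hy z hz hyz

/-- Any set of at least `2 ^ j * (1 + j * m)` vertices contains `2 ^ j` vertices that can be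
covered by one walk of `(2 ^ j - 1) * T` time steps. -/
theorem exists_walk_covering_two_pow [Fintype V] (hG : ∀ t, (G t).Connected) {d : V → ℕ}
    (hd : ∀ t v, ((G t).neighborSet v).ncard ≤ d v) {m T : ℕ} (hm : 2 ≤ m)
    (hmT : ∑ v, (d v + 2) < m * T) (j : ℕ) :
    ∀ (a : ℕ) (X : Finset V), 2 ^ j * (1 + j * m) ≤ X.card →
      ∃ w, IsTemporalWalk G a (a + (2 ^ j - 1) * T) w ∧
        2 ^ j ≤ (X ∩ visited w a (a + (2 ^ j - 1) * T)).card := by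
  induction j with
  | zero =>
    intro a X hX
    obtain ⟨x, hx⟩ : X.Nonempty := Finset.card_pos.mp (by simpa using hX)
    refine ⟨fun _ => x, fun _ _ _ => .inl rfl, Finset.card_pos.mpr ⟨x, ?_⟩⟩
    rw [Finset.mem_inter, mem_visited]
    exact ⟨hx, a, ⟨le_rfl, Nat.le_add_right _ _⟩, rfl⟩
  | succ j ih =>
    intro a X hX
    set s := 2 ^ j with hs
    have hs0 : 0 < s := by positivity
    set L := (s - 1) * T with hL
    set N := s * (1 + j * m) with hN
    have hlen : a + (2 ^ (j + 1) - 1) * T = a + L + T + L := by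
      obtain ⟨k, hk⟩ : ∃ k, s = k + 1 := ⟨s - 1, by omega⟩
      have : 2 ^ (j + 1) - 1 = 2 * k + 1 := by rw [pow_succ, ← hs]; omega
      rw [this, hL, hk, Nat.add_sub_cancel]
      ring
    have hXN : 2 * N + 2 * s * m ≤ X.card := by
      refine le_trans (le_of_eq ?_) hX
      rw [hN, pow_succ, ← hs]
      ring
    rw [hlen]
    let P : V → Finset V → Prop := fun x A =>
      ∃ w, IsTemporalWalk G a (a + L) w ∧ w (a + L) = x ∧ A ⊆ visited w a (a + L)
    let Q : V → Finset V → Prop := fun x A =>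
      ∃ w, IsTemporalWalk G (a + L + T) (a + L + T + L) w ∧ w (a + L + T) = x ∧
        A ⊆ visited w (a + L + T) (a + L + T + L)
    have hgood : ∀ Y : Finset V, 2 * N ≤ Y.card → ∃ x ∈ Y, ∃ A B, A ⊆ Y ∧ B ⊆ Y ∧ A.card = s ∧
        B.card = s ∧ x ∈ A ∧ P x A ∧ Q x B := by
      classical
      intro Y hY
      have hP : (Y.filter fun x => ¬ ∃ w, IsTemporalWalk G a (a + L) w ∧ w (a + L) = x ∧
          s ≤ (Y ∩ visited w a (a + L)).card).card < N := by
        by_contra hcon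
        obtain ⟨w, hw, hwc⟩ := ih a _ (not_lt.mp hcon)
        obtain ⟨x, hx, w', hw', hwx, hsub⟩ :=
          hw.exists_ending_in (Finset.card_pos.mp (hs0.trans_le hwc))
        rw [Finset.mem_filter] at hx
        refine hx.2 ⟨w', hw', hwx, hwc.trans (Finset.card_le_card ?_)⟩
        exact Finset.subset_inter (Finset.inter_subset_left.trans (Finset.filter_subset _ _)) hsub
      have hQ : (Y.filter fun x => ¬ ∃ w, IsTemporalWalk G (a + L + T) (a + L + T + L) w ∧
          w (a + L + T) = x ∧ s ≤ (Y ∩ visited w (a + L + T) (a + L + T + L)).card).card < N := by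
        by_contra hcon
        obtain ⟨w, hw, hwc⟩ := ih (a + L + T) _ (not_lt.mp hcon)
        obtain ⟨x, hx, w', hw', hwx, hsub⟩ :=
          hw.exists_starting_in (Finset.card_pos.mp (hs0.trans_le hwc))
        rw [Finset.mem_filter] at hx
        refine hx.2 ⟨w', hw', hwx, hwc.trans (Finset.card_le_card ?_)⟩
        exact Finset.subset_inter (Finset.inter_subset_left.trans (Finset.filter_subset _ _)) hsub
      obtain ⟨x, hxY, hx⟩ := Finset.exists_mem_notMem_of_card_lt_card
        (lt_of_lt_of_le (lt_of_le_of_lt (Finset.card_union_le _ _) (add_lt_add hP hQ))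
          (by omega : N + N ≤ Y.card))
      simp only [Finset.mem_union, Finset.mem_filter, hxY, true_and, not_or, not_not] at hx
      obtain ⟨⟨w₁, hw₁, hx₁, hc₁⟩, w₂, hw₂, hx₂, hc₂⟩ := hx
      have hmem : {x} ⊆ Y ∩ visited w₁ a (a + L) := by
        rw [Finset.singleton_subset_iff, Finset.mem_inter, mem_visited]
        exact ⟨hxY, a + L, ⟨by omega, le_rfl⟩, hx₁⟩
      obtain ⟨A, hxA, hA, hAc⟩ := Finset.exists_subsuperset_card_eq hmem
        (by rw [Finset.card_singleton]; exact hs0) hc₁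
      obtain ⟨B, hB, hBc⟩ := Finset.exists_subset_card_eq hc₂
      exact ⟨x, hxY, A, B, hA.trans Finset.inter_subset_left, hB.trans Finset.inter_subset_left,
        hAc, hBc, Finset.singleton_subset_iff.mp hxA,
        ⟨w₁, hw₁, hx₁, hA.trans Finset.inter_subset_right⟩,
        ⟨w₂, hw₂, hx₂, hB.trans Finset.inter_subset_right⟩⟩
    obtain ⟨S, -, hSc, A, B, hAB, hdisj⟩ := exists_greedy_disjoint hgood m X hXN
    obtain ⟨x, hx, y, hy, hxy, w, hw, hwx, hwy⟩ :=
      exists_temporalReach_of_card_mul_gt hG hd (a + L) T S (hSc ▸ hm) (hSc ▸ hmT)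
    obtain ⟨hAX, -, hAc, -, ⟨w₁, hw₁, hx₁, hA⟩, -⟩ := hAB x hx
    obtain ⟨-, hBX, -, hBc, -, ⟨w₂, hw₂, hy₂, hB⟩⟩ := hAB y hy
    have e₁ : w₁ (a + L) = w (a + L) := hx₁.trans hwx.symm
    have hv₁ := visited_concat (Nat.le_add_right a L) (Nat.le_add_right (a + L) T) e₁
    have hw₁₂ := hw₁.concat hw e₁
    set w₃ := fun t => if t ≤ a + L then w₁ t else w t with hw₃
    have e₂ : w₃ (a + L + T) = w₂ (a + L + T) := by
      rw [hy₂, ← hwy, hw₃]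
      rcases Nat.eq_zero_or_pos T with rfl | hT
      · simpa using e₁
      · simp [hT.ne']
    have hv₂ := visited_concat (by omega : a ≤ a + L + T) (Nat.le_add_right (a + L + T) L) e₂
    refine ⟨_, hw₁₂.concat hw₂ e₂, ?_⟩
    have hcard : 2 ^ (j + 1) = (A x ∪ B y).card := by
      rw [Finset.card_union_of_disjoint (hdisj x hx y hy hxy), hAc, hBc, pow_succ, mul_two]
    rw [hcard]
    refine Finset.card_le_card (Finset.subset_inter (Finset.union_subset hAX hBX) ?_)
    refine Finset.union_subset (hA.trans ?_) (hB.trans ?_)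
    · exact (Finset.subset_union_left.trans hv₁).trans (Finset.subset_union_left.trans hv₂)
    · exact Finset.subset_union_right.trans hv₂

/-- From any vertex, within `3 * n` time steps one can cover at least one vertex and at least
`√(|X| / (24 D log₂ n))` vertices of a nonempty set `X`. -/
theorem exists_walk_covering_sqrt [Fintype V] (hV : 2 ≤ Fintype.card V)
    (hG : ∀ t, (G t).Connected) {d : V → ℕ}
    (hd : ∀ t v, ((G t).neighborSet v).ncard ≤ d v) {D : ℝ} (hD : 1 ≤ D)
    (hdD : ((∑ v, d v : ℕ) : ℝ) ≤ D * Fintype.card V) (a : ℕ) (v : V) {X : Finset V}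
    (hX : X.Nonempty) :
    ∃ w, IsTemporalWalk G a (a + 3 * Fintype.card V) w ∧ w a = v ∧
      1 ≤ (X ∩ visited w a (a + 3 * Fintype.card V)).card ∧
      √(X.card : ℝ) ≤ 2 * √(6 * (D * Real.logb 2 (Fintype.card V))) *
        (X ∩ visited w a (a + 3 * Fintype.card V)).card := by
  set n := Fintype.card V with hn
  set l := Real.logb 2 n with hl
  have hn2 : (2 : ℝ) ≤ n := by exact_mod_cast hV
  have hl1 : 1 ≤ l := by
    rw [hl, Real.le_logb_iff_rpow_le (by norm_num) (by linarith)]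
    simpa using hn2
  have hDl : 1 ≤ D * l := one_le_mul_of_one_le_of_one_le hD hl1
  set K := 6 * (D * l) with hK
  have hK1 : 1 ≤ K := by linarith
  have hXn : (X.card : ℝ) ≤ n := by exact_mod_cast Finset.card_le_univ X
  have hX1 : 1 ≤ X.card := Finset.card_pos.mpr hX
  obtain ⟨j, hj, hju⟩ : ∃ j : ℕ, (j = 0 ∨ K * 4 ^ j ≤ X.card) ∧ (X.card : ℝ) ≤ 4 * K * 4 ^ j := by
    rcases lt_or_ge (X.card : ℝ) K with h | h
    · exact ⟨0, .inl rfl, by linarith⟩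
    · have h1 : 1 ≤ (X.card : ℝ) / K := by rwa [le_div_iff₀ (by linarith), one_mul]
      obtain ⟨j, h₁, h₂⟩ := exists_nat_pow_near h1 (by norm_num : (1 : ℝ) < 4)
      rw [le_div_iff₀ (by linarith)] at h₁
      rw [div_lt_iff₀ (by linarith), pow_succ] at h₂
      exact ⟨j, .inr (by linarith), by linarith⟩
  set s := 2 ^ j with hs
  have hs0 : 0 < s := by positivity
  have hsR : (s : ℝ) = 2 ^ j := by simp [hs]
  have hs1 : (1 : ℝ) ≤ s := by exact_mod_cast hs0
  have hs4 : (4 : ℝ) ^ j = s * s := by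
    rw [hsR, ← mul_pow]; norm_num
  have hsn : s ≤ n := by
    rcases hj with hj | hj
    · simp [hs, hj]; omega
    · have : (s : ℝ) ≤ n := by
        rw [hs4] at hj
        nlinarith
      exact_mod_cast this
  have hjl : (j : ℝ) ≤ l := by
    rw [hl, Real.le_logb_iff_rpow_le (by norm_num) (by linarith), Real.rpow_natCast, ← hsR]
    exact_mod_cast hsn
  set T := n / s + 1 with hT
  set m := ⌈3 * D * s⌉₊ + 1 with hm
  have hDs : 1 ≤ D * s := one_le_mul_of_one_le_of_one_le hD hs1
  have hm2 : 2 ≤ m := by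
    have : 0 < ⌈3 * D * s⌉₊ := Nat.ceil_pos.mpr (by linarith)
    omega
  have hmle : (m : ℝ) ≤ 5 * (D * s) := by
    have := Nat.ceil_lt_add_one (by linarith : 0 ≤ 3 * D * s)
    rw [hm]
    push_cast
    linarith
  have hmT : ∑ v, (d v + 2) < m * T := by
    have h₁ : (n : ℝ) < s * T := by
      have := Nat.lt_mul_div_succ n hs0
      exact_mod_cast this
    have h₂ : 3 * D * s < m := by
      have := Nat.le_ceil (3 * D * s)
      rw [hm]
      push_cast
      linarith
    have h₃ : ((∑ v, (d v + 2) : ℕ) : ℝ) = ((∑ v, d v : ℕ) : ℝ) + n * 2 := by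
      rw [Finset.sum_add_distrib]
      simp [hn]
    have h₄ : ((∑ v, (d v + 2) : ℕ) : ℝ) < ((m * T : ℕ) : ℝ) := by
      rw [h₃]
      push_cast at hdD ⊢
      have hT0 : (0 : ℝ) < T := by rw [hT]; positivity
      calc (∑ v, (d v : ℝ)) + n * 2 ≤ 3 * D * n := by nlinarith
        _ ≤ 3 * D * (s * T) := by gcongr
        _ = 3 * D * s * T := by ring
        _ < m * T := by gcongr
    exact_mod_cast h₄
  have hLn : (s - 1) * T ≤ 2 * n := by
    have h₁ : s * (n / s) ≤ n := Nat.mul_div_le n s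
    have h₂ : (s - 1) * T ≤ s * T := Nat.mul_le_mul_right _ (Nat.sub_le _ _)
    rw [hT, mul_add s, mul_one] at h₂
    rw [hT]
    omega
  have hsize : 2 ^ j * (1 + j * m) ≤ X.card := by
    rcases hj with hj | hj
    · simpa [hj] using hX1
    · have : ((2 ^ j * (1 + j * m) : ℕ) : ℝ) ≤ X.card := by
        push_cast
        rw [← hsR]
        have h₁ : (j : ℝ) * m ≤ l * (5 * (D * s)) := by gcongr
        have h₂ : 1 ≤ D * l * s := one_le_mul_of_one_le_of_one_le hDl hs1
        calc (s : ℝ) * (1 + j * m) ≤ s * (D * l * s + l * (5 * (D * s))) := by gcongr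
          _ = K * 4 ^ j := by rw [hs4, hK]; ring
          _ ≤ X.card := hj
      exact_mod_cast this
  obtain ⟨w₂, hw₂, hc⟩ := exists_walk_covering_two_pow hG hd hm2 hmT j (a + n) X hsize
  obtain ⟨w₁, hw₁, hv, h₁₂⟩ := temporalReach_of_connected hG a v (w₂ (a + n))
  rw [← hs] at hw₂ hc
  have hvis := visited_concat (Nat.le_add_right a n) (Nat.le_add_right (a + n) ((s - 1) * T)) h₁₂
  have hw := hw₁.concat hw₂ h₁₂
  set w := fun t => if t ≤ a + n then w₁ t else w₂ t with hwdef
  have hcard : s ≤ (X ∩ visited (fun t => w (min t (a + n + (s - 1) * T))) a (a + 3 * n)).card := by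
    refine hc.trans (Finset.card_le_card (Finset.inter_subset_inter_left fun u hu => ?_))
    have hu' := hvis (Finset.mem_union_right _ hu)
    rw [mem_visited] at hu' ⊢
    obtain ⟨t, ht, rfl⟩ := hu'
    exact ⟨t, ⟨ht.1, by omega⟩, by rw [min_eq_left ht.2]⟩
  refine ⟨fun t => w (min t (a + n + (s - 1) * T)), ?_, ?_, hs0.trans_le hcard, ?_⟩
  · intro t hat htb
    rcases lt_or_ge t (a + n + (s - 1) * T) with h | h
    · simpa only [min_eq_left h.le, min_eq_left (Nat.succ_le_of_lt h)] using hw t hat h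
    · left
      simp only [min_eq_right h, min_eq_right (h.trans t.le_succ)]
  · have : min a (a + n + (s - 1) * T) = a := by omega
    simp only [this, hwdef]
    simpa using hv
  · calc √(X.card : ℝ) ≤ √(4 * K * 4 ^ j) := Real.sqrt_le_sqrt hju
      _ = √((2 * s) ^ 2 * K) := by rw [hs4]; ring_nf
      _ = 2 * s * √K := by
        rw [Real.sqrt_mul (by positivity), Real.sqrt_sq (by positivity)]
      _ = 2 * √K * s := by ring
      _ ≤ _ := by
        gcongr

/-- If every nonempty set `X` can be met, from any vertex, in at least `√|X| / B` vertices within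
`L` time steps, then any set `X` can be covered in `2 L B √|X|` time steps. -/
theorem exists_walk_covering_of_sqrt_step {L : ℕ} {B : ℝ}
    (h : ∀ (a : ℕ) (v : V) (X : Finset V), X.Nonempty → ∃ w, IsTemporalWalk G a (a + L) w ∧
      w a = v ∧ 1 ≤ (X ∩ visited w a (a + L)).card ∧
      √(X.card : ℝ) ≤ B * (X ∩ visited w a (a + L)).card) (u : ℕ) :
    ∀ (a : ℕ) (v : V) (X : Finset V), X.card = u → ∃ (r : ℕ) (w : ℕ → V),
      IsTemporalWalk G a (a + r) w ∧ w a = v ∧ X ⊆ visited w a (a + r) ∧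
      (r : ℝ) ≤ 2 * L * B * √(u : ℝ) := by
  induction u using Nat.strong_induction_on with
  | _ u ih =>
    intro a v X hXu
    rcases X.eq_empty_or_nonempty with rfl | hX
    · refine ⟨0, fun _ => v, fun _ _ _ => .inl rfl, rfl, by simp, ?_⟩
      simp [← hXu]
    · obtain ⟨w₁, hw₁, hv, hg1, hg⟩ := h a v X hX
      set g := (X ∩ visited w₁ a (a + L)).card with hgdef
      have hsplit := Finset.card_sdiff_add_card_inter X (visited w₁ a (a + L))
      rw [← hgdef, hXu] at hsplit
      set u' := (X \ visited w₁ a (a + L)).card with hu'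
      obtain ⟨r, w₂, hw₂, h₁₂, hcov, hr⟩ := ih u' (by omega) (a + L) (w₁ (a + L)) _ rfl
      have hvis := visited_concat (Nat.le_add_right a L) (Nat.le_add_right (a + L) r) h₁₂.symm
      refine ⟨L + r, _, by rw [← add_assoc]; exact hw₁.concat hw₂ h₁₂.symm, by simpa using hv,
        fun x hx => ?_, ?_⟩
      · rw [← add_assoc]
        refine hvis (Finset.mem_union.mpr ?_)
        by_cases hxv : x ∈ visited w₁ a (a + L)
        · exact .inl hxv
        · exact .inr (hcov (Finset.mem_sdiff.mpr ⟨hx, hxv⟩))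
      · rw [hXu] at hg
        have hu : (u : ℝ) = u' + g := by exact_mod_cast hsplit.symm
        have hg1' : (1 : ℝ) ≤ g := by exact_mod_cast hg1
        have hu0 : 0 < √(u : ℝ) := Real.sqrt_pos.mpr (by rw [hu]; positivity)
        have hmono : √(u' : ℝ) ≤ √(u : ℝ) := Real.sqrt_le_sqrt (by rw [hu]; linarith)
        have hB : 0 < B := by
          by_contra! hB
          have := mul_nonpos_of_nonpos_of_nonneg hB (by linarith : (0 : ℝ) ≤ g)
          linarith
        have e₁ := Real.sq_sqrt (Nat.cast_nonneg (α := ℝ) u)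
        have e₂ := Real.sq_sqrt (Nat.cast_nonneg (α := ℝ) u')
        have hkey : 1 ≤ 2 * B * (√(u : ℝ) - √(u' : ℝ)) := by
          have h₁ : (√(u : ℝ) - √(u' : ℝ)) * (√(u : ℝ) + √(u' : ℝ)) = g := by
            linear_combination e₁ - e₂ + hu
          have h₂ : (g : ℝ) ≤ (√(u : ℝ) - √(u' : ℝ)) * (2 * √(u : ℝ)) := by
            rw [← h₁]
            exact mul_le_mul_of_nonneg_left (by linarith) (by linarith)
          have h₃ := mul_le_mul_of_nonneg_left h₂ hB.le
          by_contra! hcon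
          have := mul_lt_mul_of_pos_right hcon hu0
          linarith
        have := mul_le_mul_of_nonneg_left hkey (Nat.cast_nonneg (α := ℝ) L)
        push_cast
        linarith

end Cover

/-- There is an absolute constant `C > 0` such that any always-connected
temporal graph `(G_t)_{t ≥ 1}` on `n ≥ 2` vertices with average temporal maximum degree
at most `D` (`D ≥ 1`) admits, from any start vertex `s`, a temporal exploration spanning
at most `C · n^{3/2} · √(D · log₂ n)` time steps. -/
theorem temporal_exploration_avg_temporal_max_degree :
    ∃ C : ℝ, 0 < C ∧
      ∀ (V : Type) [Fintype V] (G : ℕ → SimpleGraph V) (D : ℝ),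
        2 ≤ Fintype.card V → 1 ≤ D →
        (∀ t : ℕ, 1 ≤ t → (G t).Connected) →
        ((∑ v : V, ⨆ t : ℕ, ⨆ _ : 1 ≤ t, ((G t).neighborSet v).ncard : ℕ) : ℝ)
          ≤ D * Fintype.card V →
        ∀ s : V, ∃ (r : ℕ) (w : ℕ → V),
          w 1 = s ∧
          (∀ t : ℕ, 1 ≤ t → t ≤ r → (w t = w (t + 1) ∨ (G t).Adj (w t) (w (t + 1)))) ∧
          (∀ v : V, ∃ t : ℕ, 1 ≤ t ∧ t ≤ r + 1 ∧ w t = v) ∧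
          (r : ℝ) ≤ C * (Fintype.card V : ℝ) ^ (3/2 : ℝ) *
            Real.sqrt (D * Real.logb 2 (Fintype.card V)) := by
  classical
  refine ⟨12 * Real.sqrt 6, by positivity, fun V _ G D hV hD hG hdeg s => ?_⟩
  have hbdd : ∀ v : V, BddAbove (Set.range fun t : ℕ =>
      ⨆ _ : 1 ≤ t, ((G t).neighborSet v).ncard) := by
    refine fun v => ⟨Fintype.card V, ?_⟩
    rintro _ ⟨t, rfl⟩
    refine Nat.le_of_lt_succ (lt_of_le_of_lt (ciSup_le' fun _ => ?_) (Nat.lt_succ_self _))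
    rw [← Nat.card_eq_fintype_card]
    exact Set.ncard_le_card _
  have hd : ∀ t v, ((G (max 1 t)).neighborSet v).ncard ≤
      ⨆ t : ℕ, ⨆ _ : 1 ≤ t, ((G t).neighborSet v).ncard := by
    intro t v
    refine le_trans (le_of_eq ?_) (le_ciSup (hbdd v) (max 1 t))
    simp
  obtain ⟨r, w, hw, hws, hcov, hr⟩ := exists_walk_covering_of_sqrt_step
    (G := fun t => G (max 1 t)) (fun a v X hX => exists_walk_covering_sqrt hV
      (fun t => hG _ (le_max_left _ _)) hd hD hdeg a v hX) _ 1 s Finset.univ rfl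
  refine ⟨r, w, hws, fun t h₁ h₂ => ?_, fun v => ?_, hr.trans (le_of_eq ?_)⟩
  · simpa [max_eq_right h₁] using hw t h₁ (by omega)
  · obtain ⟨t, ht, htv⟩ := mem_visited.mp (hcov (Finset.mem_univ v))
    exact ⟨t, ht.1, by omega, htv⟩
  · have hn : (0 : ℝ) < Fintype.card V := by
      have : 0 < Fintype.card V := by omega
      exact_mod_cast this
    have e : (Fintype.card V : ℝ) ^ (3 / 2 : ℝ) = Fintype.card V * √(Fintype.card V : ℝ) := by
      rw [Real.sqrt_eq_rpow, ← Real.rpow_one_add' hn.le (by norm_num)]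
      norm_num
    rw [Finset.card_univ, e, Real.sqrt_mul (by norm_num : (0 : ℝ) ≤ 6)]
    push_cast
    ring
end

section
/- There exists an absolute constant C > 0 such that the following holds. Let d ≥ 1 be an integer and let G = (G_t)_{t ∈ ℕ, t ≥ 1} be an always-connected temporal graph on a vertex set of size n ≥ 2 such that every snapshot G_t has maximum degree at most d. Then for every start vertex s, there exists a temporal exploration of G starting at s that spans at most C · n^{3/2} · sqrt(d · log₂ n) time steps. -/
namespace TemporalExploration

variable {V : Type}

/-- One time step: stay, or cross an edge of the snapshot `H i`. -/
def Step (H : ℕ → SimpleGraph V) (i : ℕ) (u v : V) : Prop :=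
  u = v ∨ (H i).Adj u v

/-- `ReachIn H i u v`: some temporal walk leads from `u` at time `0` to `v` at time `i`. -/
def ReachIn (H : ℕ → SimpleGraph V) : ℕ → V → V → Prop
  | 0, u, v => u = v
  | i + 1, u, v => ∃ w, ReachIn H i u w ∧ Step H i w v

theorem ReachIn.stay {H : ℕ → SimpleGraph V} {i : ℕ} {u v : V} (h : ReachIn H i u v) :
    ReachIn H (i + 1) u v := ⟨v, h, Or.inl rfl⟩

theorem ReachIn.mono {H : ℕ → SimpleGraph V} {i j : ℕ} (hij : i ≤ j) {u v : V}
    (h : ReachIn H i u v) : ReachIn H j u v := by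
  induction hij with
  | refl => exact h
  | step _ ih => exact ih.stay

theorem ReachIn.self (H : ℕ → SimpleGraph V) (i : ℕ) (u : V) : ReachIn H i u u :=
  ReachIn.mono (Nat.zero_le i) rfl

/-- A set that is neither empty nor everything has an edge leaving it in a connected graph. -/
theorem exists_adj_boundary {G : SimpleGraph V} (hG : G.Connected) (P : V → Prop) {a b : V}
    (ha : P a) (hb : ¬ P b) : ∃ y x, P y ∧ ¬ P x ∧ G.Adj y x := by
  obtain ⟨p⟩ := hG.preconnected a b
  induction p with
  | nil => exact absurd ha hb
  | @cons u v w huv p ih =>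
    by_cases hv : P v
    · exact ih hv hb
    · exact ⟨u, v, ha, hv, huv⟩

open Classical in
/-- The sources in `S` that reach `v` within `i` steps and whose level is still that of `v`. -/
noncomputable def sources (H : ℕ → SimpleGraph V) (f : ℕ → V → ℕ) (S : Finset V)
    (i : ℕ) (v : V) : Finset V :=
  S.filter fun s => ReachIn H i s v ∧ f 0 s = f i v

/-- The number of sources at `v`, replaced by a large value once it exceeds `h`. -/
noncomputable def weight (H : ℕ → SimpleGraph V) (f : ℕ → V → ℕ) (S : Finset V) (h d : ℕ)
    (i : ℕ) (v : V) : ℕ :=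
  if (sources H f S i v).card ≤ h then (sources H f S i v).card else h + h * d

section Window

variable [Fintype V] {H : ℕ → SimpleGraph V} {f : ℕ → V → ℕ} {S : Finset V} {h d i : ℕ}

omit [Fintype V] in
theorem mem_sources {s v : V} :
    s ∈ sources H f S i v ↔ s ∈ S ∧ ReachIn H i s v ∧ f 0 s = f i v := by
  simp [sources]

omit [Fintype V] in
theorem sources_subset_of_step {u v : V} (huv : Step H i u v) (hf : f i u = f (i + 1) v) :
    sources H f S i u ⊆ sources H f S (i + 1) v := by
  intro s hs
  rw [mem_sources] at hs ⊢
  exact ⟨hs.1, ⟨u, hs.2.1, huv⟩, hs.2.2.trans hf⟩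

omit [Fintype V] in
theorem weight_le (v : V) : weight H f S h d i v ≤ h + h * d := by
  unfold weight
  split_ifs <;> omega

open Classical in
/-- In one time step the total weight grows by almost one unit per source. -/
theorem card_add_sum_weight_le (hd : 1 ≤ d) (hconn : (H i).Connected)
    (hdeg : ∀ v, ((H i).neighborSet v).ncard ≤ d)
    (hf : ∀ u v, Step H i u v → f i u ≤ f (i + 1) v)
    (hS : ∀ s ∈ S, f i s = f 0 s ∧ f (i + 1) s = f 0 s)
    (hh : ∀ s ∈ S, (sources H f S (i + 1) s).card ≤ h) :
    S.card + ∑ v, weight H f S h d i v ≤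
      ∑ v, weight H f S h d (i + 1) v + h + 3 * h * d * ∑ v, (f (i + 1) v - f i v) := by
  set P : V → Finset V := sources H f S i with hP
  set Q : V → Finset V := sources H f S (i + 1) with hQ
  have hmono : ∀ v, f i v ≤ f (i + 1) v := fun v => hf v v (Or.inl rfl)
  have hPQ : ∀ v, f (i + 1) v = f i v → P v ⊆ Q v := fun v hv =>
    sources_subset_of_step (Or.inl rfl) hv.symm
  set A : Finset V := Finset.univ.filter fun v => f (i + 1) v ≠ f i v with hA
  set Z : Finset V := Finset.univ.filter fun v =>
    f (i + 1) v = f i v ∧ (P v).card ≤ h ∧ h < (Q v).card with hZ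
  set N : Finset V := Finset.univ.filter fun v =>
    f (i + 1) v = f i v ∧ (Q v).card ≤ h with hN
  have hPN : ∀ v ∈ N, (P v).card ≤ h := by
    intro v hv
    simp only [hN, Finset.mem_filter, Finset.mem_univ, true_and] at hv
    exact (Finset.card_le_card (hPQ v hv.1)).trans hv.2
  have key : S ⊆ (N.biUnion fun u => Q u \ P u) ∪
      ((S.filter fun s => ∀ v, v ∈ N ∧ s ∈ P v) ∪
        (A ∪ Z).biUnion fun x => (N.filter fun y => (H i).Adj x y).biUnion P) := by
    intro s hs
    by_cases hall : ∀ v, v ∈ N ∧ s ∈ P v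
    · exact Finset.mem_union_right _ (Finset.mem_union_left _ (Finset.mem_filter.2 ⟨hs, hall⟩))
    push Not at hall
    obtain ⟨b, hb⟩ := hall
    have hsN : s ∈ N ∧ s ∈ P s := by
      refine ⟨?_, ?_⟩
      · simp only [hN, Finset.mem_filter, Finset.mem_univ, true_and]
        exact ⟨(hS s hs).2.trans (hS s hs).1.symm, hh s hs⟩
      · exact mem_sources.2 ⟨hs, ReachIn.self _ _ _, (hS s hs).1.symm⟩
    obtain ⟨y, x, ⟨hyN, hyP⟩, hx, hadj⟩ :=
      exists_adj_boundary hconn (fun v => v ∈ N ∧ s ∈ P v) hsN (b := b) (fun hc => hb hc.1 hc.2)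
    have hyN' := hyN
    simp only [hN, Finset.mem_filter, Finset.mem_univ, true_and] at hyN'
    by_cases hxA : f (i + 1) x = f i x
    · have e1 : f i y ≤ f (i + 1) x := hf _ _ (Or.inr hadj)
      have e2 : f i x ≤ f (i + 1) y := hf _ _ (Or.inr hadj.symm)
      by_cases hxN : x ∈ N
      · refine Finset.mem_union_left _ (Finset.mem_biUnion.2 ⟨x, hxN, ?_⟩)
        refine Finset.mem_sdiff.2 ⟨?_, fun hc => hx ⟨hxN, hc⟩⟩
        exact sources_subset_of_step (Or.inr hadj) (by omega) hyP
      · have hQx : h < (Q x).card := by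
          by_contra hc
          exact hxN (by simp only [hN, Finset.mem_filter, Finset.mem_univ, true_and]
                        exact ⟨hxA, not_lt.1 hc⟩)
        have hPx : (P x).card ≤ h :=
          (Finset.card_le_card (sources_subset_of_step (Or.inr hadj.symm) (by omega))).trans hyN'.2
        refine Finset.mem_union_right _ (Finset.mem_union_right _ (Finset.mem_biUnion.2 ⟨x, ?_,
          Finset.mem_biUnion.2 ⟨y, Finset.mem_filter.2 ⟨hyN, hadj.symm⟩, hyP⟩⟩))
        refine Finset.mem_union_right _ ?_
        simp only [hZ, Finset.mem_filter, Finset.mem_univ, true_and]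
        exact ⟨hxA, hPx, hQx⟩
    · refine Finset.mem_union_right _ (Finset.mem_union_right _ (Finset.mem_biUnion.2 ⟨x, ?_,
        Finset.mem_biUnion.2 ⟨y, Finset.mem_filter.2 ⟨hyN, hadj.symm⟩, hyP⟩⟩))
      refine Finset.mem_union_left _ ?_
      simpa [hA] using hxA
  have hAll : (S.filter fun s => ∀ v, v ∈ N ∧ s ∈ P v).card ≤ h := by
    obtain ⟨v₀⟩ := hconn.nonempty
    rcases Finset.eq_empty_or_nonempty (S.filter fun s => ∀ v, v ∈ N ∧ s ∈ P v) with he | ⟨s, hs⟩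
    · rw [he]; simp
    · have hv₀ : v₀ ∈ N := ((Finset.mem_filter.1 hs).2 v₀).1
      refine (Finset.card_le_card ?_).trans (hPN v₀ hv₀)
      intro s' hs'
      exact ((Finset.mem_filter.1 hs').2 v₀).2
  have hBdry : ((A ∪ Z).biUnion fun x => (N.filter fun y => (H i).Adj x y).biUnion P).card ≤
      (A ∪ Z).card * (d * h) := by
    refine Finset.card_biUnion_le_card_mul _ _ _ fun x _ => ?_
    refine (Finset.card_biUnion_le_card_mul _ _ h fun y hy =>
      hPN y (Finset.mem_filter.1 hy).1).trans (Nat.mul_le_mul_right _ ?_)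
    refine le_trans ?_ (hdeg x)
    rw [← Set.ncard_coe_finset]
    refine Set.ncard_le_ncard (fun y hy => ?_) (Set.toFinite _)
    simp only [Finset.coe_filter, Set.mem_ofPred_eq] at hy
    exact hy.2
  have hcard := (Finset.card_le_card key).trans (Finset.card_union_le _ _)
  have hcard2 := Finset.card_union_le (S.filter fun s => ∀ v, v ∈ N ∧ s ∈ P v)
    ((A ∪ Z).biUnion fun x => (N.filter fun y => (H i).Adj x y).biUnion P)
  have hgain : (N.biUnion fun u => Q u \ P u).card ≤ ∑ u ∈ N, (Q u \ P u).card :=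
    Finset.card_biUnion_le
  have hAZ := Finset.card_union_le A Z
  have hpt : ∀ v, weight H f S h d i v + (if v ∈ N then (Q v \ P v).card else 0) +
      (if v ∈ Z then h * d else 0) ≤
      weight H f S h d (i + 1) v + (if v ∈ A then h + h * d else 0) := by
    intro v
    by_cases hvA : f (i + 1) v = f i v
    · have hsub := hPQ v hvA
      have hle := Finset.card_le_card hsub
      have hsd := Finset.card_sdiff_add_card_eq_card hsub
      simp only [weight, hA, hZ, hN, Finset.mem_filter, Finset.mem_univ, true_and, hvA, ne_eq,
        not_true_eq_false, if_false, ← hP, ← hQ]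
      split_ifs <;> omega
    · have := weight_le (H := H) (f := f) (S := S) (h := h) (d := d) (i := i) v
      simp only [hA, hZ, hN, Finset.mem_filter, Finset.mem_univ, true_and, hvA, ne_eq,
        not_false_eq_true, if_true, false_and, if_false]
      omega
  have hsum := Finset.sum_le_sum fun v (_ : v ∈ (Finset.univ : Finset V)) => hpt v
  simp only [Finset.sum_add_distrib, Finset.sum_ite_mem, Finset.univ_inter, Finset.sum_const,
    smul_eq_mul] at hsum
  have hAI : A.card ≤ ∑ v, (f (i + 1) v - f i v) := by
    rw [Finset.card_eq_sum_ones]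
    calc ∑ v ∈ A, 1 ≤ ∑ v ∈ A, (f (i + 1) v - f i v) := by
          refine Finset.sum_le_sum fun v hv => ?_
          have h1 := hmono v
          simp only [hA, Finset.mem_filter, Finset.mem_univ, true_and] at hv
          omega
      _ ≤ _ := Finset.sum_le_sum_of_subset (Finset.subset_univ A)
  have h1 : h ≤ h * d := Nat.le_mul_of_pos_right _ hd
  have h2 : (A ∪ Z).card * (d * h) ≤ (A.card + Z.card) * (h * d) := by
    rw [mul_comm d h]; exact Nat.mul_le_mul_right _ hAZ
  have h3 : A.card * (h + h * d) + A.card * (h * d) ≤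
      3 * h * d * ∑ v, (f (i + 1) v - f i v) := by
    calc A.card * (h + h * d) + A.card * (h * d) ≤ 3 * h * d * A.card := by nlinarith
      _ ≤ _ := Nat.mul_le_mul_left _ hAI
  rw [add_mul] at h2
  rw [mul_add] at h3
  omega

/-- If no source meets more than `h` sources of its own level within `T` steps, then there are
few sources or the levels increase a lot. -/
theorem mul_card_le_of_sources_le {T : ℕ} (hd : 1 ≤ d) (hconn : ∀ i, (H i).Connected)
    (hdeg : ∀ i v, ((H i).neighborSet v).ncard ≤ d)
    (hf : ∀ i u v, Step H i u v → f i u ≤ f (i + 1) v)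
    (hS : ∀ s ∈ S, f T s = f 0 s)
    (hh : ∀ s ∈ S, (sources H f S T s).card ≤ h) :
    T * S.card ≤ T * h + 3 * h * d * ∑ v, (f T v - f 0 v) + Fintype.card V * (h + h * d) := by
  have hmono : ∀ v, Monotone fun i => f i v :=
    fun v => monotone_nat_of_le_succ fun i => hf i v v (Or.inl rfl)
  have hS' : ∀ i ≤ T, ∀ s ∈ S, f i s = f 0 s := fun i hi s hs =>
    le_antisymm ((hmono s hi).trans (hS s hs).le) (hmono s (Nat.zero_le i))
  have main : ∀ i ≤ T, i * S.card ≤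
      ∑ v, weight H f S h d i v + i * h + 3 * h * d * ∑ v, (f i v - f 0 v) := by
    intro i
    induction i with
    | zero => intro; simp
    | succ i ih =>
      intro hi
      have h0 := ih (by omega)
      have hh' : ∀ s ∈ S, (sources H f S (i + 1) s).card ≤ h := by
        intro s hs
        refine (Finset.card_le_card fun s' hs' => ?_).trans (hh s hs)
        rw [mem_sources] at hs' ⊢
        exact ⟨hs'.1, hs'.2.1.mono hi, by rw [hs'.2.2, hS' _ hi s hs, hS s hs]⟩
      have h1 := card_add_sum_weight_le hd (hconn i) (hdeg i) (hf i)
        (fun s hs => ⟨hS' i (by omega) s hs, hS' (i + 1) hi s hs⟩) hh'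
      have h2 : ∑ v, (f (i + 1) v - f 0 v) =
          ∑ v, (f (i + 1) v - f i v) + ∑ v, (f i v - f 0 v) := by
        rw [← Finset.sum_add_distrib]
        refine Finset.sum_congr rfl fun v _ => ?_
        have a := hmono v (Nat.zero_le i)
        have b := hmono v (Nat.le_succ i)
        simp only [Nat.succ_eq_add_one] at a b
        omega
      rw [h2, mul_add, add_mul, add_mul]
      omega
  have hw : ∑ v, weight H f S h d T v ≤ Fintype.card V * (h + h * d) := by
    calc _ ≤ ∑ _v : V, (h + h * d) := Finset.sum_le_sum fun v _ => weight_le v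
      _ = _ := by simp
  have := main T le_rfl
  omega

end Window


/-- `Visits H x X₀ i v X`: some temporal walk leads from `x` at time `0` to `v` at time `i`, and
`X` consists of `X₀` and the vertices it enters. -/
inductive Visits [DecidableEq V] (H : ℕ → SimpleGraph V) (x : V) (X₀ : Finset V) :
    ℕ → V → Finset V → Prop
  | start : Visits H x X₀ 0 x X₀
  | step {i : ℕ} {u v : V} {X : Finset V} :
      Visits H x X₀ i u X → Step H i u v → Visits H x X₀ (i + 1) v (insert v X)

section Visits

variable [DecidableEq V] {H : ℕ → SimpleGraph V} {x : V} {X₀ : Finset V}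

theorem Visits.base_subset {i : ℕ} {v : V} {X : Finset V} (h : Visits H x X₀ i v X) :
    X₀ ⊆ X := by
  induction h with
  | start => exact Finset.Subset.refl _
  | step _ _ ih => exact ih.trans (Finset.subset_insert _ _)

theorem Visits.mem_last {i : ℕ} {v : V} {X : Finset V} (hx : x ∈ X₀)
    (h : Visits H x X₀ i v X) : v ∈ X := by
  cases h with
  | start => exact hx
  | step _ _ => exact Finset.mem_insert_self _ _

theorem Visits.trans {i j : ℕ} {v u : V} {X Y : Finset V} (h : Visits H x X₀ i v X)
    (h' : Visits (fun k => H (i + k)) v X j u Y) : Visits H x X₀ (i + j) u Y := by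
  induction h' with
  | start => exact h
  | step _ hs ih => exact Visits.step ih hs

theorem Visits.extend {a i : ℕ} {v u : V} {X : Finset V} (hx : x ∈ X₀)
    (h : Visits H x X₀ a v X) (hr : ReachIn (fun k => H (a + k)) i v u) :
    ∃ Y, Visits H x X₀ (a + i) u Y ∧ insert u X ⊆ Y := by
  induction i generalizing u with
  | zero =>
    obtain rfl : v = u := hr
    exact ⟨X, h, Finset.insert_subset (h.mem_last hx) (Finset.Subset.refl _)⟩
  | succ i ih =>
    obtain ⟨w, hw, hs⟩ := hr
    obtain ⟨Y, hY, hXY⟩ := ih hw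
    exact ⟨insert u Y, hY.step hs,
      Finset.insert_subset_insert _ ((Finset.subset_insert _ _).trans hXY)⟩

/-- A derivation of `Visits` comes from an actual temporal walk. -/
theorem Visits.exists_walk {i : ℕ} {v : V} {X : Finset V} (h : Visits H x X₀ i v X) :
    ∃ w : ℕ → V, w 0 = x ∧ w i = v ∧ (∀ j < i, Step H j (w j) (w (j + 1))) ∧
      ∀ u ∈ X, u ∈ X₀ ∨ ∃ j ≤ i, w j = u := by
  induction h with
  | start => exact ⟨fun _ => x, rfl, rfl, by simp, fun u hu => Or.inl hu⟩
  | @step i u v X _ hs ih =>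
    obtain ⟨w, h0, hi, hw, hX⟩ := ih
    refine ⟨fun j => if j ≤ i then w j else v, by simpa using h0, by simp, fun j hj => ?_,
      fun y hy => ?_⟩
    · rcases Nat.lt_succ_iff_lt_or_eq.1 hj with hj | rfl
      · have h1 : j ≤ i := hj.le
        have h2 : j + 1 ≤ i := hj
        simpa [h1, h2] using hw j hj
      · simpa [hi] using hs
    · rcases Finset.mem_insert.1 hy with rfl | hy
      · exact Or.inr ⟨i + 1, le_rfl, by simp⟩
      · rcases hX y hy with hy | ⟨j, hj, hjy⟩
        · exact Or.inl hy
        · exact Or.inr ⟨j, by omega, by simpa [hj] using hjy⟩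

end Visits

section Level

variable [Fintype V] {H : ℕ → SimpleGraph V} {x : V} {X₀ S : Finset V}

/-- In an always-connected temporal graph every vertex is reached within `n` steps. -/
theorem reachIn_card (hconn : ∀ i, (H i).Connected) (x v : V) :
    ReachIn H (Fintype.card V) x v := by
  classical
  have main : ∀ i, (∀ v, ReachIn H i x v) ∨
      i + 1 ≤ (Finset.univ.filter fun v => ReachIn H i x v).card := by
    intro i
    induction i with
    | zero => exact Or.inr (Finset.card_pos.2 ⟨x, Finset.mem_filter.2 ⟨Finset.mem_univ _, rfl⟩⟩)
    | succ i ih =>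
      by_cases hall : ∀ v, ReachIn H i x v
      · exact Or.inl fun v => (hall v).stay
      · refine Or.inr ?_
        have hi := ih.resolve_left hall
        push Not at hall
        obtain ⟨b, hb⟩ := hall
        obtain ⟨y, z, hy, hz, hyz⟩ :=
          exists_adj_boundary (hconn i) (ReachIn H i x) (ReachIn.self H i x) hb
        refine (Nat.succ_le_of_lt (Nat.lt_of_le_of_lt hi (Finset.card_lt_card ?_)))
        refine Finset.ssubset_iff_subset_ne.2 ⟨fun v hv => ?_, fun he => hz ?_⟩
        · simp only [Finset.mem_filter, Finset.mem_univ, true_and] at hv ⊢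
          exact hv.stay
        · have hz' : z ∈ Finset.univ.filter fun v => ReachIn H (i + 1) x v := by
            simp only [Finset.mem_filter, Finset.mem_univ, true_and]
            exact ⟨y, hy, Or.inr hyz⟩
          rw [← he] at hz'
          simpa using hz'
  rcases main (Fintype.card V) with h | h
  · exact h v
  · have := Finset.card_le_univ (Finset.univ.filter fun v => ReachIn H (Fintype.card V) x v)
    omega

open Classical in
/-- The largest number of vertices of `S` collected by a walk that is at `v` at time `i`. -/
noncomputable def level (H : ℕ → SimpleGraph V) (x : V) (X₀ S : Finset V) (i : ℕ) (v : V) : ℕ :=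
  (Finset.univ.filter fun X => Visits H x X₀ i v X).sup fun X => (X ∩ S).card

open Classical in
theorem card_inter_le_level {i : ℕ} {v : V} {X : Finset V} (h : Visits H x X₀ i v X) :
    (X ∩ S).card ≤ level H x X₀ S i v :=
  Finset.le_sup (f := fun X : Finset V => (X ∩ S).card) (by simpa using h)

open Classical in
theorem exists_card_inter_eq_level {i : ℕ} {v : V} {X : Finset V} (h : Visits H x X₀ i v X) :
    ∃ Y, Visits H x X₀ i v Y ∧ (Y ∩ S).card = level H x X₀ S i v := by
  obtain ⟨Y, hY, he⟩ := Finset.exists_mem_eq_sup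
    (Finset.univ.filter fun X => Visits H x X₀ i v X) ⟨X, by simpa using h⟩
    fun X => (X ∩ S).card
  exact ⟨Y, by simpa using hY, he.symm⟩

theorem level_le_of_step {i : ℕ} {u v : V} (h : Step H i u v) :
    level H x X₀ S i u ≤ level H x X₀ S (i + 1) v := by
  classical
  refine Finset.sup_le fun X hX => ?_
  simp only [Finset.mem_filter, Finset.mem_univ, true_and] at hX
  exact (Finset.card_le_card (Finset.inter_subset_inter_right (Finset.subset_insert v X))).trans
    (card_inter_le_level (hX.step h))

theorem level_mono (v : V) : Monotone fun i => level H x X₀ S i v :=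
  monotone_nat_of_le_succ fun _ => level_le_of_step (Or.inl rfl)

theorem level_le_card (i : ℕ) (v : V) : level H x X₀ S i v ≤ S.card := by
  classical
  exact Finset.sup_le fun X _ => Finset.card_le_card Finset.inter_subset_right

open Classical in
/-- A vertex whose level is `m` at time `a` reaches at most `m` targets of level `m`. -/
theorem card_reach_le_level {a T : ℕ} {u : V} {X : Finset V} (hx : x ∈ X₀)
    (h : Visits H x X₀ a u X) :
    (S.filter fun s => ReachIn (fun k => H (a + k)) T u s ∧
      level H x X₀ S a u = level H x X₀ S (a + T) s).card ≤ level H x X₀ S a u := by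
  obtain ⟨Y, hY, he⟩ := exists_card_inter_eq_level (S := S) h
  rw [← he]
  refine Finset.card_le_card fun s hs => ?_
  obtain ⟨hsS, hr, hl⟩ := Finset.mem_filter.1 hs
  refine Finset.mem_inter.2 ⟨?_, hsS⟩
  by_contra hsY
  obtain ⟨Z, hZ, hYZ⟩ := hY.extend hx hr
  have h1 := card_inter_le_level (S := S) hZ
  have h2 : (insert s (Y ∩ S)).card ≤ (Z ∩ S).card := by
    rw [← Finset.insert_inter_of_mem hsS]
    exact Finset.card_le_card (Finset.inter_subset_inter_right hYZ)
  rw [Finset.card_insert_of_notMem fun hc => hsY (Finset.mem_inter.1 hc).1] at h2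
  omega

end Level

/-- If every row of a relation on `S` has at most `m` entries, at least half of the columns have
at most `2 * m` entries. -/
theorem exists_half_card_le (S : Finset V) (r : V → V → Prop) [DecidableRel r] (m : ℕ)
    (hr : ∀ u ∈ S, (S.filter fun v => r u v).card ≤ m) :
    ∃ S' ⊆ S, S.card ≤ 2 * S'.card ∧ ∀ v ∈ S', (S.filter fun u => r u v).card ≤ 2 * m := by
  refine ⟨S.filter fun v => (S.filter fun u => r u v).card ≤ 2 * m, Finset.filter_subset _ _, ?_,
    fun v hv => (Finset.mem_filter.1 hv).2⟩
  have hdc : ∑ u ∈ S, (S.filter fun v => r u v).card = ∑ v ∈ S, (S.filter fun u => r u v).card :=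
    Finset.sum_card_bipartiteAbove_eq_sum_card_bipartiteBelow r
  have hle : ∑ u ∈ S, (S.filter fun v => r u v).card ≤ S.card * m := by
    simpa using Finset.sum_le_card_nsmul S _ m hr
  have hsplit := Finset.card_filter_add_card_filter_not (s := S)
    fun v => (S.filter fun u => r u v).card ≤ 2 * m
  set B := S.filter fun v => ¬ (S.filter fun u => r u v).card ≤ 2 * m with hB
  have hBle : B.card * (2 * m + 1) ≤ S.card * m := by
    calc B.card * (2 * m + 1) ≤ ∑ v ∈ B, (S.filter fun u => r u v).card := by
          simpa using Finset.card_nsmul_le_sum B _ (2 * m + 1) fun v hv => by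
            have := (Finset.mem_filter.1 hv).2
            omega
      _ ≤ ∑ v ∈ S, (S.filter fun u => r u v).card :=
          Finset.sum_le_sum_of_subset (Finset.filter_subset _ _)
      _ ≤ S.card * m := hdc ▸ hle
  by_contra hc
  have : S.card + 1 ≤ 2 * B.card := by omega
  nlinarith

/-- Within `5 * n` steps some walk collects at least of the order of `√(k / d)` many of any `k`
given vertices. -/
theorem exists_visits_many [Fintype V] [DecidableEq V] {H : ℕ → SimpleGraph V} {x : V}
    {X₀ S : Finset V} {d : ℕ} (hd : 1 ≤ d) (hconn : ∀ i, (H i).Connected)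
    (hdeg : ∀ i v, ((H i).neighborSet v).ncard ≤ d) (hx : x ∈ X₀) (hS : S.Nonempty) :
    ∃ v X, Visits H x X₀ (5 * Fintype.card V) v X ∧ S.card ≤ 72 * d * (X ∩ S).card ^ 2 := by
  classical
  obtain rfl : ‹DecidableEq V› = fun a b => Classical.propDecidable (a = b) :=
    Subsingleton.elim _ _
  set n := Fintype.card V with hn
  have hreach : ∀ i, n ≤ i → ∀ v, ∃ X, Visits H x X₀ i v X ∧ v ∈ X := by
    intro i hi v
    obtain ⟨Y, hY, hvY⟩ := (Visits.start (H := H) (X₀ := X₀)).extend (a := 0) (i := i) (u := v) hx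
      (by simpa using (reachIn_card hconn x v).mono hi)
    rw [zero_add] at hY
    exact ⟨Y, hY, hvY (Finset.mem_insert_self _ _)⟩
  obtain ⟨v₁, -, hv₁⟩ := Finset.exists_max_image Finset.univ
    (fun v => level H x X₀ S (5 * n) v) ⟨x, Finset.mem_univ x⟩
  set M := level H x X₀ S (5 * n) v₁ with hM
  have hlevel : ∀ i ≤ 5 * n, ∀ v, level H x X₀ S i v ≤ M := fun i hi v =>
    (level_mono v hi).trans (hv₁ v (Finset.mem_univ v))
  set k := S.card with hk
  have hkn : k ≤ n := Finset.card_le_univ S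
  have hkpos : 0 < k := Finset.card_pos.2 hS
  have hMk : M ≤ k := level_le_card _ _
  have hMpos : 0 < M := by
    obtain ⟨s, hs⟩ := hS
    obtain ⟨X, hX, hsX⟩ := hreach n le_rfl s
    have h1 : 0 < (X ∩ S).card := Finset.card_pos.2 ⟨s, Finset.mem_inter.2 ⟨hsX, hs⟩⟩
    exact h1.trans_le ((card_inter_le_level hX).trans (hlevel n (by omega) s))
  obtain ⟨T, hT⟩ : ∃ T, T = n / M := ⟨_, rfl⟩
  have hTM : M * T ≤ n := hT ▸ Nat.mul_div_le n M
  have hTpos : 0 < T := hT ▸ Nat.div_pos (hMk.trans hkn) hMpos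
  have hnT : n ≤ 2 * M * T := by
    have : n < M * (T + 1) := hT ▸ Nat.lt_mul_div_succ n hMpos
    nlinarith
  have hTn : T ≤ n := (Nat.le_mul_of_pos_left T hMpos).trans hTM
  obtain ⟨F, hF⟩ : ∃ F : ℕ → ℕ, ∀ i, F i = ∑ v, level H x X₀ S i v := ⟨_, fun _ => rfl⟩
  obtain ⟨E, hE⟩ : ∃ E : ℕ → ℕ, ∀ i, E i = ∑ s ∈ S, level H x X₀ S i s := ⟨_, fun _ => rfl⟩
  have hwindow : ∃ j < 4 * M, 2 * (k * F (n + (j + 1) * T) + n * E (n + (j + 1) * T)) ≤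
      2 * (k * F (n + j * T) + n * E (n + j * T)) + k * n := by
    by_contra! hc
    have hgrow : ∀ j ≤ 4 * M, j * (k * n + 1) ≤ 2 * (k * F (n + j * T) + n * E (n + j * T)) := by
      intro j
      induction j with
      | zero => intro; simp
      | succ j ih =>
        intro hj
        have h1 := ih (by omega)
        have h2 := hc j (by omega)
        rw [add_mul j 1 (k * n + 1), one_mul]
        omega
    have h1 := hgrow (4 * M) le_rfl
    have hle : n + 4 * M * T ≤ 5 * n := by
      rw [mul_assoc]
      omega
    have hF' : F (n + 4 * M * T) ≤ n * M := by
      rw [hF]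
      simpa using Finset.sum_le_card_nsmul Finset.univ _ M fun v _ => hlevel _ hle v
    have hE' : E (n + 4 * M * T) ≤ k * M := by
      rw [hE]
      simpa using Finset.sum_le_card_nsmul S _ M fun v _ => hlevel _ hle v
    have h2 := Nat.mul_le_mul_left k hF'
    have h3 := Nat.mul_le_mul_left n hE'
    nlinarith
  obtain ⟨j, hj, hq⟩ := hwindow
  obtain ⟨a, ha⟩ : ∃ a, a = n + j * T := ⟨_, rfl⟩
  rw [show n + (j + 1) * T = a + T by rw [ha]; ring, ← ha] at hq
  have haT : a + T ≤ 5 * n := by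
    have : (j + 1) * T ≤ 4 * M * T := Nat.mul_le_mul_right T hj
    rw [mul_assoc 4] at this
    rw [add_mul, one_mul] at this
    omega
  have hmono : ∀ v, level H x X₀ S a v ≤ level H x X₀ S (a + T) v := fun v =>
    level_mono v (Nat.le_add_right a T)
  obtain ⟨I, hI⟩ : ∃ I, I = ∑ v, (level H x X₀ S (a + T) v - level H x X₀ S a v) := ⟨_, rfl⟩
  obtain ⟨J, hJ⟩ : ∃ J, J = ∑ s ∈ S, (level H x X₀ S (a + T) s - level H x X₀ S a s) := ⟨_, rfl⟩
  have hFI : F (a + T) = F a + I := by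
    rw [hF, hF, hI, ← Finset.sum_add_distrib]
    exact Finset.sum_congr rfl fun v _ => by have := hmono v; omega
  have hEJ : E (a + T) = E a + J := by
    rw [hE, hE, hJ, ← Finset.sum_add_distrib]
    exact Finset.sum_congr rfl fun v _ => by have := hmono v; omega
  rw [hFI, hEJ] at hq
  have hIn : 2 * I ≤ n := by
    refine le_of_mul_le_mul_left (a := k) ?_ hkpos
    nlinarith [Nat.zero_le (n * J)]
  have hJk : 2 * J ≤ k := by
    refine le_of_mul_le_mul_left (a := n) ?_ (hkpos.trans_le hkn)
    nlinarith [Nat.zero_le (k * I)]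
  set S' := S.filter fun s => level H x X₀ S (a + T) s = level H x X₀ S a s with hS'
  have hS'card : k ≤ 2 * S'.card := by
    have hsplit := Finset.card_filter_add_card_filter_not (s := S)
      fun s => level H x X₀ S (a + T) s = level H x X₀ S a s
    have hJle : (S.filter fun s => ¬ level H x X₀ S (a + T) s = level H x X₀ S a s).card ≤ J := by
      rw [hJ, Finset.card_eq_sum_ones]
      calc _ ≤ ∑ s ∈ S.filter fun s => ¬ level H x X₀ S (a + T) s = level H x X₀ S a s,
            (level H x X₀ S (a + T) s - level H x X₀ S a s) := by
              refine Finset.sum_le_sum fun s hs => ?_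
              have h1 := hmono s
              have h2 := (Finset.mem_filter.1 hs).2
              omega
        _ ≤ _ := Finset.sum_le_sum_of_subset (Finset.filter_subset _ _)
    rw [← hS'] at hsplit
    omega
  obtain ⟨S'', hsub, hS''card, hcol⟩ := exists_half_card_le S'
    (fun u v => ReachIn (fun i => H (a + i)) T u v ∧
      level H x X₀ S a u = level H x X₀ S (a + T) v) M (by
    intro u _
    obtain ⟨X, hX, -⟩ := hreach a (by omega) u
    refine (Finset.card_le_card ?_).trans ((card_reach_le_level (S := S) (T := T) hx hX).trans
      (hlevel a (by omega) u))
    exact Finset.filter_subset_filter _ (Finset.filter_subset _ _))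
  have hmain := mul_card_le_of_sources_le (H := fun i => H (a + i))
    (f := fun i v => level H x X₀ S (a + i) v) (S := S'') (h := 2 * M) (T := T) hd
    (fun i => hconn _) (fun i => hdeg _) (fun i u v huv => level_le_of_step huv)
    (fun s hs => (Finset.mem_filter.1 (hsub hs)).2)
    (fun s hs => (Finset.card_le_card fun u hu => by
      obtain ⟨h1, h2, h3⟩ := mem_sources.1 hu
      exact Finset.mem_filter.2 ⟨hsub h1, h2, h3⟩).trans (hcol s hs))
  simp only [add_zero, ← hI, ← hn] at hmain
  obtain ⟨X, hX, -⟩ := hreach (5 * n) (by omega) v₁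
  obtain ⟨Y, hY, hYM⟩ := exists_card_inter_eq_level (S := S) hX
  refine ⟨v₁, Y, hY, ?_⟩
  rw [hYM, ← hM]
  have hk4 : k ≤ 4 * S''.card := by omega
  have h1 : T * k ≤ 36 * M * d * n := by
    calc T * k ≤ T * (4 * S''.card) := Nat.mul_le_mul_left T hk4
      _ = 4 * (T * S''.card) := by ring
      _ ≤ 4 * (T * (2 * M) + 3 * (2 * M) * d * I + n * (2 * M + 2 * M * d)) :=
          Nat.mul_le_mul_left 4 hmain
      _ = 8 * M * 1 * T + 12 * M * d * (2 * I) + 8 * M * 1 * n + 8 * M * d * n := by ring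
      _ ≤ 8 * M * d * n + 12 * M * d * n + 8 * M * d * n + 8 * M * d * n := by gcongr
      _ = 36 * M * d * n := by ring
  refine le_of_mul_le_mul_left (a := n) ?_ (hkpos.trans_le hkn)
  calc n * k ≤ 2 * M * T * k := Nat.mul_le_mul_right k hnT
    _ = 2 * M * (T * k) := by ring
    _ ≤ 2 * M * (36 * M * d * n) := Nat.mul_le_mul_left _ h1
    _ = n * (72 * d * M ^ 2) := by ring

/-- All `k` vertices outside `X₀` can be visited within `90 * n * √(d * k)` steps. -/
theorem exists_visits_univ [Fintype V] [DecidableEq V] {d : ℕ} (hd : 1 ≤ d) (k : ℕ) :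
    ∀ (H : ℕ → SimpleGraph V) (x : V) (X₀ : Finset V), (∀ i, (H i).Connected) →
      (∀ i v, ((H i).neighborSet v).ncard ≤ d) → x ∈ X₀ → X₀ᶜ.card = k →
      ∃ i v, Visits H x X₀ i v Finset.univ ∧
        (i : ℝ) ≤ 90 * Fintype.card V * √(d * k) := by
  induction k using Nat.strong_induction_on with
  | _ k ih =>
    intro H x X₀ hconn hdeg hx hk
    rcases Nat.eq_zero_or_pos k with rfl | hkpos
    · obtain rfl : X₀ = Finset.univ := by simpa using hk
      exact ⟨0, x, Visits.start, by simp⟩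
    obtain ⟨v, X, hX, hmany⟩ := exists_visits_many (S := X₀ᶜ) hd hconn hdeg hx
      (Finset.card_pos.1 (hk ▸ hkpos))
    rw [hk] at hmany
    set m := (X ∩ X₀ᶜ).card with hm
    have hmpos : 0 < m := by
      rcases Nat.eq_zero_or_pos m with h0 | h0
      · rw [h0] at hmany
        simp at hmany
        omega
      · exact h0
    have hsplit : Xᶜ.card + m = k := by
      have h1 : Xᶜ = X₀ᶜ \ (X ∩ X₀ᶜ) := by
        ext u
        have hu : u ∈ X₀ → u ∈ X := fun h => hX.base_subset h
        simp only [Finset.mem_compl, Finset.mem_sdiff, Finset.mem_inter]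
        tauto
      rw [h1, hm, ← hk]
      exact Finset.card_sdiff_add_card_eq_card Finset.inter_subset_right
    obtain ⟨i, u, hi, hile⟩ := ih Xᶜ.card (by omega) (fun j => H (5 * Fintype.card V + j)) v X
      (fun _ => hconn _) (fun _ => hdeg _) (hX.mem_last hx) rfl
    refine ⟨_, u, hX.trans hi, ?_⟩
    set l := Xᶜ.card with hl
    have hkl : (k : ℝ) = l + m := by rw [← hsplit]; push_cast; ring
    have hdR : (1 : ℝ) ≤ d := by exact_mod_cast hd
    have hmR : (1 : ℝ) ≤ m := by exact_mod_cast hmpos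
    have hmanyR : (k : ℝ) ≤ 72 * d * m ^ 2 := by exact_mod_cast hmany
    set p := √((d : ℝ) * k) with hp
    set q := √((d : ℝ) * l) with hq
    have hp2 : p ^ 2 = d * k := Real.sq_sqrt (by positivity)
    have hq2 : q ^ 2 = d * l := Real.sq_sqrt (by positivity)
    have hp0 : 0 < p := Real.sqrt_pos.2 (by rw [hkl]; positivity)
    have hq0 : 0 ≤ q := Real.sqrt_nonneg _
    have hpm : p ≤ 9 * (d * m) := by
      refine Real.sqrt_le_iff.2 ⟨by positivity, ?_⟩
      calc (d : ℝ) * k ≤ d * (72 * d * m ^ 2) := by gcongr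
        _ ≤ (9 * (d * m)) ^ 2 := by nlinarith [sq_nonneg ((d : ℝ) * m)]
    have hqp : q ≤ p := Real.sqrt_le_sqrt (by rw [hkl]; nlinarith)
    have hdiff : 1 / 18 ≤ p - q := by
      by_contra! hc
      have h1 : (p - q) * (p + q) = d * m := by
        have : (p - q) * (p + q) = p ^ 2 - q ^ 2 := by ring
        rw [this, hp2, hq2, hkl]
        ring
      nlinarith
    have hn0 : (0 : ℝ) ≤ Fintype.card V := Nat.cast_nonneg _
    push_cast
    nlinarith

end TemporalExploration

/-- There is an absolute constant `C > 0` such that any always-connected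
temporal graph `(G_t)_{t ≥ 1}` on `n ≥ 2` vertices all of whose snapshots have maximum
degree at most `d` (`d ≥ 1` an integer) admits, from any start vertex `s`, a temporal
exploration spanning at most `C · n^{3/2} · √(d · log₂ n)` time steps. -/
theorem temporal_exploration_bounded_snapshot_degree :
    ∃ C : ℝ, 0 < C ∧
      ∀ (d : ℕ) (V : Type) [Fintype V] (G : ℕ → SimpleGraph V),
        1 ≤ d → 2 ≤ Fintype.card V →
        (∀ t : ℕ, 1 ≤ t → (G t).Connected) →
        (∀ t : ℕ, 1 ≤ t → ∀ v : V, ((G t).neighborSet v).ncard ≤ d) →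
        ∀ s : V, ∃ (r : ℕ) (w : ℕ → V),
          w 1 = s ∧
          (∀ t : ℕ, 1 ≤ t → t ≤ r → (w t = w (t + 1) ∨ (G t).Adj (w t) (w (t + 1)))) ∧
          (∀ v : V, ∃ t : ℕ, 1 ≤ t ∧ t ≤ r + 1 ∧ w t = v) ∧
          (r : ℝ) ≤ C * (Fintype.card V : ℝ) ^ (3/2 : ℝ) *
            Real.sqrt ((d : ℝ) * Real.logb 2 (Fintype.card V)) := by
  classical
  refine ⟨90, by norm_num, fun d V _ G hd hn hconn hdeg s => ?_⟩
  obtain ⟨r, v, hV, hr⟩ := TemporalExploration.exists_visits_univ hd _ (fun i => G (i + 1)) s {s}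
    (fun i => hconn _ (by omega)) (fun i => hdeg _ (by omega)) (Finset.mem_singleton_self s) rfl
  obtain ⟨w, h0, -, hstep, hcover⟩ := hV.exists_walk
  refine ⟨r, fun t => w (t - 1), h0, fun t ht htr => ?_, fun u => ?_, hr.trans ?_⟩
  · obtain ⟨t, rfl⟩ : ∃ i, t = i + 1 := ⟨t - 1, by omega⟩
    exact hstep t (by omega)
  · rcases hcover u (Finset.mem_univ u) with hu | ⟨j, hj, hju⟩
    · exact ⟨1, le_rfl, by omega, h0.trans (Finset.mem_singleton.1 hu).symm⟩
    · exact ⟨j + 1, by omega, by omega, hju⟩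
  · have hnR : (2 : ℝ) ≤ Fintype.card V := by exact_mod_cast hn
    set n : ℝ := (Fintype.card V : ℝ)
    have hlog : 1 ≤ Real.logb 2 n :=
      (Real.le_logb_iff_rpow_le (by norm_num) (by linarith)).2 (by simpa using hnR)
    have hc : (({s}ᶜ : Finset V).card : ℝ) ≤ n := Nat.cast_le.2 (Finset.card_le_univ _)
    have hpow : n ^ (3 / 2 : ℝ) = n * √n := by
      rw [show (3 / 2 : ℝ) = 1 + 1 / 2 by norm_num, Real.rpow_add (by linarith), Real.rpow_one,
        Real.sqrt_eq_rpow]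
    rw [hpow]
    calc 90 * n * √(d * ({s}ᶜ : Finset V).card)
        ≤ 90 * n * √(n * (d * Real.logb 2 n)) := by
          refine mul_le_mul_of_nonneg_left (Real.sqrt_le_sqrt ?_) (by positivity)
          calc (d : ℝ) * ({s}ᶜ : Finset V).card ≤ d * n := by gcongr
            _ ≤ d * n * Real.logb 2 n := le_mul_of_one_le_right (by positivity) hlog
            _ = n * (d * Real.logb 2 n) := by ring
      _ = 90 * (n * √n) * √(d * Real.logb 2 n) := by
          rw [Real.sqrt_mul (by linarith)]
          ring
end

section
/- There exists an absolute constant C > 0 such that the following holds. Let G = (G_t)_{t ∈ ℕ, t ≥ 1} be an always-connected temporal graph on a vertex set of size n ≥ 2. Then for every start vertex s there exists a two-move temporal exploration of G starting at s spanning at most C · n^{3/2} · sqrt(log₂ n) time steps, i.e., a sequence of vertices (w_1, …, w_{r+1}) with w_1 = s, covering all vertices of G, such that for every t ∈ {1,…,r} there is a walk of length at most 2 in the snapshot G_t from w_t to w_{t+1}, and r ≤ C · n^{3/2} · sqrt(log₂ n). -/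
open Finset

section
variable {V : Type} {H : ℕ → SimpleGraph V}

/-- `Visits H t₀ s t₁ v A`: some temporal walk leaves `s` at time `t₀`, is at `v` at time `t₁`,
and meets every vertex of `A` in between. -/
def Visits (H : ℕ → SimpleGraph V) (t₀ : ℕ) (s : V) (t₁ : ℕ) (v : V) (A : Set V) : Prop :=
  t₀ ≤ t₁ ∧ ∃ w : ℕ → V, w t₀ = s ∧ w t₁ = v ∧
    (∀ t, t₀ ≤ t → t < t₁ → w t = w (t + 1) ∨ (H t).Adj (w t) (w (t + 1))) ∧
    ∀ a ∈ A, ∃ t, t₀ ≤ t ∧ t ≤ t₁ ∧ w t = a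

theorem Visits.mono {t₀ t₁ : ℕ} {s v : V} {A B : Set V} (h : Visits H t₀ s t₁ v B)
    (hAB : A ⊆ B) : Visits H t₀ s t₁ v A := by
  obtain ⟨h0, w, h1, h2, h3, h4⟩ := h
  exact ⟨h0, w, h1, h2, h3, fun a ha => h4 a (hAB ha)⟩

theorem Visits.stay {t₀ t₁ : ℕ} (h : t₀ ≤ t₁) (s : V) : Visits H t₀ s t₁ s {s} :=
  ⟨h, fun _ => s, rfl, rfl, fun _ _ _ => Or.inl rfl, fun _ ha => ⟨t₀, le_rfl, h, ha.symm⟩⟩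

theorem Visits.of_adj {t : ℕ} {u v : V} (h : (H t).Adj u v) : Visits H t u (t + 1) v ∅ := by
  refine ⟨Nat.le_succ t, fun i => if i ≤ t then u else v, by simp, by simp, ?_, by simp⟩
  intro i h1 h2
  obtain rfl : i = t := by omega
  simpa using Or.inr h

theorem Visits.trans {t₀ t₁ t₂ : ℕ} {s u v : V} {A B : Set V} (h : Visits H t₀ s t₁ u A)
    (h' : Visits H t₁ u t₂ v B) : Visits H t₀ s t₂ v (A ∪ B) := by
  obtain ⟨h0, w, h1, h2, h3, h4⟩ := h
  obtain ⟨h0', w', h1', h2', h3', h4'⟩ := h'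
  have hw : ∀ t, t₁ ≤ t → (if t ≤ t₁ then w t else w' t) = w' t := by
    intro t ht
    split_ifs with hle
    · obtain rfl : t = t₁ := by omega
      rw [h2, h1']
    · rfl
  refine ⟨h0.trans h0', fun t => if t ≤ t₁ then w t else w' t, by simp [h0, h1], ?_, ?_, ?_⟩
  · exact (hw _ h0').trans h2'
  · intro t ht ht2
    dsimp only
    rcases lt_or_ge t t₁ with hlt | hge
    · rw [if_pos hlt.le, if_pos (show t + 1 ≤ t₁ from hlt)]
      exact h3 t ht hlt
    · rw [hw t hge, hw (t + 1) (by omega)]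
      exact h3' t hge ht2
  · rintro a (ha | ha)
    · obtain ⟨t, ht, ht', rfl⟩ := h4 a ha
      exact ⟨t, ht, ht'.trans h0', by simp [ht']⟩
    · obtain ⟨t, ht, ht', rfl⟩ := h4' a ha
      exact ⟨t, h0.trans ht, ht', hw t ht⟩

theorem SimpleGraph.Connected.exists_adj_boundary {G : SimpleGraph V} (hG : G.Connected)
    {A : Set V} {a b : V} (ha : a ∈ A) (hb : b ∉ A) : ∃ u v, G.Adj u v ∧ u ∈ A ∧ v ∉ A := by
  obtain ⟨p⟩ := hG.preconnected a b
  obtain ⟨d, -, h1, h2⟩ := p.exists_boundary_dart A ha hb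
  exact ⟨_, _, d.adj, h1, h2⟩

variable [Fintype V]

theorem visits_of_card_le {t₀ : ℕ} (hH : ∀ t, t₀ ≤ t → (H t).Connected) (s v : V) :
    Visits H t₀ s (t₀ + Fintype.card V) v ∅ := by
  classical
  have key : ∀ i, min (i + 1) (Fintype.card V) ≤
      (univ.filter fun u => Visits H t₀ s (t₀ + i) u ∅).card := by
    intro i
    induction i with
    | zero =>
      refine (min_le_left _ _).trans (Finset.card_pos.2 ⟨s, ?_⟩)
      simpa using (Visits.stay le_rfl s).mono (Set.empty_subset _)
    | succ i ih =>
      set A := univ.filter fun u => Visits H t₀ s (t₀ + i) u ∅ with hA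
      set B := univ.filter fun u => Visits H t₀ s (t₀ + (i + 1)) u ∅ with hB
      have hstep : A ⊆ B := by
        intro u hu
        rw [hA, mem_filter] at hu
        rw [hB, mem_filter]
        exact ⟨mem_univ _, (hu.2.trans (Visits.stay (by omega) u)).mono (Set.empty_subset _)⟩
      by_cases hfull : A = univ
      · have : B = univ := univ_subset_iff.1 (hfull ▸ hstep)
        rw [this, card_univ]
        exact min_le_right _ _
      · obtain ⟨b, hb⟩ : ∃ b, b ∉ A := by
          by_contra! h
          exact hfull (eq_univ_iff_forall.2 h)
        have hs : s ∈ A := by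
          rw [hA, mem_filter]
          exact ⟨mem_univ _, (Visits.stay (by omega) s).mono (Set.empty_subset _)⟩
        obtain ⟨u, w, huw, hu, hw⟩ := (hH (t₀ + i) (by omega)).exists_adj_boundary
          (A := (A : Set V)) (by exact_mod_cast hs) (by exact_mod_cast hb)
        have hwB : w ∈ B := by
          have hu' : u ∈ A := by exact_mod_cast hu
          rw [hA, mem_filter] at hu'
          rw [hB, mem_filter]
          exact ⟨mem_univ _, (hu'.2.trans (Visits.of_adj huw)).mono (Set.empty_subset _)⟩
        have : A.card < B.card :=
          card_lt_card ((ssubset_iff_of_subset hstep).2 ⟨w, hwB, by exact_mod_cast hw⟩)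
        omega
  have h := key (Fintype.card V)
  rw [min_eq_right (Nat.le_succ _)] at h
  have := eq_univ_of_card _ (le_antisymm (card_le_univ _) h)
  have hv := this ▸ mem_univ v
  simpa using hv

end

section
variable {V : Type} [Fintype V]

theorem card_add_potential_le [DecidableEq V] {G : SimpleGraph V} (hG : G.Connected) {D K k : ℕ}
    {N : V → Finset V} (hN : ∀ u v, G.Adj u v → u ∈ N v) (hD : ∀ v, (N v).card ≤ D)
    {X : Finset V}
    {S S' : ℕ → V → Finset V} {ρ ρ' : V → ℕ}
    (hS : ∀ v i j, i ≤ j → S j v ⊆ S i v) (hS' : ∀ v i j, i ≤ j → S' j v ⊆ S' i v)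
    (hSS : ∀ j v, S j v ⊆ S' j v) (hadj : ∀ j u v, G.Adj u v → S j u ⊆ S' j v)
    (hρ : ∀ v, ρ v ≤ ρ' v) (hρadj : ∀ u v, G.Adj u v → ρ u ≤ ρ' v)
    (hK : ∀ v, (S (ρ v) v).card < K) (hK' : ∀ v, (S' (ρ' v) v).card < K)
    (hX : ∀ x ∈ X, x ∈ S (ρ x) x) (hk : ∀ v, ρ v < k) :
    X.card + ∑ v, (∑ j ∈ range k, min (S j v).card K + (D + 1) * K * ρ v) ≤
      K + ∑ v, (∑ j ∈ range k, min (S' j v).card K + (D + 1) * K * ρ' v) := by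
  classical
  obtain ⟨z⟩ := hG.nonempty
  let C : V → Finset V := fun w =>
    if ρ w < ρ' w then S (ρ w) w ∪ (N w).biUnion fun u => S (ρ u) u
    else (range k).biUnion fun j => if ρ w ≤ j then S' j w \ S j w else ∅
  have hcover : X ⊆ S (ρ z) z ∪ univ.biUnion C := by
    intro x hx
    rw [mem_union, mem_biUnion]
    by_cases hall : ∀ v, ρ v ≤ ρ x ∧ x ∈ S (ρ x) v
    · exact Or.inl (hS z _ _ (hall z).1 (hall z).2)
    right
    push Not at hall
    obtain ⟨b, hb⟩ := hall
    obtain ⟨u, v, huv, hu, hv⟩ := hG.exists_adj_boundary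
      (A := {v | ρ v ≤ ρ x ∧ x ∈ S (ρ x) v}) (a := x) (b := b) ⟨le_rfl, hX x hx⟩
      (fun h => hb h.1 h.2)
    by_cases hvx : ρ v ≤ ρ x
    · have hxv : x ∉ S (ρ x) v := fun h => hv ⟨hvx, h⟩
      refine ⟨v, mem_univ _, ?_⟩
      by_cases hup : ρ v < ρ' v
      · simp only [C, if_pos hup, mem_union, mem_biUnion]
        exact Or.inr ⟨u, hN u v huv, hS u _ _ hu.1 hu.2⟩
      · simp only [C, if_neg hup, mem_biUnion, mem_range]
        refine ⟨ρ x, hk x, ?_⟩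
        rw [if_pos hvx, mem_sdiff]
        exact ⟨hadj _ _ _ huv hu.2, hxv⟩
    · refine ⟨u, mem_univ _, ?_⟩
      have hup : ρ u < ρ' u := (hu.1.trans_lt (not_le.1 hvx)).trans_le (hρadj _ _ huv.symm)
      simp only [C, if_pos hup, mem_union]
      exact Or.inl (hS u _ _ hu.1 hu.2)
  have hmin : ∀ w j, min (S j w).card K ≤ min (S' j w).card K := fun w j =>
    min_le_min_right _ (card_le_card (hSS j w))
  have hC : ∀ w, (C w).card + (∑ j ∈ range k, min (S j w).card K + (D + 1) * K * ρ w) ≤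
      ∑ j ∈ range k, min (S' j w).card K + (D + 1) * K * ρ' w := by
    intro w
    by_cases hup : ρ w < ρ' w
    · have h1 : (C w).card ≤ (D + 1) * K := by
        simp only [C, if_pos hup]
        refine (card_union_le _ _).trans ?_
        have h2 := card_biUnion_le_card_mul (N w)
          (fun u => S (ρ u) u) K (fun u _ => (hK u).le)
        have h3 := Nat.mul_le_mul_right K (hD w)
        have h4 := (hK w).le
        linarith
      have h2 : ∑ j ∈ range k, min (S j w).card K ≤ ∑ j ∈ range k, min (S' j w).card K :=
        sum_le_sum fun j _ => hmin w j
      have h3 : (D + 1) * K * (ρ w + 1) ≤ (D + 1) * K * ρ' w := Nat.mul_le_mul_left _ hup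
      linarith
    · have heq : ρ' w = ρ w := le_antisymm (not_lt.1 hup) (hρ w)
      have h1 : (C w).card ≤
          ∑ j ∈ range k, (if ρ w ≤ j then S' j w \ S j w else ∅).card := by
        simp only [C, if_neg hup]
        exact card_biUnion_le
      have h2 : ∑ j ∈ range k, (if ρ w ≤ j then S' j w \ S j w else ∅).card +
          ∑ j ∈ range k, min (S j w).card K ≤ ∑ j ∈ range k, min (S' j w).card K := by
        rw [← sum_add_distrib]
        refine sum_le_sum fun j _ => ?_
        split_ifs with hj
        · have h3 : (S' j w).card < K :=
            (card_le_card (hS' w _ _ (heq ▸ hj))).trans_lt (hK' w)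
          have h4 := card_sdiff_add_card_eq_card (hSS j w)
          rw [min_eq_left h3.le]
          exact (Nat.add_le_add_left (min_le_left _ _) _).trans h4.le
        · simpa using hmin w j
      rw [heq]
      linarith
  have h1 : X.card ≤ K + ∑ w, (C w).card :=
    (card_le_card hcover).trans ((card_union_le _ _).trans
      (Nat.add_le_add (hK z).le card_biUnion_le))
  have h2 := sum_le_sum fun w (_ : w ∈ univ) => hC w
  rw [sum_add_distrib] at h2
  linarith

end

section
variable {V : Type}

open Classical in
/-- `Ranked H X K t₀ j t v` certifies a walk within `[t₀, t]` ending at `v` that meets `j` vertices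
of `X`: at each level, at least `K` vertices of `X` can serve as the previous stop. -/
def Ranked (H : ℕ → SimpleGraph V) (X : Finset V) (K t₀ : ℕ) : ℕ → ℕ → V → Prop
  | 0, _, _ => True
  | j + 1, t, v => K ≤ (X.filter fun x =>
      ∃ t', t₀ ≤ t' ∧ Ranked H X K t₀ j t' x ∧ Visits H t' x t v ∅).card

open Classical in
/-- The vertices of `X` from which a walk starting at rank at least `j` can be at `v` at time `t`. -/
noncomputable def sources (H : ℕ → SimpleGraph V) (X : Finset V) (K t₀ j t : ℕ) (v : V) : Finset V :=
  X.filter fun x => ∃ t', t₀ ≤ t' ∧ Ranked H X K t₀ j t' x ∧ Visits H t' x t v ∅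

variable {H : ℕ → SimpleGraph V} {X : Finset V} {K t₀ : ℕ}

theorem mem_sources {j t : ℕ} {v x : V} : x ∈ sources H X K t₀ j t v ↔
    x ∈ X ∧ ∃ t', t₀ ≤ t' ∧ Ranked H X K t₀ j t' x ∧ Visits H t' x t v ∅ := by
  simp [sources]

theorem ranked_succ {j t : ℕ} {v : V} :
    Ranked H X K t₀ (j + 1) t v ↔ K ≤ (sources H X K t₀ j t v).card := Iff.rfl

theorem Ranked.of_succ {j t : ℕ} {v : V} (h : Ranked H X K t₀ (j + 1) t v) :
    Ranked H X K t₀ j t v := by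
  induction j generalizing t v with
  | zero => trivial
  | succ j ih =>
    rw [ranked_succ] at h ⊢
    refine h.trans (card_le_card fun x hx => ?_)
    rw [mem_sources] at hx ⊢
    obtain ⟨hx, t', h1, h2, h3⟩ := hx
    exact ⟨hx, t', h1, ih h2, h3⟩

theorem Ranked.anti {i j t : ℕ} {v : V} (hij : i ≤ j) (h : Ranked H X K t₀ j t v) :
    Ranked H X K t₀ i t v := by
  induction j, hij using Nat.le_induction with
  | base => exact h
  | succ j _ ih => exact ih h.of_succ

theorem sources_anti {i j t : ℕ} {v : V} (hij : i ≤ j) :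
    sources H X K t₀ j t v ⊆ sources H X K t₀ i t v := by
  intro x hx
  rw [mem_sources] at hx ⊢
  obtain ⟨hx, t', h1, h2, h3⟩ := hx
  exact ⟨hx, t', h1, h2.anti hij, h3⟩

theorem sources_subset_of_visits {j t t' : ℕ} {u v : V} (h : Visits H t u t' v ∅) :
    sources H X K t₀ j t u ⊆ sources H X K t₀ j t' v := by
  intro x hx
  rw [mem_sources] at hx ⊢
  obtain ⟨hx, t'', h1, h2, h3⟩ := hx
  exact ⟨hx, t'', h1, h2, (h3.trans h).mono (Set.empty_subset _)⟩

theorem Ranked.of_visits {j t t' : ℕ} {u v : V} (h : Visits H t u t' v ∅)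
    (hu : Ranked H X K t₀ j t u) : Ranked H X K t₀ j t' v := by
  cases j with
  | zero => trivial
  | succ j => exact hu.trans (card_le_card (sources_subset_of_visits h))

theorem Ranked.exists_visits {j t : ℕ} {v : V} (ht : t₀ ≤ t) (h : Ranked H X K t₀ j t v)
    {B : Finset V} (hB : B.card + j ≤ K) :
    ∃ (x : V) (A : Finset V), A ⊆ X ∧ Disjoint A B ∧ A.card = j ∧ Visits H t₀ x t v A := by
  classical
  induction j generalizing t v B with
  | zero =>
    exact ⟨v, ∅, empty_subset _, disjoint_empty_left _, rfl,
      (Visits.stay ht v).mono (by simp)⟩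
  | succ j ih =>
    rw [ranked_succ] at h
    obtain ⟨x, hx, hxB⟩ : ∃ x ∈ sources H X K t₀ j t v, x ∉ B := by
      by_contra! hsub
      have := card_le_card (show sources H X K t₀ j t v ⊆ B from hsub)
      omega
    obtain ⟨hxX, t', ht', hr, hv⟩ := mem_sources.1 hx
    obtain ⟨y, A, hA, hd, hc, hw⟩ := ih ht' hr (B := insert x B) (by
      rw [card_insert_of_notMem hxB]; omega)
    rw [disjoint_insert_right] at hd
    refine ⟨y, insert x A, insert_subset hxX hA, disjoint_insert_left.2 ⟨hxB, hd.2⟩, ?_, ?_⟩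
    · rw [card_insert_of_notMem hd.1, hc]
    · refine ((hw.trans (Visits.stay le_rfl x)).trans hv).mono ?_
      rw [coe_insert, Set.union_empty, Set.union_singleton]

variable [Fintype V]

theorem exists_ranked {N : ℕ → V → Finset V} {D k T : ℕ}
    (hH : ∀ t, t₀ ≤ t → (H t).Connected)
    (hN : ∀ t, t₀ ≤ t → ∀ u v, (H t).Adj u v → u ∈ N t v) (hD : ∀ t v, (N t v).card ≤ D)
    (hT : T * K + Fintype.card V * (k * K + (D + 1) * K * k) < T * X.card) :
    ∃ v, Ranked H X K t₀ k (t₀ + T) v := by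
  classical
  by_contra! hno
  have hno' : ∀ i, i ≤ T → ∀ v, ¬ Ranked H X K t₀ k (t₀ + i) v := fun i hi v h =>
    hno v (h.of_visits ((Visits.stay (by omega) v).mono (Set.empty_subset _)))
  let ρ : ℕ → V → ℕ := fun t v => Nat.findGreatest (fun j => Ranked H X K t₀ j t v) k
  have hρr : ∀ t v, Ranked H X K t₀ (ρ t v) t v := fun t v =>
    Nat.findGreatest_spec (P := fun j => Ranked H X K t₀ j t v) (Nat.zero_le k) trivial
  have hρk : ∀ i, i ≤ T → ∀ v, ρ (t₀ + i) v < k := by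
    intro i hi v
    refine lt_of_le_of_ne (Nat.findGreatest_le k) fun h => hno' i hi v ?_
    have := hρr (t₀ + i) v
    rwa [h] at this
  have hρK : ∀ i, i ≤ T → ∀ v,
      (sources H X K t₀ (ρ (t₀ + i) v) (t₀ + i) v).card < K := by
    intro i hi v
    by_contra! h
    exact Nat.findGreatest_is_greatest (P := fun j => Ranked H X K t₀ j (t₀ + i) v)
      (Nat.lt_succ_self _) (hρk i hi v) (ranked_succ.2 h)
  have hρm : ∀ t u t' v, Visits H t u t' v ∅ → ρ t u ≤ ρ t' v := fun t u t' v h =>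
    Nat.le_findGreatest (Nat.findGreatest_le k) ((hρr t u).of_visits h)
  have hstay : ∀ t (v : V), Visits H t v (t + 1) v ∅ := fun t v =>
    (Visits.stay (Nat.le_succ t) v).mono (Set.empty_subset _)
  let P : ℕ → ℕ := fun t => ∑ v, (∑ j ∈ range k, min (sources H X K t₀ j t v).card K +
    (D + 1) * K * ρ t v)
  have hP : ∀ i, i ≤ T → i * X.card ≤ i * K + P (t₀ + i) := by
    intro i
    induction i with
    | zero => simp
    | succ i ih =>
      intro hi
      have h1 := ih (by omega)
      have h2 : X.card + P (t₀ + i) ≤ K + P (t₀ + (i + 1)) := by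
        refine card_add_potential_le (hH (t₀ + i) (by omega)) (hN (t₀ + i) (by omega))
          (hD (t₀ + i))
          (S := fun j v => sources H X K t₀ j (t₀ + i) v)
          (S' := fun j v => sources H X K t₀ j (t₀ + (i + 1)) v)
          (fun v i j hij => sources_anti hij) (fun v i j hij => sources_anti hij)
          (fun j v => sources_subset_of_visits (hstay _ v))
          (fun j u v huv => sources_subset_of_visits (Visits.of_adj huv))
          (fun v => hρm _ _ _ _ (hstay _ v)) (fun u v huv => hρm _ _ _ _ (Visits.of_adj huv))
          (hρK i (by omega)) (hρK (i + 1) hi) (fun x hx => ?_) (hρk i (by omega))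
        exact mem_sources.2 ⟨hx, t₀ + i, by omega, hρr _ _,
          (Visits.stay le_rfl x).mono (Set.empty_subset _)⟩
      linarith
  have hPle : P (t₀ + T) ≤ Fintype.card V * (k * K + (D + 1) * K * k) := by
    have : ∀ v ∈ (univ : Finset V), ∑ j ∈ range k, min (sources H X K t₀ j (t₀ + T) v).card K +
        (D + 1) * K * ρ (t₀ + T) v ≤ k * K + (D + 1) * K * k := by
      intro v _
      refine Nat.add_le_add ?_ (Nat.mul_le_mul_left _ (Nat.findGreatest_le k))
      simpa using sum_le_card_nsmul (range k)
        (fun j => min (sources H X K t₀ j (t₀ + T) v).card K) K (fun j _ => min_le_right _ _)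
    simpa using sum_le_card_nsmul _ _ _ this
  have := hP T le_rfl
  omega

/-- Twelve times `card V` steps suffice to meet about `√|X|` vertices of `X`. -/
theorem exists_visits_many {N : ℕ → V → Finset V}
    (hH : ∀ t, t₀ ≤ t → (H t).Connected)
    (hN : ∀ t, t₀ ≤ t → ∀ u v, (H t).Adj u v → u ∈ N t v) (hD : ∀ t v, (N t v).card ≤ 3)
    (hX : X.Nonempty) (s : V) :
    ∃ (v : V) (A : Finset V), A ⊆ X ∧ A.Nonempty ∧ X.card ≤ 4 * A.card ^ 2 ∧
      Visits H t₀ s (t₀ + 12 * Fintype.card V) v A := by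
  obtain ⟨x₀, hx₀⟩ := hX
  by_cases hsmall : X.card < 4
  · refine ⟨x₀, {x₀}, by simpa using hx₀, singleton_nonempty _, by simpa using hsmall.le, ?_⟩
    simpa using (visits_of_card_le hH s x₀).trans
      (Visits.stay (show t₀ + Fintype.card V ≤ t₀ + 12 * Fintype.card V by omega) x₀)
  · push Not at hsmall
    have hk1 := Nat.sqrt_le X.card
    have hk2 := Nat.sqrt_lt_self (n := X.card) (by omega)
    have hk3 := Nat.lt_succ_sqrt X.card
    set k := Nat.sqrt X.card with hk
    have hk4 : 2 ≤ k := by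
      rw [hk, Nat.le_sqrt]; omega
    have hn : 0 < Fintype.card V := Fintype.card_pos_iff.2 ⟨x₀⟩
    have hT : 11 * Fintype.card V * k + Fintype.card V * (k * k + (3 + 1) * k * k) <
        11 * Fintype.card V * X.card := by
      have h1 : 11 * k + (k * k + (3 + 1) * k * k) < 11 * X.card := by nlinarith
      nlinarith
    obtain ⟨v, hv⟩ := exists_ranked (H := H) (t₀ := t₀ + Fintype.card V) (N := N)
      (fun t ht => hH t (by omega)) (fun t ht => hN t (by omega)) hD hT
    obtain ⟨x, A, hAX, -, hc, hw⟩ := hv.exists_visits (by omega) (B := ∅) (by simp)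
    refine ⟨v, A, hAX, card_pos.1 (by omega), ?_, ?_⟩
    · rw [hc]; simp only [Nat.succ_eq_add_one] at hk3; nlinarith
    · have := (visits_of_card_le hH s x).trans hw
      rw [Set.empty_union] at this
      convert this using 1
      ring

/-- A temporal graph whose snapshots are connected of maximum degree at most three can be
explored in `O(n ^ (3 / 2))` steps. -/
theorem exists_visits_all {N : ℕ → V → Finset V}
    (hH : ∀ t, t₀ ≤ t → (H t).Connected)
    (hN : ∀ t, t₀ ≤ t → ∀ u v, (H t).Adj u v → u ∈ N t v) (hD : ∀ t v, (N t v).card ≤ 3)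
    (s : V) : ∃ (r : ℕ) (v : V), Visits H t₀ s (t₀ + r) v X ∧
      (r : ℝ) ≤ 48 * Fintype.card V * √(X.card : ℝ) := by
  classical
  induction hm : X.card using Nat.strong_induction_on generalizing X t₀ s with
  | _ m ih =>
    rcases X.eq_empty_or_nonempty with rfl | hX
    · exact ⟨0, s, by simpa using (Visits.stay le_rfl s).mono (Set.empty_subset _),
        by simp only [Nat.cast_zero]; positivity⟩
    obtain ⟨v, A, hAX, hA, hcard, hw⟩ := exists_visits_many hH hN hD hX s
    have hAc := card_pos.2 hA
    have hsub : (X \ A).card = m - A.card := by rw [card_sdiff_of_subset hAX, hm]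
    have hle : A.card ≤ m := hm ▸ card_le_card hAX
    obtain ⟨r, v', hw', hr⟩ := ih (m - A.card) (by omega)
      (t₀ := t₀ + 12 * Fintype.card V) (X := X \ A) (fun t ht => hH t (by omega))
      (fun t ht => hN t (by omega)) v hsub
    refine ⟨12 * Fintype.card V + r, v', ?_, ?_⟩
    · have := hw.trans hw'
      rw [add_assoc] at this
      exact this.mono fun x hx => by by_cases h : x ∈ A <;> simp_all
    · rw [Nat.cast_sub hle] at hr
      have h0 : (0 : ℝ) ≤ m := Nat.cast_nonneg m
      have h1 : (1 : ℝ) ≤ A.card := by exact_mod_cast hAc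
      have h2 : (m : ℝ) ≤ 4 * (A.card : ℝ) ^ 2 := by rw [← hm]; exact_mod_cast hcard
      have h3 : √(m : ℝ) ≤ 2 * A.card := by
        rw [Real.sqrt_le_left (by positivity)]; linarith
      have h4 : 1 ≤ √(m : ℝ) := by
        rw [Real.one_le_sqrt]; exact_mod_cast (by omega : 1 ≤ m)
      have h5 : √((m : ℝ) - A.card) ≤ √(m : ℝ) - 1 / 4 := by
        rw [Real.sqrt_le_left (by linarith)]
        nlinarith [Real.sq_sqrt h0]
      have h6 := mul_le_mul_of_nonneg_left h5
        (show (0 : ℝ) ≤ 48 * Fintype.card V by positivity)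
      push_cast
      linarith

end

/-- The first-child/next-sibling encoding of a spanning tree: the square of a connected graph
contains a connected spanning subgraph of maximum degree at most three. -/
theorem SimpleGraph.Connected.exists_connected_degree_le_three {V : Type} [Fintype V]
    {G : SimpleGraph V} (hG : G.Connected) :
    ∃ (H : SimpleGraph V) (N : V → Finset V), H.Connected ∧ (∀ u v, H.Adj u v → u ∈ N v) ∧
      (∀ v, (N v).card ≤ 3) ∧
      ∀ u v, H.Adj u v → G.Adj u v ∨ ∃ x, G.Adj u x ∧ G.Adj x v := by
  classical
  obtain ⟨r⟩ := hG.nonempty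
  let e := Fintype.equivFin V
  have hpar : ∀ v, ∃ w, v ≠ r → G.Adj v w ∧ G.dist w r < G.dist v r := by
    intro v
    by_cases hv : v = r
    · exact ⟨v, fun h => absurd hv h⟩
    obtain ⟨p, hp⟩ := hG.exists_walk_length_eq_dist v r
    cases p with
    | nil => exact absurd rfl hv
    | cons h p =>
      refine ⟨_, fun _ => ⟨h, ?_⟩⟩
      rw [← hp, SimpleGraph.Walk.length_cons]
      exact Nat.lt_succ_of_le (SimpleGraph.dist_le p)
  choose par hpar using hpar
  let First : V → Prop := fun v => ∀ u, u ≠ r → par u = par v → e v ≤ e u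
  let Next : V → V → Prop := fun v w => w ≠ r ∧ par w = par v ∧ e w < e v ∧
    ∀ u, u ≠ r → par u = par v → e u < e v → e u ≤ e w
  have hpred : ∀ v, ∃ w, (First v ∧ w = par v) ∨ Next v w := by
    intro v
    by_cases hv : First v
    · exact ⟨_, Or.inl ⟨hv, rfl⟩⟩
    simp only [First] at hv
    push Not at hv
    obtain ⟨u, hu, hpu, hlt⟩ := hv
    obtain ⟨w, hw, hmax⟩ := exists_max_image
      (univ.filter fun u => u ≠ r ∧ par u = par v ∧ e u < e v) e ⟨u, by simp [hu, hpu, hlt]⟩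
    rw [mem_filter] at hw
    exact ⟨w, Or.inr ⟨hw.2.1, hw.2.2.1, hw.2.2.2, fun u h1 h2 h3 =>
      hmax u (by simp [h1, h2, h3])⟩⟩
  choose pred hpred using hpred
  let H : SimpleGraph V := SimpleGraph.fromRel fun u v => u ≠ r ∧ pred u = v
  have hreach : ∀ v, v ≠ r → H.Reachable v (pred v) := by
    intro v hv
    by_cases h : v = pred v
    · rw [← h]
    · exact SimpleGraph.Adj.reachable ((SimpleGraph.fromRel_adj _ _ _).2 ⟨h, Or.inl ⟨hv, rfl⟩⟩)
  have hroot : ∀ d v, v ≠ r → G.dist (par v) r = d → H.Reachable v r := by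
    intro d
    induction d using Nat.strong_induction_on with
    | _ d ih =>
      intro v
      induction hi : e v using WellFoundedLT.induction generalizing v with
      | _ i ih' =>
        intro hv hd
        refine (hreach v hv).trans ?_
        rcases hpred v with ⟨-, h⟩ | ⟨h1, h2, h3, -⟩
        · rw [h]
          by_cases hr : par v = r
          · rw [hr]
          · exact ih _ (hd ▸ (hpar _ hr).2) _ hr rfl
        · exact ih' _ (hi ▸ h3) _ rfl h1 (by rw [h2, hd])
  have hroot' : ∀ v, H.Reachable v r := fun v => by
    by_cases hv : v = r
    · rw [hv]
    · exact hroot _ v hv rfl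
  let A : V → Finset V := fun v => univ.filter fun u => u ≠ r ∧ First u ∧ par u = v
  let B : V → Finset V := fun v => univ.filter fun u => u ≠ r ∧ Next u v
  have hA : ∀ v, (A v).card ≤ 1 := fun v => card_le_one.2 fun a ha b hb => by
    simp only [A, mem_filter, mem_univ, true_and] at ha hb
    exact e.injective (le_antisymm (ha.2.1 b hb.1 (hb.2.2.trans ha.2.2.symm))
      (hb.2.1 a ha.1 (ha.2.2.trans hb.2.2.symm)))
  have hB : ∀ v, (B v).card ≤ 1 := fun v => card_le_one.2 fun a ha b hb => by
    simp only [B, mem_filter, mem_univ, true_and] at ha hb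
    obtain ⟨ha, -, ha2, ha3, ha4⟩ := ha
    obtain ⟨hb, -, hb2, hb3, hb4⟩ := hb
    refine e.injective (le_antisymm ?_ ?_)
    · by_contra! h
      exact absurd (ha4 b hb (hb2.symm.trans ha2) h) (not_le.2 hb3)
    · by_contra! h
      exact absurd (hb4 a ha (ha2.symm.trans hb2) h) (not_le.2 ha3)
  refine ⟨H, fun v => {pred v} ∪ A v ∪ B v, ?_, ?_, ?_, ?_⟩
  · have : Nonempty V := ⟨r⟩
    exact ⟨fun u v => (hroot' u).trans (hroot' v).symm⟩
  · intro u v huv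
    rw [SimpleGraph.fromRel_adj] at huv
    simp only [mem_union, mem_singleton, A, B, mem_filter, mem_univ, true_and]
    rcases huv.2 with ⟨hu, rfl⟩ | ⟨-, rfl⟩
    · rcases hpred u with ⟨h1, h2⟩ | h
      · exact Or.inl (Or.inr ⟨hu, h1, h2.symm⟩)
      · exact Or.inr ⟨hu, h⟩
    · exact Or.inl (Or.inl rfl)
  · intro v
    change ({pred v} ∪ A v ∪ B v).card ≤ 3
    have h1 := card_union_le ({pred v} ∪ A v) (B v)
    have h2 := card_union_le {pred v} (A v)
    have h3 := hA v
    have h4 := hB v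
    rw [card_singleton] at h2
    omega
  · have key : ∀ v, v ≠ r → G.Adj v (pred v) ∨ ∃ x, G.Adj v x ∧ G.Adj x (pred v) := by
      intro v hv
      rcases hpred v with ⟨-, h⟩ | ⟨h1, h2, -, -⟩
      · rw [h]
        exact Or.inl (hpar v hv).1
      · exact Or.inr ⟨par v, (hpar v hv).1, h2 ▸ (hpar _ h1).1.symm⟩
    intro u v huv
    rw [SimpleGraph.fromRel_adj] at huv
    rcases huv.2 with ⟨hu, rfl⟩ | ⟨hv, rfl⟩
    · exact key u hu
    · rcases key v hv with h | ⟨x, h1, h2⟩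
      · exact Or.inl h.symm
      · exact Or.inr ⟨x, h2.symm, h1.symm⟩


/-- There is an absolute constant `C > 0` such that any always-connected
temporal graph `(G_t)_{t ≥ 1}` on `n ≥ 2` vertices admits, from any start vertex `s`,
a two-move temporal exploration spanning at most `C · n^{3/2} · √(log₂ n)` time steps:
a sequence `(w_1, …, w_{r+1})` with `w_1 = s`, covering all vertices, such that at each
time step `t ∈ {1,…,r}` the vertex `w_{t+1}` is reachable from `w_t` by a walk of length
at most 2 in the snapshot `G_t`. -/
theorem two_move_temporal_exploration :
    ∃ C : ℝ, 0 < C ∧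
      ∀ (V : Type) [Fintype V] (G : ℕ → SimpleGraph V),
        2 ≤ Fintype.card V →
        (∀ t : ℕ, 1 ≤ t → (G t).Connected) →
        ∀ s : V, ∃ (r : ℕ) (w : ℕ → V),
          w 1 = s ∧
          (∀ t : ℕ, 1 ≤ t → t ≤ r →
            (w t = w (t + 1) ∨ (G t).Adj (w t) (w (t + 1)) ∨
              ∃ x : V, (G t).Adj (w t) x ∧ (G t).Adj x (w (t + 1)))) ∧
          (∀ v : V, ∃ t : ℕ, 1 ≤ t ∧ t ≤ r + 1 ∧ w t = v) ∧
          (r : ℝ) ≤ C * (Fintype.card V : ℝ) ^ (3/2 : ℝ) *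
            Real.sqrt (Real.logb 2 (Fintype.card V)) := by
  refine ⟨48, by norm_num, fun V _ G hn hG s => ?_⟩
  have hex : ∀ t, ∃ (H : SimpleGraph V) (N : V → Finset V), (∀ v, (N v).card ≤ 3) ∧
      (1 ≤ t → H.Connected ∧ (∀ u v, H.Adj u v → u ∈ N v) ∧
        ∀ u v, H.Adj u v → (G t).Adj u v ∨ ∃ x, (G t).Adj u x ∧ (G t).Adj x v) := by
    intro t
    by_cases ht : 1 ≤ t
    · obtain ⟨H, N, h1, h2, h3, h4⟩ := (hG t ht).exists_connected_degree_le_three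
      exact ⟨H, N, h3, fun _ => ⟨h1, h2, h4⟩⟩
    · exact ⟨⊥, fun _ => ∅, by simp, fun h => absurd h ht⟩
  choose H N hD hH using hex
  obtain ⟨r, v, ⟨-, w, hw1, -, hw3, hw4⟩, hr⟩ := exists_visits_all (t₀ := 1) (X := univ)
    (fun t ht => (hH t ht).1) (fun t ht => (hH t ht).2.1) hD s
  refine ⟨r, w, hw1, fun t ht htr => ?_, fun v => ?_, hr.trans ?_⟩
  · exact (hw3 t ht (by omega)).imp_right ((hH t ht).2.2 _ _)
  · obtain ⟨t, h1, h2, h3⟩ := hw4 v (by simp)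
    exact ⟨t, h1, by omega, h3⟩
  · have h2 : (2 : ℝ) ≤ Fintype.card V := by exact_mod_cast hn
    have hlog : 1 ≤ √(Real.logb 2 (Fintype.card V)) := by
      rw [Real.one_le_sqrt, Real.le_logb_iff_rpow_le (by norm_num) (by linarith)]
      simpa using h2
    have hpow : (Fintype.card V : ℝ) ^ (3 / 2 : ℝ) = Fintype.card V * √(Fintype.card V : ℝ) := by
      rw [Real.sqrt_eq_rpow, show (3 / 2 : ℝ) = 1 + 1 / 2 by norm_num,
        Real.rpow_add (by linarith), Real.rpow_one]
    rw [hpow, card_univ, mul_assoc]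
    exact le_mul_of_one_le_right (by positivity) hlog
end

section
/- There exists an absolute constant C > 0 such that the following holds. Let k ≥ 1 be a real number and let G = (G_t)_{t ∈ ℕ, t ≥ 1} be an always-connected temporal graph on a vertex set of size n ≥ 2 whose underlying graph has average degree at most k (equivalently, at most k·n/2 edges). Then for every start vertex s, there exists a temporal exploration of G starting at s that spans at most C · n^{3/2} · sqrt(k · log₂ n) time steps. -/
namespace TemporalGraph

variable {V : Type}

/-- `w` restricted to the times `a, …, b` is a temporal walk of `G`. -/
def IsWalk (G : ℕ → SimpleGraph V) (a b : ℕ) (w : ℕ → V) : Prop :=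
  ∀ t, a ≤ t → t < b → w t = w (t + 1) ∨ (G t).Adj (w t) (w (t + 1))

/-- Some temporal walk leads from `u` at time `a` to `v` at time `b`. -/
def Reach (G : ℕ → SimpleGraph V) (a b : ℕ) (u v : V) : Prop :=
  ∃ w, IsWalk G a b w ∧ w a = u ∧ w b = v

variable {G : ℕ → SimpleGraph V}

/-- Temporal walks can be concatenated. -/
theorem IsWalk.concat {a b c : ℕ} {w₁ w₂ : ℕ → V} (h₁ : IsWalk G a b w₁) (h₂ : IsWalk G b c w₂)
    (h : w₁ b = w₂ b) :
    ∃ w, IsWalk G a c w ∧ (∀ t, t ≤ b → w t = w₁ t) ∧ ∀ t, b ≤ t → w t = w₂ t := by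
  refine ⟨fun t => if t ≤ b then w₁ t else w₂ t, ?_, fun t ht => if_pos ht, ?_⟩
  · intro t hat htc
    rcases lt_trichotomy t b with hlt | rfl | hlt
    · have : t + 1 ≤ b := hlt
      simpa [hlt.le, this] using h₁ t hat hlt
    · simpa [h] using h₂ t le_rfl htc
    · have h1 : ¬ t ≤ b := by omega
      have h2 : ¬ t + 1 ≤ b := by omega
      simpa [h1, h2] using h₂ t hlt.le htc
  · intro t ht
    rcases ht.eq_or_lt with rfl | hlt
    · simpa using h
    · simp [hlt.not_ge]

theorem Reach.refl (a b : ℕ) (u : V) : Reach G a b u u :=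
  ⟨fun _ => u, fun _ _ _ => Or.inl rfl, rfl, rfl⟩

theorem Reach.trans {a b c : ℕ} {u v x : V} (hab : a ≤ b) (hbc : b ≤ c)
    (h₁ : Reach G a b u v) (h₂ : Reach G b c v x) : Reach G a c u x := by
  obtain ⟨w₁, hw₁, ha₁, hb₁⟩ := h₁
  obtain ⟨w₂, hw₂, hb₂, hc₂⟩ := h₂
  obtain ⟨w, hw, hl, hr⟩ := hw₁.concat hw₂ (hb₁.trans hb₂.symm)
  exact ⟨w, hw, (hl a hab).trans ha₁, (hr c hbc).trans hc₂⟩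

theorem Reach.of_adj {t : ℕ} {u v : V} (h : (G t).Adj u v) : Reach G t (t + 1) u v := by
  refine ⟨fun i => if i ≤ t then u else v, ?_, by simp, by simp⟩
  intro i hi hit
  obtain rfl : i = t := by omega
  exact Or.inr (by simpa using h)

theorem Reach.extend_right {a b c : ℕ} {u v : V} (hab : a ≤ b) (hbc : b ≤ c)
    (h : Reach G a b u v) : Reach G a c u v :=
  h.trans hab hbc (Reach.refl b c v)

theorem Reach.extend_left {a b c : ℕ} {u v : V} (hab : a ≤ b) (hbc : b ≤ c)
    (h : Reach G b c u v) : Reach G a c u v :=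
  (Reach.refl a b u).trans hab hbc h

theorem exists_boundary_adj {H : SimpleGraph V} (hH : H.Connected) {X : Set V} {u v : V}
    (hu : u ∈ X) (hv : v ∉ X) : ∃ x y, H.Adj x y ∧ x ∈ X ∧ y ∉ X := by
  obtain ⟨p⟩ := hH.preconnected u v
  obtain ⟨d, -, h1, h2⟩ := p.exists_boundary_dart X hu hv
  exact ⟨d.fst, d.snd, d.adj, h1, h2⟩

/-- In an always-connected temporal graph, all vertices are reached within `|V|` time steps. -/
theorem reach_of_card_le [Fintype V] (hG : ∀ t, 1 ≤ t → (G t).Connected) {a b : ℕ} (ha : 1 ≤ a)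
    (hb : a + Fintype.card V ≤ b) (u v : V) : Reach G a b u v := by
  classical
  have key : ∀ i, (∀ v, Reach G a (a + i) u v) ∨
      i + 1 ≤ (Finset.univ.filter fun v => Reach G a (a + i) u v).card := by
    intro i
    induction i with
    | zero =>
      right
      exact Finset.card_pos.2 ⟨u, by simpa using Reach.refl a a u⟩
    | succ i ih =>
      by_cases hall : ∀ v, Reach G a (a + i) u v
      · exact Or.inl fun v => (hall v).extend_right (by omega) (by omega)
      · right
        have hcard := ih.resolve_left hall
        push Not at hall
        obtain ⟨v, hv⟩ := hall
        obtain ⟨x, y, hxy, hx, hy⟩ := exists_boundary_adj (hG (a + i) (by omega))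
          (X := {v | Reach G a (a + i) u v}) (u := u) (Reach.refl _ _ u) hv
        refine lt_of_le_of_lt hcard (Finset.card_lt_card ?_)
        refine Finset.ssubset_iff_of_subset ?_ |>.2 ⟨y, ?_, ?_⟩
        · intro z hz
          simp only [Finset.mem_filter, Finset.mem_univ, true_and] at hz ⊢
          exact hz.extend_right (by omega) (by omega)
        · simp only [Finset.mem_filter, Finset.mem_univ, true_and]
          exact Reach.trans (by omega) (by omega) hx (Reach.of_adj hxy)
        · simpa using hy
  rcases key (Fintype.card V) with h | h
  · exact (h v).extend_right (by omega) hb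
  · have := Finset.card_le_univ (Finset.univ.filter fun v => Reach G a (a + Fintype.card V) u v)
    omega

/-- If no two distinct vertices of `S` reach each other between the times `a` and `b`, then
`|S| * (b - a)` is bounded in terms of the size of the underlying graph. -/
theorem card_mul_le_of_forall_not_reach [Fintype V] (hG : ∀ t, 1 ≤ t → (G t).Connected)
    {U : SimpleGraph V} [Fintype U.Dart] (hU : ∀ t, 1 ≤ t → G t ≤ U) {S : Finset V}
    (hS : 2 ≤ S.card) {a b : ℕ} (ha : 1 ≤ a)
    (hreach : ∀ u ∈ S, ∀ v ∈ S, Reach G a b u v → u = v) :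
    S.card * (b - a) ≤ Fintype.card V + Fintype.card U.Dart := by
  classical
  have hstep : ∀ p : S × Finset.Ico a b, ∃ q : V ⊕ U.Dart,
      (∃ u, Reach G a p.2 p.1 u ∧ Reach G p.2 b u p.1 ∧ ¬ Reach G (p.2 + 1) b u p.1 ∧
        q = Sum.inl u) ∨
      (∃ d : U.Dart, Reach G a p.2 p.1 d.fst ∧ Reach G p.2 b d.fst p.1 ∧
        ¬ Reach G a p.2 p.1 d.snd ∧ Reach G a (p.2 + 1) p.1 d.snd ∧ q = Sum.inr d) := by
    rintro ⟨⟨j, hj⟩, ⟨t, ht⟩⟩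
    obtain ⟨hat, htb⟩ := Finset.mem_Ico.1 ht
    obtain ⟨i, hi, hij⟩ := Finset.exists_mem_ne (by omega : 1 < S.card) j
    obtain ⟨x, y, hxy, ⟨hx₁, hx₂⟩, hy⟩ := exists_boundary_adj (hG t (by omega))
      (X := {v | Reach G a t j v ∧ Reach G t b v j}) (u := j) (v := i)
      ⟨Reach.refl _ _ _, Reach.refl _ _ _⟩
      (fun h => hij (hreach j hj i hi (h.1.extend_right hat htb.le)).symm)
    have hfwd : Reach G a (t + 1) j y := hx₁.trans hat (by omega) (Reach.of_adj hxy)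
    by_cases hlost : Reach G (t + 1) b x j
    · refine ⟨Sum.inr ⟨(x, y), hU t (by omega) hxy⟩, Or.inr ⟨_, hx₁, hx₂, ?_, ?_, rfl⟩⟩
      · exact fun h => hy ⟨h, (Reach.of_adj hxy.symm).trans (by omega) (by omega) hlost⟩
      · exact hfwd
    · exact ⟨Sum.inl x, Or.inl ⟨x, hx₁, hx₂, hlost, rfl⟩⟩
  choose f hf using hstep
  have hsame : ∀ p q : S × Finset.Ico a b, ∀ u, (p.2 : ℕ) ≤ q.2 → Reach G a p.2 p.1 u →
      Reach G q.2 b u q.1 → p.1 = q.1 := by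
    intro p q u hpq h1 h2
    have hp := Finset.mem_Ico.1 p.2.2
    have hq := Finset.mem_Ico.1 q.2.2
    exact Subtype.ext (hreach _ p.1.2 _ q.1.2
      ((h1.extend_right hp.1 hpq).trans hq.1 hq.2.le h2))
  have hinj : ∀ p q : S × Finset.Ico a b, (p.2 : ℕ) ≤ q.2 → f p = f q → p = q := by
    intro p q hpq hfe
    have hp := Finset.mem_Ico.1 p.2.2
    have hq := Finset.mem_Ico.1 q.2.2
    rcases hf p with ⟨u, h1, h2, h3, h4⟩ | ⟨d, h1, h2, h3, h4, h5⟩ <;>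
    rcases hf q with ⟨u', h1', h2', h3', h4'⟩ | ⟨d', h1', h2', h3', h4', h5'⟩
    · obtain rfl : u = u' := by simpa [h4, h4'] using hfe
      have h := hsame p q u hpq h1 h2'
      refine Prod.ext h (Subtype.ext (hpq.eq_or_lt.resolve_right fun hlt => h3 ?_))
      rw [h]
      exact h2'.extend_left hlt hq.2.le
    · simp [h4, h5'] at hfe
    · simp [h4', h5] at hfe
    · obtain rfl : d = d' := by simpa [h5, h5'] using hfe
      have h := hsame p q _ hpq h1 h2'
      refine Prod.ext h (Subtype.ext (hpq.eq_or_lt.resolve_right fun hlt => h3' ?_))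
      rw [← h]
      exact h4.extend_right (by omega) hlt
  have hf_inj : Function.Injective f := by
    intro p q hpq
    rcases le_total (p.2 : ℕ) q.2 with h | h
    · exact hinj p q h hpq
    · exact (hinj q p h hpq.symm).symm
  simpa using Fintype.card_le_of_injective f hf_inj

/-- About half of the vertices of `A` suffice to reach all of `A` within `w` time steps. -/
theorem exists_half_reaching [Fintype V] (hG : ∀ t, 1 ≤ t → (G t).Connected)
    {U : SimpleGraph V} [Fintype U.Dart] (hU : ∀ t, 1 ≤ t → G t ≤ U) {s w : ℕ} (hs : 2 ≤ s)
    (hsw : Fintype.card V + Fintype.card U.Dart < s * w) {a : ℕ} (ha : 1 ≤ a) (A : Finset V) :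
    ∃ W ⊆ A, 2 * W.card ≤ A.card + s ∧ ∀ x ∈ A, ∃ y ∈ W, Reach G a (a + w) y x := by
  classical
  induction A using Finset.strongInduction with
  | H A ih =>
    by_cases hA : A.card < s
    · exact ⟨A, subset_rfl, by omega, fun x hx => ⟨x, hx, Reach.refl _ _ _⟩⟩
    · have hex : ∃ u ∈ A, ∃ v ∈ A, Reach G a (a + w) u v ∧ u ≠ v := by
        by_contra! hno
        have h := card_mul_le_of_forall_not_reach hG hU (by omega : 2 ≤ A.card) ha hno
        have : s * w ≤ A.card * (a + w - a) := Nat.mul_le_mul (by omega) (by omega)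
        omega
      obtain ⟨u, hu, v, hv, huv, hne⟩ := hex
      have hsub : ({u, v} : Finset V) ⊆ A := by
        simp [Finset.insert_subset_iff, hu, hv]
      have hcard : (A \ {u, v}).card + 2 = A.card := by
        rw [← Finset.card_pair hne]
        exact Finset.card_sdiff_add_card_eq_card hsub
      obtain ⟨W, hWA, hWc, hW⟩ := ih (A \ {u, v})
        (Finset.sdiff_ssubset hsub ⟨u, by simp⟩)
      refine ⟨insert u W, ?_, ?_, ?_⟩
      · exact Finset.insert_subset hu (hWA.trans Finset.sdiff_subset)
      · have := Finset.card_insert_le u W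
        omega
      · intro x hx
        by_cases hxu : x = u
        · exact ⟨u, by simp, hxu ▸ Reach.refl _ _ _⟩
        by_cases hxv : x = v
        · exact ⟨u, by simp, hxv ▸ huv⟩
        obtain ⟨y, hy, hyx⟩ := hW x (by simp [hx, hxu, hxv])
        exact ⟨y, Finset.mem_insert_of_mem hy, hyx⟩

/-- Iterated version of `exists_half_reaching`. -/
theorem exists_small_reaching [Fintype V] (hG : ∀ t, 1 ≤ t → (G t).Connected)
    {U : SimpleGraph V} [Fintype U.Dart] (hU : ∀ t, 1 ≤ t → G t ≤ U) {s w : ℕ} (hs : 2 ≤ s)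
    (hsw : Fintype.card V + Fintype.card U.Dart < s * w) {a : ℕ} (ha : 1 ≤ a) (h : ℕ)
    (A : Finset V) :
    ∃ W ⊆ A, 2 ^ h * W.card + s ≤ A.card + 2 ^ h * s ∧
      ∀ x ∈ A, ∃ y ∈ W, Reach G a (a + h * w) y x := by
  induction h generalizing A with
  | zero => exact ⟨A, subset_rfl, by simp, fun x hx => ⟨x, hx, Reach.refl _ _ _⟩⟩
  | succ h ih =>
    obtain ⟨W₁, hW₁A, hW₁c, hW₁⟩ := exists_half_reaching hG hU hs hsw (a := a + h * w)
      (by omega) A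
    obtain ⟨W, hW, hWc, hWr⟩ := ih W₁
    refine ⟨W, hW.trans hW₁A, ?_, ?_⟩
    · rw [pow_succ]
      linarith
    · intro x hx
      obtain ⟨y, hy, hyx⟩ := hW₁ x hx
      obtain ⟨z, hz, hzy⟩ := hWr y hy
      refine ⟨z, hz, hzy.trans (c := a + (h + 1) * w) (by omega) (by linarith) ?_⟩
      rwa [show a + (h + 1) * w = a + h * w + w by ring]

/-- A large vertex set `A` admits a temporal walk covering `Q + 1` of its vertices. -/
theorem exists_walk_covering [Fintype V] (hG : ∀ t, 1 ≤ t → (G t).Connected)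
    {U : SimpleGraph V} [Fintype U.Dart] (hU : ∀ t, 1 ≤ t → G t ≤ U) {s w h : ℕ} (hs : 2 ≤ s)
    (hsw : Fintype.card V + Fintype.card U.Dart < s * w) (hh : Fintype.card V ≤ 2 ^ h)
    (Q : ℕ) {a : ℕ} (ha : 1 ≤ a) {A : Finset V} (hA : Q * (s + 1) < A.card) :
    ∃ p, IsWalk G a (a + Q * (h * w)) p ∧ p a ∈ A ∧
      ∃ C ⊆ A, C.card = Q + 1 ∧ ∀ c ∈ C, ∃ t, a ≤ t ∧ t ≤ a + Q * (h * w) ∧ p t = c := by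
  classical
  induction Q generalizing a A with
  | zero =>
    obtain ⟨v, hv⟩ := Finset.card_pos.1 (by omega : 0 < A.card)
    refine ⟨fun _ => v, fun _ _ _ => Or.inl rfl, hv, {v}, by simpa using hv, by simp, ?_⟩
    intro c hc
    exact ⟨a, le_rfl, by omega, (Finset.mem_singleton.1 hc).symm⟩
  | succ Q ih =>
    obtain ⟨W, hWA, hWc, hW⟩ := exists_small_reaching hG hU hs hsw ha h A
    have hWs : W.card ≤ s + 1 := by
      have hAn : A.card ≤ 2 ^ h := A.card_le_univ.trans hh
      refine le_of_mul_le_mul_left (a := 2 ^ h) ?_ (by positivity)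
      linarith
    have hcard := Finset.card_sdiff_add_card_eq_card hWA
    obtain ⟨p, hp, hpA, C, hCA, hCc, hC⟩ := ih (a := a + h * w) (by omega) (A := A \ W) (by
      rw [add_mul] at hA
      omega)
    obtain ⟨y, hy, q, hq, hqa, hqb⟩ := hW _ (Finset.sdiff_subset hpA)
    obtain ⟨r, hr, hr₁, hr₂⟩ := hq.concat hp hqb
    have hend : a + h * w + Q * (h * w) = a + (Q + 1) * (h * w) := by ring
    have hra : r a = y := (hr₁ a (by omega)).trans hqa
    refine ⟨r, hend ▸ hr, hra ▸ hWA hy, insert y C, ?_, ?_, ?_⟩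
    · exact Finset.insert_subset (hWA hy) (hCA.trans Finset.sdiff_subset)
    · rw [Finset.card_insert_of_notMem fun h => (Finset.mem_sdiff.1 (hCA h)).2 hy, hCc]
    · intro c hc
      rcases Finset.mem_insert.1 hc with rfl | hc
      · exact ⟨a, le_rfl, by omega, hra⟩
      · obtain ⟨t, h1, h2, h3⟩ := hC c hc
        exact ⟨t, by omega, by omega, (hr₂ t h1).trans h3⟩

/-- From any vertex, a temporal walk spanning at most `3 * |V|` time steps covers more than
`√(|A| / (6 k h))` vertices of a given nonempty set `A`. -/
theorem exists_walk_covering_sqrt [Fintype V] (hG : ∀ t, 1 ≤ t → (G t).Connected)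
    {U : SimpleGraph V} [Fintype U.Dart] (hU : ∀ t, 1 ≤ t → G t ≤ U) {k : ℝ} (hk : 1 ≤ k)
    (hUk : (Fintype.card U.Dart : ℝ) ≤ k * Fintype.card V) {h : ℕ} (hh₁ : 1 ≤ h)
    (hh : Fintype.card V ≤ 2 ^ h) (x : V) {a : ℕ} (ha : 1 ≤ a) {A : Finset V}
    (hA : A.Nonempty) :
    ∃ p, IsWalk G a (a + 3 * Fintype.card V) p ∧ p a = x ∧
      ∃ C ⊆ A, √(A.card / (6 * k * h)) < C.card ∧
        ∀ c ∈ C, ∃ t, a ≤ t ∧ t ≤ a + 3 * Fintype.card V ∧ p t = c := by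
  set n := Fintype.card V with hn
  have hn₁ : 1 ≤ n := Fintype.card_pos_iff.2 ⟨x⟩
  have hAn : A.card ≤ n := A.card_le_univ
  have hhR : (1 : ℝ) ≤ h := by exact_mod_cast hh₁
  have hkh : (1 : ℝ) ≤ k * h := one_le_mul_of_one_le_of_one_le hk hhR
  set Q := ⌊√(A.card / (6 * k * h))⌋₊ with hQ
  have hlong : ∃ b ≤ a + 3 * n, a + n ≤ b ∧ ∃ p, IsWalk G (a + n) b p ∧
      ∃ C ⊆ A, C.card = Q + 1 ∧ ∀ c ∈ C, ∃ t, a + n ≤ t ∧ t ≤ b ∧ p t = c := by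
    rcases Nat.eq_zero_or_pos Q with hQ0 | hQ1
    · obtain ⟨v, hv⟩ := hA
      refine ⟨a + n, by omega, le_rfl, fun _ => v, fun _ _ _ => Or.inl rfl, {v},
        by simpa using hv, by simp [hQ0], fun c hc => ⟨a + n, le_rfl, le_rfl, ?_⟩⟩
      exact (Finset.mem_singleton.1 hc).symm
    · have hQR : (1 : ℝ) ≤ Q := by exact_mod_cast hQ1
      have hQsq : 6 * k * h * (Q : ℝ) ^ 2 ≤ A.card := by
        have h1 : (Q : ℝ) ≤ √(A.card / (6 * k * h)) := Nat.floor_le (Real.sqrt_nonneg _)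
        have h2 := (Real.le_sqrt' (by linarith)).1 h1
        rw [le_div_iff₀ (by nlinarith)] at h2
        linarith
      have hnR : (1 : ℝ) ≤ n := by exact_mod_cast hn₁
      have hQh : Q * h ≤ n := by
        have h1 : (A.card : ℝ) ≤ n := by exact_mod_cast hAn
        have h2 : (Q : ℝ) * h ≤ n := by
          have h3 : (Q : ℝ) * h ≤ k * h * (Q : ℝ) ^ 2 := by
            have : (Q : ℝ) * h * 1 ≤ Q * h * (k * Q) :=
              mul_le_mul_of_nonneg_left (one_le_mul_of_one_le_of_one_le hk hQR) (by positivity)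
            linarith
          nlinarith
        exact_mod_cast h2
      have hQh₁ : 0 < Q * h := by positivity
      set M := n + Fintype.card U.Dart with hM
      set w := n / (Q * h) + 1 with hw
      set s := M / w + 2 with hs
      have hsw : M < s * w := by
        have := Nat.lt_div_mul_add (a := M) (b := w) (by rw [hw]; exact Nat.succ_pos _)
        rw [hs, add_mul]
        omega
      have hwle : Q * (h * w) ≤ 2 * n := by
        have := Nat.mul_div_le n (Q * h)
        calc Q * (h * w) = Q * h * (n / (Q * h)) + Q * h := by rw [hw]; ring
          _ ≤ 2 * n := by omega
      have hwge : n ≤ Q * h * w := by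
        have := Nat.lt_mul_div_succ n hQh₁
        rw [hw]
        omega
      have hsle : (s : ℝ) ≤ 2 * k * (Q * h) + 2 := by
        have hwR : (n : ℝ) ≤ Q * h * w := by exact_mod_cast hwge
        have hw0 : (0 : ℝ) < w := by rw [hw]; positivity
        have h1 : ((M / w : ℕ) : ℝ) ≤ M / w := Nat.cast_div_le
        have h2 : (M : ℝ) / w ≤ 2 * k * (Q * h) := by
          rw [div_le_iff₀ hw0]
          have h3 : (M : ℝ) ≤ 2 * k * n := by
            rw [hM]
            push_cast
            nlinarith
          nlinarith
        rw [hs]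
        push_cast
        linarith
      have hAQ : Q * (s + 1) < A.card := by
        have h1 : (Q : ℝ) * (s + 1) < A.card := by
          have h2 : (Q : ℝ) * (s + 1) ≤ Q * (2 * k * (Q * h) + 3) :=
            mul_le_mul_of_nonneg_left (by linarith) (by linarith)
          have h3 : (Q : ℝ) ≤ k * h * (Q : ℝ) ^ 2 := by
            nlinarith [mul_le_mul hkh hQR (by norm_num) (by linarith)]
          nlinarith
        exact_mod_cast h1
      obtain ⟨p, hp, -, C, hCA, hCc, hC⟩ := exists_walk_covering hG hU (Nat.le_add_left 2 _)
        hsw hh Q (a := a + n) (by omega) hAQ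
      exact ⟨_, by omega, by omega, p, hp, C, hCA, hCc, hC⟩
  obtain ⟨b, hb, hab, p, hp, C, hCA, hCc, hC⟩ := hlong
  obtain ⟨q, hq, hqa, hqb⟩ := reach_of_card_le hG ha (le_refl (a + Fintype.card V)) x (p (a + n))
  obtain ⟨r, hr, hr₁, hr₂⟩ := hq.concat hp hqb
  obtain ⟨r', hr', hr'₁, -⟩ := hr.concat (w₂ := fun _ => r b) (c := a + 3 * n)
    (fun _ _ _ => Or.inl rfl) rfl
  refine ⟨r', hr', ?_, C, hCA, ?_, ?_⟩
  · rw [hr'₁ a (by omega), hr₁ a (by omega), hqa]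
  · rw [hCc]
    push_cast
    exact Nat.lt_floor_add_one _
  · intro c hc
    obtain ⟨t, h1, h2, h3⟩ := hC c hc
    exact ⟨t, by omega, by omega, by rw [hr'₁ t h2, hr₂ t h1, h3]⟩

/-- A vertex set `A` can be covered within `6 |V| √(6 k h) √|A|` time steps. -/
theorem exists_walk_covering_all [Fintype V] (hG : ∀ t, 1 ≤ t → (G t).Connected)
    {U : SimpleGraph V} [Fintype U.Dart] (hU : ∀ t, 1 ≤ t → G t ≤ U) {k : ℝ} (hk : 1 ≤ k)
    (hUk : (Fintype.card U.Dart : ℝ) ≤ k * Fintype.card V) {h : ℕ} (hh₁ : 1 ≤ h)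
    (hh : Fintype.card V ≤ 2 ^ h) (x : V) {a : ℕ} (ha : 1 ≤ a) (A : Finset V) :
    ∃ L : ℕ, (L : ℝ) ≤ 6 * Fintype.card V * √(6 * k * h) * √A.card ∧
      ∃ p, IsWalk G a (a + L) p ∧ p a = x ∧
        ∀ v ∈ A, ∃ t, a ≤ t ∧ t ≤ a + L ∧ p t = v := by
  classical
  induction A using Finset.strongInduction generalizing x a with
  | H A ih =>
    rcases A.eq_empty_or_nonempty with rfl | hA
    · exact ⟨0, by simp, fun _ => x, fun _ _ _ => Or.inl rfl, rfl, by simp⟩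
    set n := Fintype.card V with hn
    have hhR : (1 : ℝ) ≤ h := by exact_mod_cast hh₁
    have hkh : (1 : ℝ) ≤ k * h := one_le_mul_of_one_le_of_one_le hk hhR
    obtain ⟨q, hq, hqa, C, hCA, hCc, hC⟩ :=
      exists_walk_covering_sqrt hG hU hk hUk hh₁ hh x ha hA
    have hCpos : 0 < C.card := by
      have := (Real.sqrt_nonneg _).trans_lt hCc
      exact_mod_cast this
    have hcard := Finset.card_sdiff_add_card_eq_card hCA
    obtain ⟨L, hL, p, hp, hpa, hpc⟩ := ih (A \ C)
      (Finset.sdiff_ssubset hCA (Finset.card_pos.1 hCpos)) (q (a + 3 * n)) (a := a + 3 * n)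
      (by omega)
    obtain ⟨r, hr, hr₁, hr₂⟩ := hq.concat hp hpa.symm
    refine ⟨3 * n + L, ?_, r, by rwa [← add_assoc], (hr₁ a (by omega)).trans hqa, ?_⟩
    · set D := 6 * k * h with hD
      have hD0 : 0 < D := by rw [hD]; linarith
      have hstep : 1 ≤ 2 * √D * (√A.card - √(A \ C).card) := by
        have hA0 : 0 < √(A.card : ℝ) := Real.sqrt_pos.2 (by exact_mod_cast hA.card_pos)
        have hle : √((A \ C).card : ℝ) ≤ √A.card :=
          Real.sqrt_le_sqrt (by exact_mod_cast Finset.card_le_card Finset.sdiff_subset)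
        have h1 : (√(A.card : ℝ)) ^ 2 = A.card := Real.sq_sqrt (by positivity)
        have h2 : (√((A \ C).card : ℝ)) ^ 2 = (A \ C).card := Real.sq_sqrt (by positivity)
        have h3 : ((A \ C).card : ℝ) + C.card = A.card := by exact_mod_cast hcard
        rw [Real.sqrt_div (by positivity), div_lt_iff₀ (Real.sqrt_pos.2 hD0)] at hCc
        have h4 : (C.card : ℝ) ≤ 2 * √A.card * (√A.card - √(A \ C).card) := by nlinarith
        have h5 : √(A.card : ℝ) * 1 ≤ √A.card * (2 * √D * (√A.card - √(A \ C).card)) := by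
          nlinarith [mul_le_mul_of_nonneg_right h4 (Real.sqrt_nonneg D)]
        exact le_of_mul_le_mul_left h5 hA0
      have hn0 : (0 : ℝ) ≤ 3 * n := by positivity
      push_cast
      nlinarith [mul_le_mul_of_nonneg_left hstep hn0]
    · intro v hv
      by_cases hvC : v ∈ C
      · obtain ⟨t, h1, h2, h3⟩ := hC v hvC
        exact ⟨t, h1, by omega, (hr₁ t h2).trans h3⟩
      · obtain ⟨t, h1, h2, h3⟩ := hpc v (Finset.mem_sdiff.2 ⟨hv, hvC⟩)
        exact ⟨t, by omega, by omega, (hr₂ t h1).trans h3⟩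

end TemporalGraph

/-- There is an absolute constant `C > 0` such that any always-connected
temporal graph `(G_t)_{t ≥ 1}` on `n ≥ 2` vertices whose underlying graph has average
degree at most `k` (equivalently, at most `k·n/2` edges), where `k ≥ 1` is real, admits,
from any start vertex `s`, a temporal exploration spanning at most
`C · n^{3/2} · √(k · log₂ n)` time steps. -/
theorem temporal_exploration_bounded_average_degree :
    ∃ C : ℝ, 0 < C ∧
      ∀ (k : ℝ) (V : Type) [Fintype V] (G : ℕ → SimpleGraph V),
        1 ≤ k → 2 ≤ Fintype.card V →
        (∀ t : ℕ, 1 ≤ t → (G t).Connected) →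
        2 * (((⨆ t : ℕ, ⨆ _ : 1 ≤ t, G t : SimpleGraph V).edgeSet.ncard : ℝ))
          ≤ k * Fintype.card V →
        ∀ s : V, ∃ (r : ℕ) (w : ℕ → V),
          w 1 = s ∧
          (∀ t : ℕ, 1 ≤ t → t ≤ r → (w t = w (t + 1) ∨ (G t).Adj (w t) (w (t + 1)))) ∧
          (∀ v : V, ∃ t : ℕ, 1 ≤ t ∧ t ≤ r + 1 ∧ w t = v) ∧
          (r : ℝ) ≤ C * (Fintype.card V : ℝ) ^ (3/2 : ℝ) *
            Real.sqrt (k * Real.logb 2 (Fintype.card V)) := by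
  classical
  refine ⟨24, by norm_num, ?_⟩
  intro k V _ G hk hn hG hE s
  set U : SimpleGraph V := ⨆ t : ℕ, ⨆ _ : 1 ≤ t, G t with hUdef
  have hU : ∀ t, 1 ≤ t → G t ≤ U := fun t ht => le_iSup₂_of_le t ht le_rfl
  have hdart : (Fintype.card U.Dart : ℝ) ≤ k * Fintype.card V := by
    rw [U.dart_card_eq_twice_card_edges, ← Set.ncard_coe_finset, U.coe_edgeFinset]
    exact_mod_cast hE
  set n := Fintype.card V with hn_def
  have hclog : 1 ≤ Nat.clog 2 n := Nat.clog_pos (by norm_num) hn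
  obtain ⟨L, hL, p, hp, hps, hpc⟩ := TemporalGraph.exists_walk_covering_all hG hU hk hdart hclog
    (Nat.le_pow_clog (by norm_num) n) s le_rfl Finset.univ
  refine ⟨L, p, hps, fun t h1 h2 => hp t h1 (by omega), fun v => ?_, hL.trans ?_⟩
  · obtain ⟨t, h1, h2, h3⟩ := hpc v (Finset.mem_univ v)
    exact ⟨t, h1, by omega, h3⟩
  · have hnR : (2 : ℝ) ≤ n := by exact_mod_cast hn
    have hlog₁ : 1 ≤ Real.logb 2 n := by
      rw [Real.le_logb_iff_rpow_le (by norm_num) (by linarith)]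
      simpa using hnR
    have hlog : (Nat.clog 2 n : ℝ) ≤ 2 * Real.logb 2 n := by
      have h1 := Nat.ceil_lt_add_one (show 0 ≤ Real.logb 2 n by linarith)
      have h2 := Real.natCeil_logb_natCast 2 n
      push_cast at h2
      rw [h2] at h1
      linarith
    have hpow : (n : ℝ) ^ (3 / 2 : ℝ) = n * √n := by
      rw [Real.sqrt_eq_rpow, show (3 / 2 : ℝ) = 1 + 1 / 2 by norm_num,
        Real.rpow_add (by linarith), Real.rpow_one]
    have hsqrt : √(6 * k * Nat.clog 2 n) ≤ 4 * √(k * Real.logb 2 n) := by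
      have h16 : (4 : ℝ) = √16 := by
        rw [show (16 : ℝ) = 4 ^ 2 by norm_num, Real.sqrt_sq (by norm_num)]
      rw [h16, ← Real.sqrt_mul (by norm_num)]
      apply Real.sqrt_le_sqrt
      nlinarith [mul_le_mul_of_nonneg_left hlog (show 0 ≤ k by linarith)]
    rw [hpow, Finset.card_univ, ← hn_def]
    calc 6 * (n : ℝ) * √(6 * k * Nat.clog 2 n) * √n
        ≤ 6 * (n : ℝ) * (4 * √(k * Real.logb 2 n)) * √n := by gcongr
      _ = 24 * (n * √n) * √(k * Real.logb 2 n) := by ring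
end

section
/- There exists an absolute constant C > 0 such that the following holds. Let G = (G_t)_{t ∈ ℕ, t ≥ 1} be an always-connected temporal graph on a vertex set of size n ≥ 2 whose underlying graph is planar. Then for every start vertex s, there exists a temporal exploration of G starting at s that spans at most C · n^{3/2} · sqrt(log₂ n) time steps. -/
/-- A graph `P` (the pattern) is a minor of `H`: there is a family of pairwise disjoint
branch sets in `H`, one for each vertex of `P`, each inducing a connected (hence
nonempty) subgraph of `H`, with an edge of `H` between the branch sets of every pair of
adjacent vertices of `P`. -/
def HasMinor {V W : Type} (H : SimpleGraph V) (P : SimpleGraph W) : Prop :=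
  ∃ B : W → Set V,
    (∀ i, (SimpleGraph.induce (B i) H).Connected) ∧
    (Pairwise fun i j => Disjoint (B i) (B j)) ∧
    ∀ i j : W, P.Adj i j → ∃ u ∈ B i, ∃ v ∈ B j, H.Adj u v

/-- A finite simple graph is planar iff it has no `K₅` minor and no `K₃,₃` minor
(Wagner's characterization of planarity). -/
def IsPlanar {V : Type} (H : SimpleGraph V) : Prop :=
  ¬ HasMinor H (⊤ : SimpleGraph (Fin 5)) ∧
  ¬ HasMinor H (completeBipartiteGraph (Fin 3) (Fin 3))

open Classical in
/-- The number of ordered pairs of adjacent vertices. -/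
noncomputable def numDarts {V : Type} [Fintype V] (H : SimpleGraph V) : ℕ :=
  (Finset.univ.filter fun e : V × V => H.Adj e.1 e.2).card

/-- The simple graph obtained by identifying the vertices with the same image under `f`. -/
def quotientGraph {V V' : Type} (H : SimpleGraph V) (f : V → V') : SimpleGraph V' where
  Adj a b := a ≠ b ∧ ∃ u v, f u = a ∧ f v = b ∧ H.Adj u v
  symm := ⟨by
    rintro a b ⟨hab, u, v, hu, hv, huv⟩
    exact ⟨hab.symm, v, u, hv, hu, huv.symm⟩⟩
  loopless := ⟨fun _ h => h.1 rfl⟩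

/-- Contractions of minors: identifying adjacent vertices creates no new minors. -/
theorem HasMinor.of_quotientGraph {V V' W : Type} {H : SimpleGraph V} {P : SimpleGraph W}
    {f : V → V'} (hsurj : f.Surjective) (hf : ∀ u v, f u = f v → u = v ∨ H.Adj u v)
    (h : HasMinor (quotientGraph H f) P) : HasMinor H P := by
  obtain ⟨B, hB, hdisj, hadj⟩ := h
  refine ⟨fun i => f ⁻¹' B i, fun i => ?_, fun i j hij => (hdisj hij).preimage f, ?_⟩
  · have hfib : ∀ u v : f ⁻¹' B i, f u = f v → (H.induce (f ⁻¹' B i)).Reachable u v := by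
      intro u v huv
      rcases hf u v huv with h | h
      · rw [Subtype.ext h]
      · exact SimpleGraph.Adj.reachable (by simpa using h)
    have hreach : ∀ a b : B i, ((quotientGraph H f).induce (B i)).Reachable a b →
        ∀ u v : f ⁻¹' B i, f u = a → f v = b → (H.induce (f ⁻¹' B i)).Reachable u v := by
      rintro a b ⟨p⟩
      induction p with
      | nil => exact fun u v hu hv => hfib u v (hu.trans hv.symm)
      | cons hac _ ih =>
        intro u v hu hv
        obtain ⟨-, x, y, hx, hy, hxy⟩ := hac
        have hxB : x ∈ f ⁻¹' B i := by simp [hx]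
        have hyB : y ∈ f ⁻¹' B i := by simp [hy]
        refine (hfib u ⟨x, hxB⟩ (hu.trans hx.symm)).trans (SimpleGraph.Reachable.trans
          (SimpleGraph.Adj.reachable ?_) (ih ⟨y, hyB⟩ v hy hv))
        simpa using hxy
    have hpre : (H.induce (f ⁻¹' B i)).Preconnected := fun u v =>
      hreach ⟨f u, u.2⟩ ⟨f v, v.2⟩ ((hB i).preconnected _ _) u v rfl rfl
    obtain ⟨⟨a, ha⟩⟩ := (hB i).nonempty
    obtain ⟨u, rfl⟩ := hsurj a
    exact (SimpleGraph.connected_iff _).2 ⟨hpre, ⟨⟨u, ha⟩⟩⟩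
  · intro i j hij
    obtain ⟨a, ha, b, hb, -, u, v, rfl, rfl, huv⟩ := hadj i j hij
    exact ⟨u, ha, v, hb, huv⟩

theorem connected_induce_singleton {V : Type} (H : SimpleGraph V) (x : V) :
    (H.induce {x}).Connected :=
  (SimpleGraph.connected_iff _).2 ⟨fun u v => by rw [Subsingleton.elim u v], ⟨⟨x, rfl⟩⟩⟩

/-- Adding a vertex to a clique minor in its neighbourhood. -/
theorem HasMinor.top_succ_of_neighborSet {V : Type} {H : SimpleGraph V} (x : V) {r : ℕ}
    (h : HasMinor (H.induce (H.neighborSet x)) (⊤ : SimpleGraph (Fin r))) :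
    HasMinor H (⊤ : SimpleGraph (Fin (r + 1))) := by
  obtain ⟨B, hB, hdisj, hadj⟩ := h
  have hx : ∀ i, x ∉ Subtype.val '' B i := by
    rintro i ⟨⟨y, hy⟩, -, hyx⟩
    exact H.ne_of_adj hy hyx.symm
  refine ⟨Fin.cons {x} fun i => Subtype.val '' B i, fun i => ?_, fun i j hij => ?_, ?_⟩
  · refine Fin.cases ?_ (fun i => ?_) i
    · exact connected_induce_singleton H x
    · let g : (H.induce (H.neighborSet x)).induce (B i) →g H.induce (Subtype.val '' B i) :=
        { toFun := fun u => ⟨u.1.1, u.1, u.2, rfl⟩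
          map_rel' := fun {a b} hab => hab }
      refine (hB i).map g ?_
      rintro ⟨_, u, hu, rfl⟩
      exact ⟨⟨u, hu⟩, rfl⟩
  · revert hij
    refine Fin.cases ?_ (fun i => ?_) i <;> refine Fin.cases ?_ (fun j => ?_) j
    · simp
    · intro _
      simp [hx j]
    · intro _
      simp [hx i]
    · intro hij
      simp only [Fin.cons_succ]
      exact (Set.disjoint_image_iff Subtype.val_injective).2
        (hdisj fun h => hij (congrArg Fin.succ h))
  · have hnb : ∀ i, ∃ v ∈ Subtype.val '' B i, H.Adj x v := by
      intro i
      obtain ⟨⟨y, hy⟩⟩ := (hB i).nonempty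
      exact ⟨y.1, ⟨y, hy, rfl⟩, y.2⟩
    intro i j
    refine Fin.cases ?_ (fun i => ?_) i <;> refine Fin.cases ?_ (fun j => ?_) j
    · simp
    · intro _
      obtain ⟨v, hv, hxv⟩ := hnb j
      exact ⟨x, by simp, v, by simpa using hv, hxv⟩
    · intro _
      obtain ⟨v, hv, hxv⟩ := hnb i
      exact ⟨v, by simpa using hv, x, by simp, hxv.symm⟩
    · intro hij
      obtain ⟨u, hu, v, hv, huv⟩ := hadj i j (fun h => hij (congrArg Fin.succ h))
      exact ⟨u.1, ⟨u, hu, rfl⟩, v.1, ⟨v, hv, rfl⟩, huv⟩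

theorem numDarts_eq_sum {V : Type} [Fintype V] (H : SimpleGraph V) :
    numDarts H = ∑ v, (H.neighborSet v).ncard := by
  classical
  unfold numDarts
  rw [← Finset.univ_product_univ, Finset.card_filter, Finset.sum_product]
  refine Finset.sum_congr rfl fun v _ => ?_
  rw [← Finset.card_filter, ← Set.ncard_coe_finset]
  congr 1
  ext
  simp

/-- The map contracting the pair `x, y` to `x`. -/
def contractTo {V : Type} [DecidableEq V] {x y : V} (hxy : x ≠ y) (v : V) : {v : V // v ≠ y} :=
  if h : v = y then ⟨x, hxy⟩ else ⟨v, h⟩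

theorem numDarts_le_contract {V : Type} [Fintype V] [DecidableEq V] (H : SimpleGraph V) {x y : V}
    (hxy : H.Adj x y) :
    numDarts H ≤ numDarts (quotientGraph H (contractTo hxy.ne)) +
      2 * ((H.commonNeighbors x y).ncard + 1) := by
  classical
  let N : Finset V := insert x (Finset.univ.filter fun z => H.Adj x z ∧ H.Adj y z)
  have hN : N.card ≤ (H.commonNeighbors x y).ncard + 1 := by
    refine (Finset.card_insert_le _ _).trans (le_of_eq ?_)
    rw [← Set.ncard_coe_finset]
    congr 2
    ext
    simp [SimpleGraph.mem_commonNeighbors]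
  let R : Finset (V × V) := N.image (fun z => (y, z)) ∪ N.image (fun z => (z, y))
  have hR : R.card ≤ 2 * N.card := by
    refine (Finset.card_union_le _ _).trans ?_
    have h1 : (N.image (fun z => (y, z))).card ≤ N.card := Finset.card_image_le
    have h2 : (N.image (fun z => (z, y))).card ≤ N.card := Finset.card_image_le
    omega
  let E := Finset.univ.filter fun e : V × V => H.Adj e.1 e.2
  have hER : (E \ R).card ≤ numDarts (quotientGraph H (contractTo hxy.ne)) := by
    have hmem : ∀ u v, (u, v) ∈ E \ R → H.Adj u v ∧
        (u = y → v ≠ x ∧ ¬ H.Adj x v) ∧ (v = y → u ≠ x ∧ ¬ H.Adj x u) := by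
      intro u v h
      simp only [E, R, N, Finset.mem_sdiff, Finset.mem_filter, Finset.mem_univ, true_and,
        Finset.mem_union, Finset.mem_image, Finset.mem_insert, Prod.mk.injEq, not_or,
        not_exists, not_and] at h
      obtain ⟨h1, h2, h3⟩ := h
      refine ⟨h1, ?_, ?_⟩
      · rintro rfl
        exact ⟨fun hv => h2 v (Or.inl hv) rfl rfl, fun hv => h2 v (Or.inr ⟨hv, h1⟩) rfl rfl⟩
      · rintro rfl
        exact ⟨fun hv => h3 u (Or.inl hv) rfl rfl, fun hv => h3 u (Or.inr ⟨hv, h1.symm⟩) rfl rfl⟩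
    have hval : ∀ u v : V, contractTo hxy.ne u = contractTo hxy.ne v →
        u = v ∨ (u = x ∧ v = y) ∨ (u = y ∧ v = x) := by
      intro u v h
      unfold contractTo at h
      split_ifs at h with h1 h2 h2 <;> simp only [Subtype.mk.injEq] at h <;> grind
    refine Finset.card_le_card_of_injOn
      (fun e => (contractTo hxy.ne e.1, contractTo hxy.ne e.2)) ?_ ?_
    · rintro ⟨u, v⟩ he
      obtain ⟨h1, h2, h3⟩ := hmem u v he
      simp only [Finset.coe_filter, Finset.mem_univ, true_and, Set.mem_ofPred_eq]
      refine ⟨fun h => ?_, u, v, rfl, rfl, h1⟩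
      rcases hval u v h with h | ⟨h, h'⟩ | ⟨h, h'⟩
      · exact h1.ne h
      · exact (h3 h').1 h
      · exact (h2 h).1 h'
    · rintro ⟨u, v⟩ he ⟨u', v'⟩ he' heq
      obtain ⟨h1, h2, h3⟩ := hmem u v he
      obtain ⟨h1', h2', h3'⟩ := hmem u' v' he'
      simp only [Prod.mk.injEq] at heq
      have e1 := hval _ _ heq.1
      have e2 := hval _ _ heq.2
      have := hxy.ne
      have s1 := h1.symm
      have s2 := h1'.symm
      have s3 := hxy.symm
      clear heq hmem hval he he'
      simp only [Prod.mk.injEq]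
      grind
  have := Finset.le_card_sdiff R E
  have hE : numDarts H = E.card := rfl
  omega

/-- Dense graphs have clique minors. -/
theorem hasMinor_top_of_le_numDarts (r : ℕ) : ∀ (V : Type) [Fintype V] [Nonempty V]
    (H : SimpleGraph V), 2 ^ (r + 1) * Fintype.card V ≤ numDarts H →
      HasMinor H (⊤ : SimpleGraph (Fin (r + 1))) := by
  induction r with
  | zero =>
    intro V _ _ H _
    have : Subsingleton (Fin (0 + 1)) := inferInstanceAs (Subsingleton (Fin 1))
    obtain ⟨x⟩ := ‹Nonempty V›
    refine ⟨fun _ => {x}, fun i => ?_, fun i j hij => absurd (Subsingleton.elim i j) hij,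
      fun i j hij => absurd (Subsingleton.elim i j) hij.ne⟩
    exact connected_induce_singleton H x
  | succ r ihr =>
    intro V _ _
    have main : ∀ (n : ℕ) (V : Type) [Fintype V] [Nonempty V] (H : SimpleGraph V),
        Fintype.card V = n → 2 ^ (r + 2) * Fintype.card V ≤ numDarts H →
        HasMinor H (⊤ : SimpleGraph (Fin (r + 2))) := by
      intro n
      induction n with
      | zero =>
        intro V _ _ H hn
        exact absurd hn Fintype.card_ne_zero
      | succ n ihn =>
        intro V _ _ H hn hdarts
        classical
        have hpow : 2 ^ (r + 2) = 2 * 2 ^ (r + 1) := by ring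
        have hpos : 0 < 2 ^ (r + 1) := by positivity
        obtain ⟨⟨x, y₀⟩, hx⟩ : (Finset.univ.filter fun e : V × V => H.Adj e.1 e.2).Nonempty := by
          refine Finset.card_pos.1 (lt_of_lt_of_le ?_ hdarts)
          have : 0 < Fintype.card V := Fintype.card_pos
          positivity
        have hxy₀ : H.Adj x y₀ := by simpa using hx
        by_cases hfew : ∃ x y, H.Adj x y ∧ (H.commonNeighbors x y).ncard + 1 ≤ 2 ^ (r + 1)
        · obtain ⟨x, y, hxy, hc⟩ := hfew
          have hsurj : Function.Surjective (contractTo hxy.ne) := by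
            rintro ⟨v, hv⟩
            exact ⟨v, by simp [contractTo, hv]⟩
          refine HasMinor.of_quotientGraph hsurj ?_ ?_
          · intro u v h
            unfold contractTo at h
            split_ifs at h with h1 h2 h2 <;> simp only [Subtype.mk.injEq] at h
            · exact Or.inl (h1.trans h2.symm)
            · exact Or.inr (h1 ▸ h ▸ hxy.symm)
            · exact Or.inr (h2 ▸ h ▸ hxy)
            · exact Or.inl h
          · have : Nonempty {v : V // v ≠ y} := ⟨⟨x, hxy.ne⟩⟩
            have hcard : Fintype.card {v : V // v ≠ y} = n := by
              have := Set.card_ne_eq y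
              simp_all
            refine ihn _ _ hcard ?_
            have h1 := numDarts_le_contract H hxy
            rw [hcard]
            rw [hn, mul_add] at hdarts
            omega
        · push Not at hfew
          refine HasMinor.top_succ_of_neighborSet x ?_
          have : Nonempty (H.neighborSet x) := ⟨⟨y₀, hxy₀⟩⟩
          refine ihr _ _ ?_
          rw [numDarts_eq_sum, mul_comm, ← smul_eq_mul]
          refine Finset.card_nsmul_le_sum Finset.univ _ _ ?_
          rintro ⟨y, hy⟩ -
          have h1 := hfew x y hy
          have h2 : H.commonNeighbors x y =
              Subtype.val '' ((H.induce (H.neighborSet x)).neighborSet ⟨y, hy⟩) := by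
            ext z
            simp [SimpleGraph.mem_commonNeighbors, and_comm]
          rw [h2, Set.ncard_image_of_injective _ Subtype.val_injective] at h1
          omega
    exact fun H hH => main _ V H rfl hH

/-- There is a temporal walk in `G` that starts in `s` at time `a`, ends in `v` at time `b` and
visits every vertex of `W`. -/
def Covers {V : Type} (G : ℕ → SimpleGraph V) (a : ℕ) (s : V) (b : ℕ) (v : V)
    (W : Finset V) : Prop :=
  a ≤ b ∧ ∃ w : ℕ → V, w a = s ∧ w b = v ∧
    (∀ t, a ≤ t → t < b → (w t = w (t + 1) ∨ (G t).Adj (w t) (w (t + 1)))) ∧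
    ∀ x ∈ W, ∃ t, a ≤ t ∧ t ≤ b ∧ w t = x

namespace Covers

variable {V : Type} {G : ℕ → SimpleGraph V} {a b c : ℕ} {s u v : V} {W W' : Finset V}

theorem refl (G : ℕ → SimpleGraph V) (a : ℕ) (s : V) : Covers G a s a s {s} :=
  ⟨le_rfl, fun _ => s, rfl, rfl, fun _ _ _ => Or.inl rfl, fun _ hx =>
    ⟨a, le_rfl, le_rfl, (Finset.mem_singleton.1 hx).symm⟩⟩

theorem mono (h : Covers G a s b v W) (hW : W' ⊆ W) : Covers G a s b v W' := by
  obtain ⟨hab, w, h1, h2, h3, h4⟩ := h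
  exact ⟨hab, w, h1, h2, h3, fun x hx => h4 x (hW hx)⟩

theorem step (b : ℕ) (h : u = v ∨ (G b).Adj u v) : Covers G b u (b + 1) v {v} := by
  refine ⟨by omega, fun t => if t ≤ b then u else v, by simp, by simp, ?_, ?_⟩
  · intro t h1 h2
    obtain rfl : t = b := by omega
    simpa using h
  · intro x hx
    exact ⟨b + 1, by omega, le_rfl, by simpa using (Finset.mem_singleton.1 hx).symm⟩

theorem trans [DecidableEq V] (h : Covers G a s b v W) (h' : Covers G b v c u W') :
    Covers G a s c u (W ∪ W') := by
  obtain ⟨hab, w, h1, h2, h3, h4⟩ := h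
  obtain ⟨hbc, w', h1', h2', h3', h4'⟩ := h'
  refine ⟨hab.trans hbc, fun t => if t ≤ b then w t else w' t, by simp [hab, h1], ?_, ?_, ?_⟩
  · by_cases hcb : c ≤ b
    · obtain rfl : b = c := le_antisymm hbc hcb
      simp [h2, ← h1', h2']
    · simp [hcb, h2']
  · intro t hat htc
    by_cases htb : t < b
    · simpa [htb.le, Nat.succ_le_of_lt htb] using h3 t hat htb
    · have hb : b ≤ t := not_lt.1 htb
      have hn : ¬ t + 1 ≤ b := by omega
      have key := h3' t hb htc
      by_cases hbt : t ≤ b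
      · obtain rfl : t = b := le_antisymm hbt hb
        simpa [h2, ← h1'] using key
      · simpa [hbt, hn] using key
  · intro x hx
    rcases Finset.mem_union.1 hx with hx | hx
    · obtain ⟨t, ht1, ht2, ht3⟩ := h4 x hx
      exact ⟨t, ht1, ht2.trans hbc, by simp [ht2, ht3]⟩
    · obtain ⟨t, ht1, ht2, ht3⟩ := h4' x hx
      refine ⟨t, hab.trans ht1, ht2, ?_⟩
      by_cases htb : t ≤ b
      · obtain rfl : t = b := le_antisymm htb ht1
        simp [h2, ← h1', ht3]
      · simp [htb, ht3]

theorem stay (v : V) (h : a ≤ b) : Covers G a v b v {v} := by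
  classical
  induction b, h using Nat.le_induction with
  | base => exact refl G a v
  | succ b _ ih => simpa using ih.trans (step (G := G) b (Or.inl (rfl : v = v)))

end Covers

theorem SimpleGraph.Connected.forall_of_adj_closed {V : Type} {G : SimpleGraph V}
    (hG : G.Connected) {A : V → Prop} (hA : ∀ u v, A u → G.Adj u v → A v) {x : V} (hx : A x)
    (y : V) : A y := by
  obtain ⟨p⟩ := hG.preconnected x y
  induction p with
  | nil => exact hx
  | cons h _ ih => exact ih (hA _ _ hx h)

/-- In an always-connected temporal graph every vertex can be reached within `card V` steps. -/
theorem covers_card_steps {V : Type} [Fintype V] {G : ℕ → SimpleGraph V} {a : ℕ}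
    (hG : ∀ t, a ≤ t → (G t).Connected) (s v : V) :
    Covers G a s (a + Fintype.card V) v {v} := by
  classical
  let R : ℕ → Finset V := fun j => Finset.univ.filter fun v => Covers G a s (a + j) v {v}
  have hmono : ∀ j, R j ⊆ R (j + 1) := fun j v hv => by
    simp only [R, Finset.mem_filter, Finset.mem_univ, true_and] at hv ⊢
    exact (hv.trans (Covers.step (G := G) (a + j) (Or.inl (rfl : v = v)))).mono (by simp)
  have hR : ∀ j, j + 1 ≤ (R j).card ∨ R j = Finset.univ := by
    intro j
    induction j with
    | zero =>
      left
      exact Finset.card_pos.2 ⟨s, by simpa [R] using Covers.refl G a s⟩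
    | succ j ih =>
      by_cases hu : R (j + 1) = Finset.univ
      · exact Or.inr hu
      left
      rcases ih with ih | ih
      · refine Nat.succ_le_of_lt (lt_of_le_of_lt ih (Finset.card_lt_card ⟨hmono j, fun hsub => hu ?_⟩))
        refine Finset.eq_univ_of_forall fun y => hmono j ?_
        obtain ⟨x, hx⟩ : (R j).Nonempty := Finset.card_pos.1 (by omega)
        refine (hG (a + j) (by omega)).forall_of_adj_closed (A := fun y => y ∈ R j) ?_ hx y
        intro u v huR huv
        refine hsub ?_
        simp only [R, Finset.mem_filter, Finset.mem_univ, true_and] at huR ⊢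
        exact (huR.trans (Covers.step (G := G) (a + j) (Or.inr huv))).mono (by simp)
      · exact absurd (Finset.eq_univ_of_forall fun y => hmono j (ih ▸ Finset.mem_univ y)) hu
  have huniv : R (Fintype.card V) = Finset.univ := by
    rcases hR (Fintype.card V) with h | h
    · have := Finset.card_le_univ (R (Fintype.card V))
      omega
    · exact h
  have hv : v ∈ R (Fintype.card V) := huniv ▸ Finset.mem_univ v
  simpa [R] using hv

/-- A set carrying a digraph of out-degree at most `l` has a large independent subset. -/
theorem exists_independent_subset {V : Type} [DecidableEq V] (W : V → Finset V) (l : ℕ)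
    (hW : ∀ x, (W x).card ≤ l) (S : Finset V) :
    ∃ I ⊆ S, (∀ x ∈ I, ∀ y ∈ I, x ≠ y → y ∉ W x) ∧ S.card ≤ I.card * (2 * l + 1) := by
  induction S using Finset.strongInduction with
  | H S ih =>
    rcases S.eq_empty_or_nonempty with rfl | hS
    · exact ⟨∅, by simp, by simp, by simp⟩
    obtain ⟨x, hxS, hx⟩ : ∃ x ∈ S, (S.filter fun y => x ∈ W y).card ≤ l := by
      refine Finset.exists_le_of_sum_le (f := fun x => (S.filter fun y => x ∈ W y).card)
        (g := fun _ => l) hS ?_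
      have hcount := Finset.sum_card_bipartiteAbove_eq_sum_card_bipartiteBelow
        (s := S) (t := S) (fun x y => x ∈ W y)
      unfold Finset.bipartiteAbove Finset.bipartiteBelow at hcount
      rw [hcount]
      refine Finset.sum_le_sum fun y _ => (Finset.card_le_card ?_).trans (hW y)
      intro z hz
      exact (Finset.mem_filter.1 hz).2
    let N : Finset V := insert x (W x ∪ S.filter fun y => x ∈ W y)
    have hN : N.card ≤ 2 * l + 1 := by
      refine (Finset.card_insert_le _ _).trans ?_
      have := Finset.card_union_le (W x) (S.filter fun y => x ∈ W y)
      have := hW x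
      omega
    obtain ⟨I, hIS, hI, hcard⟩ := ih (S \ N) (Finset.ssubset_iff_subset_ne.2
      ⟨Finset.sdiff_subset, fun h => by
        have hx' := hxS
        rw [← h] at hx'
        simp [N] at hx'⟩)
    have hIN : ∀ y ∈ I, y ∈ S ∧ y ≠ x ∧ y ∉ W x ∧ x ∉ W y := by
      intro y hy
      have := hIS hy
      simp only [N, Finset.mem_sdiff, Finset.mem_insert, Finset.mem_union, Finset.mem_filter,
        not_or, not_and] at this
      exact ⟨this.1, this.2.1, this.2.2.1, this.2.2.2 this.1⟩
    refine ⟨insert x I, ?_, ?_, ?_⟩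
    · exact Finset.insert_subset hxS fun y hy => (hIN y hy).1
    · intro y hy z hz hyz
      rcases Finset.mem_insert.1 hy with hyx | hy' <;> rcases Finset.mem_insert.1 hz with hzx | hz'
      · exact absurd (hyx.trans hzx.symm) hyz
      · exact hyx ▸ (hIN z hz').2.2.1
      · exact hzx ▸ (hIN y hy').2.2.2
      · exact hI y hy' z hz' hyz
    · rw [Finset.card_insert_of_notMem fun hx => (hIN x hx).2.1 rfl]
      have := Finset.le_card_sdiff N S
      rw [add_mul, one_mul]
      omega

/-- If labels spread along the edges of a connected graph, and each marked vertex carries only its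
own label, then the vertices at which the labelling changes have large total degree. -/
theorem card_le_two_mul_sum_changed {V : Type} [Fintype V] [DecidableEq V] {H : SimpleGraph V}
    [DecidableRel H.Adj] (hH : H.Connected) (d : V → ℕ) (hd : ∀ v, H.degree v ≤ d v)
    (hd1 : ∀ v, 1 ≤ d v) (w w' : V → ℕ) (T T' : V → Finset V)
    (hw : ∀ u v, (u = v ∨ H.Adj u v) → w u ≤ w' v)
    (hT : ∀ u v, (u = v ∨ H.Adj u v) → w u = w' v → T u ⊆ T' v)
    (I : Finset V) (hI : 2 ≤ I.card) (hTI : ∀ x ∈ I, T x = {x}) :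
    I.card ≤ 2 * ∑ v ∈ Finset.univ.filter
      (fun v => 3 * w v + min (T v).card 2 < 3 * w' v + min (T' v).card 2), d v := by
  set Z := Finset.univ.filter
      (fun v => 3 * w v + min (T v).card 2 < 3 * w' v + min (T' v).card 2) with hZ
  have hnotZ : ∀ v, v ∉ Z → w v = w' v ∧ T v ⊆ T' v ∧
      min (T v).card 2 = min (T' v).card 2 := by
    intro v hv
    have h1 : ¬ (3 * w v + min (T v).card 2 < 3 * w' v + min (T' v).card 2) := by
      simpa [hZ] using hv
    have h2 := hw v v (Or.inl rfl)
    have h3 : w v = w' v := by omega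
    have h4 := hT v v (Or.inl rfl) h3
    have h5 := Finset.card_le_card h4
    exact ⟨h3, h4, by omega⟩
  have hedge : ∀ x ∈ I \ Z, ∃ e : Σ _ : V, V,
      e ∈ Z.sigma (fun z => H.neighborFinset z) ∧ T e.2 = {x} := by
    intro x hxIZ
    obtain ⟨hxI, hxZ⟩ := Finset.mem_sdiff.1 hxIZ
    by_contra! hno
    have hall : ∀ y, y ∉ Z ∧ T y = {x} := by
      refine hH.forall_of_adj_closed (A := fun y => y ∉ Z ∧ T y = {x}) ?_ ⟨hxZ, hTI x hxI⟩
      rintro u v ⟨huZ, huT⟩ huv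
      have hvZ : v ∉ Z := fun hvZ => hno ⟨v, u⟩ (by simp [hvZ, huv.symm]) huT
      obtain ⟨hu1, hu2, hu3⟩ := hnotZ u huZ
      obtain ⟨hv1, hv2, hv3⟩ := hnotZ v hvZ
      have huv' := hw u v (Or.inr huv)
      have hvu' := hw v u (Or.inr huv.symm)
      have e1 := hT u v (Or.inr huv) (by omega)
      have e2 := hT v u (Or.inr huv.symm) (by omega)
      have hc : (T u).card = 1 := by simp [huT]
      have hTu : T u = T' u := Finset.eq_of_subset_of_card_le hu2 (by omega)
      have hc' := Finset.card_le_card e1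
      refine ⟨hvZ, Finset.eq_of_subset_of_card_le ?_ ?_⟩
      · rw [← huT, hTu]; exact e2
      · rw [Finset.card_singleton]; omega
    obtain ⟨y, hy, hyx⟩ := Finset.exists_mem_ne (by omega : 1 < I.card) x
    have h1 := (hall y).2
    rw [hTI y hy, Finset.singleton_inj] at h1
    exact hyx h1
  have : Nonempty (Σ _ : V, V) := hH.nonempty.elim fun v => ⟨⟨v, v⟩⟩
  choose! f hf1 hf2 using hedge
  have hcard1 : (I \ Z).card ≤ (Z.sigma (fun z => H.neighborFinset z)).card := by
    refine Finset.card_le_card_of_injOn f ?_ ?_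
    · exact hf1
    · intro x hx y hy hxy
      have h1 := hf2 x hx
      rw [hxy, hf2 y hy, Finset.singleton_inj] at h1
      exact h1.symm
  rw [Finset.card_sigma] at hcard1
  have hcard2 : ∑ z ∈ Z, (H.neighborFinset z).card ≤ ∑ z ∈ Z, d z :=
    Finset.sum_le_sum fun z _ => by simpa using hd z
  have hcard3 : Z.card ≤ ∑ z ∈ Z, d z := by
    simpa using Finset.card_nsmul_le_sum Z d 1 fun z _ => hd1 z
  have hcard4 := Finset.le_card_sdiff Z I
  omega

open Classical in
/-- The largest number of vertices of `U` on a temporal walk during `[a, t]` ending in `v`. -/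
noncomputable def maxVisits {V : Type} (G : ℕ → SimpleGraph V) (U : Finset V) (a t : ℕ) (v : V) :
    ℕ :=
  (U.powerset.filter fun W => ∃ s, Covers G a s t v W).sup Finset.card

section maxVisits

variable {V : Type} {G : ℕ → SimpleGraph V} {U : Finset V} {a b t : ℕ} {s u v : V}

theorem Covers.card_le_maxVisits {W : Finset V} (h : Covers G a s t v W) (hW : W ⊆ U) :
    W.card ≤ maxVisits G U a t v := by
  classical
  exact Finset.le_sup (f := Finset.card)
    (Finset.mem_filter.2 ⟨Finset.mem_powerset.2 hW, s, h⟩)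

theorem exists_covers_maxVisits (G : ℕ → SimpleGraph V) (U : Finset V) (v : V) (h : a ≤ t) :
    ∃ W ⊆ U, (∃ s, Covers G a s t v W) ∧ W.card = maxVisits G U a t v := by
  classical
  obtain ⟨W, hW, hc⟩ := Finset.exists_mem_eq_sup
    (U.powerset.filter fun W => ∃ s, Covers G a s t v W)
    ⟨∅, Finset.mem_filter.2 ⟨by simp, v, (Covers.stay v h).mono (by simp)⟩⟩ Finset.card
  rw [Finset.mem_filter, Finset.mem_powerset] at hW
  exact ⟨W, hW.1, hW.2, hc.symm⟩

theorem maxVisits_le_of_covers {W : Finset V} (h : a ≤ t) (huv : Covers G t u b v W) :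
    maxVisits G U a t u ≤ maxVisits G U a b v := by
  classical
  obtain ⟨W', hW, ⟨s, hs⟩, hc⟩ := exists_covers_maxVisits G U u h
  rw [← hc]
  exact ((hs.trans huv).mono Finset.subset_union_left).card_le_maxVisits hW

end maxVisits

/-- A time window during which `maxVisits` grows little must be short. -/
theorem window_mul_card_le {V : Type} [Fintype V] {G : ℕ → SimpleGraph V} {U I : Finset V}
    {a b τ : ℕ} (hab : a ≤ b) (hG : ∀ t, a ≤ t → (G t).Connected) (d : V → ℕ)
    (hd : ∀ t, a ≤ t → ∀ v, ((G t).neighborSet v).ncard ≤ d v) (hd1 : ∀ v, 1 ≤ d v)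
    (hIU : I ⊆ U) (hI2 : 2 ≤ I.card) (W : V → Finset V)
    (hW : ∀ x, W x ⊆ U ∧ (∃ s, Covers G a s b x (W x)) ∧ (W x).card = maxVisits G U a b x)
    (hI : ∀ x ∈ I, ∀ y ∈ I, x ≠ y → y ∉ W x)
    (hconst : ∀ x ∈ I, maxVisits G U a (b + τ) x = maxVisits G U a b x)
    (hgrow : 2 * ∑ v, d v * maxVisits G U a (b + τ) v ≤
      2 * ∑ v, d v * maxVisits G U a b v + ∑ v, d v) :
    τ * I.card ≤ 7 * ∑ v, d v := by
  classical
  let w : ℕ → V → ℕ := fun t v => maxVisits G U a t v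
  let T : ℕ → V → Finset V := fun t v =>
    I.filter fun x => Covers G b x t v ∅ ∧ w b x = w t v
  let p : ℕ → V → ℕ := fun t v => 3 * w t v + min (T t v).card 2
  have hTI : ∀ t, b ≤ t → t ≤ b + τ → ∀ x ∈ I, T t x = {x} := by
    intro t hbt htτ x hx
    have hwx : w t x = w b x := by
      refine le_antisymm ?_ (maxVisits_le_of_covers hab (Covers.stay x hbt))
      exact (maxVisits_le_of_covers (hab.trans hbt) (Covers.stay x htτ)).trans (hconst x hx).le
    ext y
    simp only [T, Finset.mem_filter, Finset.mem_singleton]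
    constructor
    · rintro ⟨hy, hyc, hyw⟩
      by_contra hne
      obtain ⟨h1, ⟨s, h2⟩, h3⟩ := hW y
      have hxW : x ∉ W y := hI y hy x hx hne
      have hcov : Covers G a s t x (insert x (W y)) :=
        ((h2.trans hyc).trans ((Covers.refl G t x))).mono (by
          intro z hz
          simpa [or_comm] using hz)
      have hle := hcov.card_le_maxVisits (Finset.insert_subset (hIU hx) h1)
      rw [Finset.card_insert_of_notMem hxW, h3] at hle
      have : w b y + 1 ≤ w t x := hle
      omega
    · rintro rfl
      exact ⟨hx, (Covers.stay y hbt).mono (by simp), hwx.symm⟩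
  have hstep : ∀ t, b ≤ t → t < b + τ →
      2 * ∑ v, d v * p t v + I.card ≤ 2 * ∑ v, d v * p (t + 1) v := by
    intro t hbt htτ
    have hwle : ∀ u v, (u = v ∨ (G t).Adj u v) → w t u ≤ w (t + 1) v := fun u v h =>
      maxVisits_le_of_covers (hab.trans hbt) (Covers.step t h)
    have hTle : ∀ u v, (u = v ∨ (G t).Adj u v) → w t u = w (t + 1) v → T t u ⊆ T (t + 1) v := by
      intro u v h hw x hx
      simp only [T, Finset.mem_filter] at hx ⊢
      exact ⟨hx.1, (hx.2.1.trans (Covers.step t h)).mono (by simp), hx.2.2.trans hw⟩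
    have hle := card_le_two_mul_sum_changed (hG t (hab.trans hbt)) d
      (fun v => by
        have := hd t (hab.trans hbt) v
        rwa [← SimpleGraph.coe_neighborFinset, Set.ncard_coe_finset] at this)
      hd1 (w t) (w (t + 1)) (T t) (T (t + 1)) hwle hTle I hI2 (hTI t hbt htτ.le)
    have hsum : ∑ v, d v * p t v + ∑ v ∈ Finset.univ.filter (fun v => p t v < p (t + 1) v), d v
        ≤ ∑ v, d v * p (t + 1) v := by
      rw [Finset.sum_filter, ← Finset.sum_add_distrib]
      refine Finset.sum_le_sum fun v _ => ?_
      have hmono : p t v ≤ p (t + 1) v := by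
        have h1 := hwle v v (Or.inl rfl)
        rcases h1.lt_or_eq with h2 | h2
        · simp only [p]; omega
        · have := Finset.card_le_card (hTle v v (Or.inl rfl) h2)
          simp only [p]; omega
      split_ifs with h
      · calc d v * p t v + d v = d v * (p t v + 1) := by ring
          _ ≤ _ := Nat.mul_le_mul_left _ h
      · simpa using Nat.mul_le_mul_left (d v) hmono
    have hle' : I.card ≤
      2 * ∑ v ∈ Finset.univ.filter (fun v => p t v < p (t + 1) v), d v := hle
    omega
  have htotal : ∀ j ≤ τ, 2 * ∑ v, d v * p b v + j * I.card ≤ 2 * ∑ v, d v * p (b + j) v := by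
    intro j
    induction j with
    | zero => simp
    | succ j ih =>
      intro hj
      have h1 := ih (by omega)
      have h2 := hstep (b + j) (by omega) (by omega)
      rw [add_mul, one_mul, ← add_assoc b j 1]
      omega
  have h1 := htotal τ le_rfl
  have h2 : ∑ v, d v * p (b + τ) v ≤ 3 * ∑ v, d v * w (b + τ) v + 2 * ∑ v, d v := by
    rw [Finset.mul_sum, Finset.mul_sum, ← Finset.sum_add_distrib]
    refine Finset.sum_le_sum fun v _ => ?_
    calc d v * p (b + τ) v ≤ d v * (3 * w (b + τ) v + 2) :=
          Nat.mul_le_mul_left _ (Nat.add_le_add_left (min_le_right _ _) _)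
      _ = _ := by ring
  have h3 : 3 * ∑ v, d v * w b v ≤ ∑ v, d v * p b v := by
    rw [Finset.mul_sum]
    refine Finset.sum_le_sum fun v _ => ?_
    calc 3 * (d v * w b v) = d v * (3 * w b v) := by ring
      _ ≤ _ := Nat.mul_le_mul_left _ (Nat.le_add_right _ _)
  have h4 : 2 * ∑ v, d v * w (b + τ) v ≤ 2 * ∑ v, d v * w b v + ∑ v, d v := hgrow
  omega

theorem exists_small_increment (f : ℕ → ℕ) (c N : ℕ) (hN : 0 < N) (hf : f N ≤ N * c) :
    ∃ i < N, f (i + 1) ≤ f i + c := by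
  by_contra! h
  have : ∀ j ≤ N, j * (c + 1) ≤ f j := by
    intro j
    induction j with
    | zero => simp
    | succ j ih =>
      intro hj
      have h1 := ih (by omega)
      have h2 := h j (by omega)
      rw [add_mul, one_mul]
      omega
  have := this N le_rfl
  rw [mul_add] at this
  omega

/-- In `4 * l * τ` time steps some temporal walk visits `l` vertices of `U`. -/
theorem exists_covers_card_ge {V : Type} [Fintype V] {G : ℕ → SimpleGraph V} {U : Finset V}
    {a l τ : ℕ} (hG : ∀ t, a ≤ t → (G t).Connected) (d : V → ℕ)
    (hd : ∀ t, a ≤ t → ∀ v, ((G t).neighborSet v).ncard ≤ d v) (hd1 : ∀ v, 1 ≤ d v)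
    (hl : 0 < l) (hU : 2 * (2 * l + 1) < U.card)
    (hτ : 14 * (2 * l + 1) * ∑ v, d v < U.card * τ) :
    ∃ s v W, W ⊆ U ∧ Covers G a s (a + 4 * l * τ) v W ∧ l ≤ W.card := by
  classical
  by_contra! hno
  let w : ℕ → V → ℕ := fun i v => maxVisits G U a (a + i * τ) v
  have hwmono : ∀ i j, i ≤ j → ∀ v, w i v ≤ w j v := fun i j hij v =>
    maxVisits_le_of_covers (Nat.le_add_right _ _)
      (Covers.stay v (Nat.add_le_add_left (Nat.mul_le_mul_right _ hij) _))
  have hwl : ∀ i ≤ 4 * l, ∀ v, w i v ≤ l := by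
    intro i hi v
    refine (hwmono i (4 * l) hi v).trans ?_
    obtain ⟨W, hWU, ⟨s, hs⟩, hc⟩ :=
      exists_covers_maxVisits G U v (Nat.le_add_right a (4 * l * τ))
    exact hc.symm.trans_le (hno s v W hWU hs).le
  set M := ∑ v, d v with hM
  let f : ℕ → ℕ := fun i => 2 * (U.card * ∑ v, d v * w i v + M * ∑ v ∈ U, w i v)
  have hMpos : 0 < M := by
    obtain ⟨x, -⟩ : U.Nonempty := Finset.card_pos.1 (by omega)
    exact Finset.sum_pos (fun v _ => hd1 v) ⟨x, Finset.mem_univ x⟩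
  obtain ⟨i, hi, hfi⟩ := exists_small_increment f (M * U.card) (4 * l) (by omega) (by
    have h1 : ∑ v, d v * w (4 * l) v ≤ M * l := by
      rw [hM, Finset.sum_mul]
      exact Finset.sum_le_sum fun v _ => Nat.mul_le_mul_left _ (hwl _ le_rfl v)
    have h2 : ∑ v ∈ U, w (4 * l) v ≤ U.card * l := by
      simpa using Finset.sum_le_card_nsmul U (w (4 * l)) l fun v _ => hwl _ le_rfl v
    calc f (4 * l) ≤ 2 * (U.card * (M * l) + M * (U.card * l)) := by
          simp only [f]; gcongr
      _ = _ := by ring)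
  have hd_le : ∑ v, d v * w i v ≤ ∑ v, d v * w (i + 1) v :=
    Finset.sum_le_sum fun v _ => Nat.mul_le_mul_left _ (hwmono _ _ (Nat.le_succ i) v)
  have hu_le : ∑ v ∈ U, w i v ≤ ∑ v ∈ U, w (i + 1) v :=
    Finset.sum_le_sum fun v _ => hwmono _ _ (Nat.le_succ i) v
  have hd_grow : 2 * ∑ v, d v * w (i + 1) v ≤ 2 * ∑ v, d v * w i v + M := by
    simp only [f] at hfi
    have : U.card * (2 * ∑ v, d v * w (i + 1) v) ≤ U.card * (2 * ∑ v, d v * w i v + M) := by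
      have := Nat.mul_le_mul_left M hu_le
      nlinarith
    exact Nat.le_of_mul_le_mul_left this (by omega)
  have hu_grow : 2 * ∑ v ∈ U, w (i + 1) v ≤ 2 * ∑ v ∈ U, w i v + U.card := by
    simp only [f] at hfi
    have : M * (2 * ∑ v ∈ U, w (i + 1) v) ≤ M * (2 * ∑ v ∈ U, w i v + U.card) := by
      have := Nat.mul_le_mul_left U.card hd_le
      nlinarith
    exact Nat.le_of_mul_le_mul_left this hMpos
  let S := U.filter fun v => w (i + 1) v = w i v
  have hS : U.card ≤ 2 * S.card := by
    have h1 : ∑ v ∈ U, w i v + (U.filter fun v => ¬ w (i + 1) v = w i v).card ≤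
        ∑ v ∈ U, w (i + 1) v := by
      rw [Finset.card_filter, ← Finset.sum_add_distrib]
      refine Finset.sum_le_sum fun v _ => ?_
      have := hwmono i (i + 1) (Nat.le_succ i) v
      split_ifs with h <;> omega
    have h2 := Finset.card_filter_add_card_filter_not (s := U) (fun v => w (i + 1) v = w i v)
    simp only [S]
    omega
  choose W hW using fun v => exists_covers_maxVisits G U v (Nat.le_add_right a (i * τ))
  obtain ⟨I, hIS, hI, hcard⟩ := exists_independent_subset W l
    (fun v => (hW v).2.2.trans_le (hwl i hi.le v)) S
  have hsucc : a + (i + 1) * τ = a + i * τ + τ := by ring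
  have hfinal := window_mul_card_le (τ := τ) (Nat.le_add_right a (i * τ)) hG d hd hd1
    (hIS.trans (Finset.filter_subset _ _)) (by
      by_contra hlt
      have : I.card * (2 * l + 1) ≤ 1 * (2 * l + 1) := Nat.mul_le_mul_right _ (by omega)
      omega) W hW hI
    (fun x hx => by
      have := (Finset.mem_filter.1 (hIS hx)).2
      simpa only [w, hsucc] using this)
    (by simpa only [w, hsucc] using hd_grow)
  have h1 : U.card * τ ≤ 2 * (2 * l + 1) * (τ * I.card) := by
    calc U.card * τ ≤ (2 * (I.card * (2 * l + 1))) * τ := Nat.mul_le_mul_right _ (by omega)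
      _ = _ := by ring
  have h2 := Nat.mul_le_mul_left (2 * (2 * l + 1)) hfinal
  nlinarith

/-- One round of exploration: some number of vertices proportional to `√(card U)` can be visited
in linear time. -/
theorem exists_covers_round {V : Type} [Fintype V] {G : ℕ → SimpleGraph V} {U : Finset V} {a : ℕ}
    (hG : ∀ t, a ≤ t → (G t).Connected) (d : V → ℕ)
    (hd : ∀ t, a ≤ t → ∀ v, ((G t).neighborSet v).ncard ≤ d v) (hd1 : ∀ v, 1 ≤ d v) {D : ℕ}
    (hD : ∑ v, d v ≤ D * Fintype.card V) (hU : U.Nonempty) (s : V) :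
    ∃ b v W, W ⊆ U ∧ Covers G a s b v W ∧ b ≤ a + (168 * D + 5) * Fintype.card V ∧
      U.card ≤ (5 * W.card) ^ 2 := by
  classical
  set n := Fintype.card V
  set k := U.card with hk
  have hkn : k ≤ n := Finset.card_le_univ U
  have hkpos : 0 < k := Finset.card_pos.2 hU
  by_cases hsmall : k ≤ 25
  · obtain ⟨x, hx⟩ := hU
    refine ⟨a + n, x, {x}, by simpa using hx, covers_card_steps hG s x, ?_, by simpa using hsmall⟩
    nlinarith
  · set l := Nat.sqrt k with hl
    have hl1 : l * l ≤ k := Nat.sqrt_le k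
    have hl2 : k < (l + 1) * (l + 1) := Nat.lt_succ_sqrt k
    have hl5 : 5 ≤ l := by
      by_contra hlt
      have : (l + 1) * (l + 1) ≤ 5 * 5 := Nat.mul_le_mul (by omega) (by omega)
      omega
    set τ := 14 * (2 * l + 1) * (∑ v, d v) / k + 1 with hτ
    have hτ1 : 14 * (2 * l + 1) * ∑ v, d v < k * τ := Nat.lt_mul_div_succ _ hkpos
    have hτ2 : k * τ ≤ 14 * (2 * l + 1) * (∑ v, d v) + k := by
      rw [hτ, mul_add, mul_one]
      exact Nat.add_le_add_right (Nat.mul_div_le _ _) _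
    have htime : 4 * l * τ ≤ (168 * D + 4) * n := by
      have h1 : 14 * (2 * l + 1) * (∑ v, d v) ≤ 42 * l * (D * n) :=
        Nat.mul_le_mul (by omega) hD
      refine Nat.le_of_mul_le_mul_left (c := k) ?_ hkpos
      calc k * (4 * l * τ) = 4 * l * (k * τ) := by ring
        _ ≤ 4 * l * (42 * l * (D * n) + k) := Nat.mul_le_mul_left _ (hτ2.trans (by omega))
        _ = (l * l) * (168 * (D * n)) + k * (4 * l) := by ring
        _ ≤ k * (168 * (D * n)) + k * (4 * n) := by
          gcongr
          nlinarith
        _ = _ := by ring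
    obtain ⟨x, v, W, hWU, hW, hlW⟩ := exists_covers_card_ge (a := a + n) (U := U)
      (fun t ht => hG t (by omega)) d (fun t ht => hd t (by omega)) hd1 (by omega : 0 < l)
      (by nlinarith) hτ1
    refine ⟨a + n + 4 * l * τ, v, W, hWU,
      ((covers_card_steps hG s x).trans hW).mono Finset.subset_union_right, ?_, ?_⟩
    · linarith
    · have : (l + 1) * (l + 1) ≤ (5 * W.card) * (5 * W.card) :=
        Nat.mul_le_mul (by omega) (by omega)
      rw [sq]
      omega

/-- Exploration time for always-connected temporal graphs of average degree at most `D`. -/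
theorem exists_covers_sqrt {V : Type} [Fintype V] {G : ℕ → SimpleGraph V}
    (hG : ∀ t, 1 ≤ t → (G t).Connected) (d : V → ℕ)
    (hd : ∀ t, 1 ≤ t → ∀ v, ((G t).neighborSet v).ncard ≤ d v) (hd1 : ∀ v, 1 ≤ d v) {D : ℕ}
    (hD : ∑ v, d v ≤ D * Fintype.card V) (U : Finset V) :
    ∀ a, 1 ≤ a → ∀ s, ∃ b v, Covers G a s b v U ∧
      (b : ℝ) ≤ a + 10 * (168 * D + 5) * Fintype.card V * √(U.card) := by
  classical
  induction U using Finset.strongInduction with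
  | H U ih =>
    intro a ha s
    rcases U.eq_empty_or_nonempty with rfl | hU
    · exact ⟨a, s, (Covers.refl G a s).mono (by simp), by simp⟩
    obtain ⟨b, v, W, hWU, hW, hb, hUW⟩ := exists_covers_round
      (fun t ht => hG t (ha.trans ht)) d (fun t ht => hd t (ha.trans ht)) hd1 hD hU s
    have hUpos : 0 < U.card := Finset.card_pos.2 hU
    have hWne : W.Nonempty := by
      rw [Finset.nonempty_iff_ne_empty]
      rintro rfl
      rw [Finset.card_empty] at hUW
      omega
    obtain ⟨c, u, hcov, hc⟩ := ih (U \ W) (Finset.sdiff_ssubset hWU hWne) b (ha.trans hW.1) v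
    refine ⟨c, u, (hW.trans hcov).mono (by simp), hc.trans ?_⟩
    have hcard : ((U \ W).card : ℝ) + W.card = U.card := by
      exact_mod_cast Finset.card_sdiff_add_card_eq_card hWU
    have hsqrt : √(U.card) ≤ 5 * W.card :=
      Real.sqrt_le_iff.2 ⟨by positivity, by exact_mod_cast hUW⟩
    have hpos : 0 < √(U.card : ℝ) := Real.sqrt_pos.2 (by exact_mod_cast hUpos)
    have hle : √((U \ W).card : ℝ) ≤ √(U.card) := Real.sqrt_le_sqrt (by
      exact_mod_cast Finset.card_le_card Finset.sdiff_subset)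
    have h1 : √(U.card : ℝ) ^ 2 = U.card := Real.sq_sqrt (by positivity)
    have h2 : √((U \ W).card : ℝ) ^ 2 = (U \ W).card := Real.sq_sqrt (by positivity)
    have hdrop : √((U \ W).card : ℝ) + 1 / 10 ≤ √(U.card) := by
      by_contra! hlt
      have := Real.sqrt_nonneg ((U \ W).card : ℝ)
      nlinarith
    have hbR : (b : ℝ) ≤ a + (168 * D + 5) * Fintype.card V := by exact_mod_cast hb
    have hK : (0 : ℝ) ≤ 10 * (168 * D + 5) * Fintype.card V := by positivity
    have := mul_le_mul_of_nonneg_left hdrop hK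
    linarith

/-- There is an absolute constant `C > 0` such that any always-connected
temporal graph `(G_t)_{t ≥ 1}` on `n ≥ 2` vertices whose underlying graph is planar
admits, from any start vertex `s`, a temporal exploration spanning at most
`C · n^{3/2} · √(log₂ n)` time steps. -/
theorem temporal_exploration_planar :
    ∃ C : ℝ, 0 < C ∧
      ∀ (V : Type) [Fintype V] (G : ℕ → SimpleGraph V),
        2 ≤ Fintype.card V →
        (∀ t : ℕ, 1 ≤ t → (G t).Connected) →
        IsPlanar (⨆ t : ℕ, ⨆ _ : 1 ≤ t, G t : SimpleGraph V) →
        ∀ s : V, ∃ (r : ℕ) (w : ℕ → V),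
          w 1 = s ∧
          (∀ t : ℕ, 1 ≤ t → t ≤ r → (w t = w (t + 1) ∨ (G t).Adj (w t) (w (t + 1)))) ∧
          (∀ v : V, ∃ t : ℕ, 1 ≤ t ∧ t ≤ r + 1 ∧ w t = v) ∧
          (r : ℝ) ≤ C * (Fintype.card V : ℝ) ^ (3/2 : ℝ) *
            Real.sqrt (Real.logb 2 (Fintype.card V)) := by
  classical
  refine ⟨53810, by norm_num, fun V _ G hn hG hplanar s => ?_⟩
  set H : SimpleGraph V := ⨆ t : ℕ, ⨆ _ : 1 ≤ t, G t with hH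
  have hle : ∀ t, 1 ≤ t → G t ≤ H := fun t ht => le_iSup₂_of_le t ht le_rfl
  have hmono : ∀ t, 1 ≤ t → ∀ v, ((G t).neighborSet v).ncard ≤ (H.neighborSet v).ncard :=
    fun t ht v => Set.ncard_le_ncard (fun _ hu => hle t ht hu) (Set.toFinite _)
  have hpos : ∀ v, 1 ≤ (H.neighborSet v).ncard := by
    intro v
    have : Nontrivial V := Fintype.one_lt_card_iff_nontrivial.1 hn
    obtain ⟨u, hu⟩ := (hG 1 le_rfl).preconnected.exists_adj_of_nontrivial v
    exact (Set.ncard_pos (Set.toFinite _)).2 ⟨u, hle 1 le_rfl hu⟩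
  have hsum : ∑ v, (H.neighborSet v).ncard ≤ 32 * Fintype.card V := by
    by_contra! hlt
    have : Nonempty V := ⟨s⟩
    rw [← numDarts_eq_sum] at hlt
    exact hplanar.1 (hasMinor_top_of_le_numDarts 4 V H hlt.le)
  obtain ⟨b, v, ⟨hb, w, hw1, -, hw2, hw3⟩, hbound⟩ :=
    exists_covers_sqrt hG _ hmono hpos hsum Finset.univ 1 le_rfl s
  refine ⟨b - 1, w, hw1, fun t ht htb => hw2 t ht (by omega), fun v => ?_, ?_⟩
  · obtain ⟨t, ht1, ht2, ht3⟩ := hw3 v (Finset.mem_univ v)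
    exact ⟨t, ht1, by omega, ht3⟩
  · rw [Finset.card_univ] at hbound
    rw [Nat.cast_sub hb]
    have hn2 : (2 : ℝ) ≤ Fintype.card V := by exact_mod_cast hn
    set n : ℝ := (Fintype.card V : ℝ)
    have hrpow : n ^ (3 / 2 : ℝ) = n * √n := by
      rw [Real.sqrt_eq_rpow, ← Real.rpow_one_add' (by linarith) (by norm_num)]
      norm_num
    have hlog : 1 ≤ √(Real.logb 2 n) := by
      rw [Real.one_le_sqrt, Real.le_logb_iff_rpow_le one_lt_two (by linarith), Real.rpow_one]
      exact hn2
    rw [hrpow]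
    have h0 : 0 ≤ 53810 * (n * √n) := by positivity
    have h1 := le_mul_of_one_le_right h0 hlog
    push_cast at hbound ⊢
    linarith
end
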